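/- arXiv:math/0611829 — 3 statements merged into one kernel-verified Lean document; each statement's English description precedes it below -/
import Mathlib

section
/- For every integer d ≥ 2 there exists a constant m = m(d) ∈ ℕ with the following property: if Σ ⊆ SL_d(ℤ) is a symmetric subset with 1 ∈ Σ and Σ = Σ⁻¹ such that the subgroup generated by Σ is Zariski dense in SL_d, then Σ^m contains two independent elements, i.e. two elements that freely generate a free subgroup of rank 2. -/
open scoped Pointwise

/-- Two elements of a group freely generate a free subgroup of rank 2. -/
def FreelyGens {G : Type*} [Group G] (x y : G) : Prop :=
  Function.Injective ⇑(FreeGroup.lift (fun b : Bool => if b then x else y))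

/-- A subgroup of `SL_d(ℤ)` is Zariski dense in `SL_d` if every polynomial with rational
coefficients in the matrix entries vanishing on the subgroup vanishes on all of `SL_d(ℂ)`. -/
def ZariskiDenseSLZ (d : ℕ) (Δ : Subgroup (Matrix.SpecialLinearGroup (Fin d) ℤ)) : Prop :=
  ∀ p : MvPolynomial (Fin d × Fin d) ℚ,
    (∀ γ ∈ Δ, MvPolynomial.aeval
        (fun ij : Fin d × Fin d =>
          (((γ : Matrix (Fin d) (Fin d) ℤ) ij.1 ij.2 : ℤ) : ℚ)) p = 0) →
    ∀ g : Matrix.SpecialLinearGroup (Fin d) ℂ,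
      MvPolynomial.aeval
        (fun ij : Fin d × Fin d => (g : Matrix (Fin d) (Fin d) ℂ) ij.1 ij.2) p = 0

section SpecialLinear

open Matrix
open scoped MatrixGroups

section TensorPower

variable {d : ℕ} {R : Type*} [CommRing R]

/-- The block diagonal matrix `1 ⊕ x`. -/
def oneSum (x : Matrix (Fin d) (Fin d) R) : Matrix (Option (Fin d)) (Option (Fin d)) R
  | none, none => 1
  | some i, some j => x i j
  | none, some _ => 0
  | some _, none => 0

/-- The `D`-th Kronecker power of `1 ⊕ x`; its entries are all the monomials of degree at most `D`
in the entries of `x`. -/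
def tpow (D : ℕ) (x : Matrix (Fin d) (Fin d) R) :
    Matrix (Fin D → Option (Fin d)) (Fin D → Option (Fin d)) R :=
  Matrix.of fun ι κ => ∏ a, oneSum x (ι a) (κ a)

lemma oneSum_mul (x y : Matrix (Fin d) (Fin d) R) : oneSum (x * y) = oneSum x * oneSum y := by
  ext (_ | i) (_ | j) <;> simp [oneSum, Matrix.mul_apply, Fintype.sum_option]

lemma oneSum_map {R' : Type*} [CommRing R'] (f : R →+* R') (x : Matrix (Fin d) (Fin d) R) (i j) :
    oneSum (x.map f) i j = f (oneSum x i j) := by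
  rcases i with _ | i <;> rcases j with _ | j <;> simp [oneSum]

lemma oneSum_transpose (x : Matrix (Fin d) (Fin d) R) (i j) : oneSum xᵀ i j = oneSum x j i := by
  rcases i with _ | i <;> rcases j with _ | j <;> simp [oneSum]

lemma tpow_mul (D : ℕ) (x y : Matrix (Fin d) (Fin d) R) :
    tpow D (x * y) = tpow D x * tpow D y := by
  ext ι κ
  simp only [tpow, Matrix.of_apply, oneSum_mul, Matrix.mul_apply, ← Finset.prod_mul_distrib]
  rw [Finset.prod_univ_sum]
  simp [Fintype.piFinset_univ]

lemma tpow_map (D : ℕ) {R' : Type*} [CommRing R'] (f : R →+* R') (x : Matrix (Fin d) (Fin d) R) :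
    tpow D (x.map f) = (tpow D x).map f := by
  ext ι κ
  simp [tpow, oneSum_map]

lemma tpow_transpose (D : ℕ) (x : Matrix (Fin d) (Fin d) R) : tpow D xᵀ = (tpow D x)ᵀ := by
  ext ι κ
  simp [tpow, oneSum_transpose]

lemma totalDegree_oneSum_le (i j : Option (Fin d)) :
    (oneSum (mvPolynomialX (Fin d) (Fin d) ℚ) i j).totalDegree ≤ 1 := by
  rcases i with _ | i <;> rcases j with _ | j <;> simp [oneSum, MvPolynomial.totalDegree_X]

lemma totalDegree_tpow_le (D : ℕ) (ι κ : Fin D → Option (Fin d)) :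
    (tpow D (mvPolynomialX (Fin d) (Fin d) ℚ) ι κ).totalDegree ≤ D := by
  simp only [tpow, Matrix.of_apply]
  refine (MvPolynomial.totalDegree_finsetProd _ _).trans ?_
  refine (Finset.sum_le_sum fun a _ => totalDegree_oneSum_le (ι a) (κ a)).trans ?_
  simp

/-- A polynomial of degree at most `D` in the matrix entries is a linear function of `tpow D`. -/
lemma exists_eval_eq_trace_tpow (D : ℕ) (p : MvPolynomial (Fin d × Fin d) R)
    (hp : p.totalDegree ≤ D) :
    ∃ A : Matrix (Fin D → Option (Fin d)) (Fin D → Option (Fin d)) R,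
      ∀ x : Matrix (Fin d) (Fin d) R,
        MvPolynomial.eval (fun ij => x ij.1 ij.2) p = (A * tpow D x).trace := by
  classical
  have hmon : ∀ (n : ℕ) (l : List (Fin d × Fin d)), l.length ≤ n →
      ∃ ι κ : Fin n → Option (Fin d), ∀ x : Matrix (Fin d) (Fin d) R,
        tpow n x ι κ = (l.map fun ij => x ij.1 ij.2).prod := by
    intro n
    induction n with
    | zero =>
      intro l hl
      obtain rfl : l = [] := by simpa using hl
      exact ⟨fun _ => none, fun _ => none, fun x => by simp [tpow]⟩
    | succ n ih =>
      intro l hl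
      rcases l with _ | ⟨e, l⟩
      · exact ⟨fun _ => none, fun _ => none, fun x => by simp [tpow, oneSum]⟩
      · obtain ⟨ι, κ, h⟩ := ih l (by simpa using hl)
        refine ⟨Fin.cons (some e.1) ι, Fin.cons (some e.2) κ, fun x => ?_⟩
        rw [List.map_cons, List.prod_cons, ← h x]
        simp [tpow, Fin.prod_univ_succ, oneSum]
  have hs : ∀ s ∈ p.support, ∃ ικ : (Fin D → Option (Fin d)) × (Fin D → Option (Fin d)),
      ∀ x : Matrix (Fin d) (Fin d) R,
        tpow D x ικ.1 ικ.2 = s.prod fun ij n => x ij.1 ij.2 ^ n := by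
    intro s hs
    obtain ⟨ι, κ, h⟩ := hmon D s.toMultiset.toList (by
      rw [Multiset.length_toList, Finsupp.card_toMultiset]
      exact (MvPolynomial.le_totalDegree hs).trans hp)
    refine ⟨(ι, κ), fun x => ?_⟩
    rw [h x, ← Multiset.prod_coe, ← Multiset.map_coe, Multiset.coe_toList, Finsupp.toMultiset_map,
      Finsupp.prod_toMultiset, Finsupp.prod_mapDomain_index (by simp) (by simp [pow_add])]
  choose! f hf using hs
  refine ⟨∑ s ∈ p.support, Matrix.single (f s).2 (f s).1 (p.coeff s), fun x => ?_⟩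
  rw [MvPolynomial.eval_eq, Finset.sum_mul, Matrix.trace_sum]
  refine Finset.sum_congr rfl fun s hs => ?_
  rw [Matrix.trace_single_mul, hf s hs x]
  simp [Finsupp.prod]

end TensorPower

section Frame

lemma mem_submonoid_closure_of_symm {G : Type*} [Group G] {S : Set G} (hS : S⁻¹ = S) {γ : G}
    (hγ : γ ∈ Subgroup.closure S) : γ ∈ Submonoid.closure S := by
  rw [← Subgroup.mem_toSubmonoid, Subgroup.closure_toSubmonoid, hS, Set.union_self] at hγ
  exact hγ

/-- The linear span of a finite dimensional representation of a group generated by `S` is spanned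
by words of length bounded by the dimension. -/
lemma mem_span_image_pow {G A : Type*} [Group G] [Ring A] [Algebra ℚ A] [FiniteDimensional ℚ A]
    (f : G → A) (hf : ∀ x y, f (x * y) = f x * f y) {S : Set G} (h1 : 1 ∈ S) (hS : S⁻¹ = S)
    {γ : G} (hγ : γ ∈ Subgroup.closure S) :
    f γ ∈ Submodule.span ℚ (f '' (S ^ Module.finrank ℚ A)) := by
  set U : ℕ → Submodule ℚ A := fun j => Submodule.span ℚ (f '' (S ^ j)) with hU
  have hmono : ∀ {i j}, i ≤ j → U i ≤ U j := fun h =>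
    Submodule.span_mono (Set.image_mono (Set.pow_subset_pow_right h1 h))
  obtain ⟨j, hj, hjj⟩ : ∃ j ≤ Module.finrank ℚ A, U j = U (j + 1) := by
    by_contra! hne
    have hlt : ∀ j ≤ Module.finrank ℚ A + 1, j ≤ Module.finrank ℚ (U j) := by
      intro j
      induction j with
      | zero => simp
      | succ j ih =>
        intro hj
        have := Submodule.finrank_lt_finrank_of_lt
          (lt_of_le_of_ne (hmono (Nat.le_succ j) : U j ≤ U (j + 1)) (hne j (by omega)))
        have := ih (by omega)
        omega
    have h1 := hlt _ le_rfl
    have h2 := Submodule.finrank_le (U (Module.finrank ℚ A + 1))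
    omega
  have hstep : ∀ s ∈ S, ∀ u ∈ U j, f s * u ∈ U j := by
    intro s hs u hu
    induction hu using Submodule.span_induction with
    | mem x hx =>
      obtain ⟨t, ht, rfl⟩ := hx
      rw [← hf, hjj, hU]
      refine Submodule.subset_span ⟨s * t, ?_, rfl⟩
      rw [pow_succ']
      exact Set.mul_mem_mul hs ht
    | zero => simp
    | add x y _ _ hx hy => rw [mul_add]; exact add_mem hx hy
    | smul c x _ hx => rw [mul_smul_comm]; exact Submodule.smul_mem _ _ hx
  have h1j : f 1 ∈ U j :=
    Submodule.subset_span ⟨1, Set.one_mem_pow h1, rfl⟩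
  refine hmono hj ?_
  have hγ' := mem_submonoid_closure_of_symm hS hγ
  induction hγ' using Submonoid.closure_induction_left with
  | one => exact h1j
  | mul_left s hs y hy ih =>
    rw [hf]
    exact hstep s hs _ (ih (by
      have : Submonoid.closure S ≤ (Subgroup.closure S).toSubmonoid :=
        Submonoid.closure_le.2 Subgroup.subset_closure
      exact this hy))

variable {d : ℕ}

/-- Every polynomial of degree at most `D` vanishing on `Γ` vanishes on `SL_d(ℂ)`. -/
def DenseUpTo (D : ℕ) (Γ : Subgroup SL(d, ℤ)) : Prop :=
  ∀ p : MvPolynomial (Fin d × Fin d) ℚ, p.totalDegree ≤ D →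
    (∀ γ ∈ Γ, MvPolynomial.aeval (fun ij : Fin d × Fin d => ((γ.1 ij.1 ij.2 : ℤ) : ℚ)) p = 0) →
    ∀ g : SL(d, ℂ), MvPolynomial.aeval (fun ij : Fin d × Fin d => g.1 ij.1 ij.2) p = 0

lemma DenseUpTo.mono {D D' : ℕ} (h : D ≤ D') {Γ : Subgroup SL(d, ℤ)} (hΓ : DenseUpTo D' Γ) :
    DenseUpTo D Γ := fun p hp => hΓ p (hp.trans h)

/-- The rational matrix underlying an element of `SL_d(ℤ)`. -/
abbrev ratMat (γ : SL(d, ℤ)) : Matrix (Fin d) (Fin d) ℚ := γ.1.map (Int.castRingHom ℚ)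

/-- The complex matrix underlying an element of `SL_d(ℤ)`. -/
abbrev complexMat (γ : SL(d, ℤ)) : Matrix (Fin d) (Fin d) ℂ := γ.1.map (Int.castRingHom ℂ)

lemma ratMat_mul (γ γ' : SL(d, ℤ)) : ratMat (γ * γ') = ratMat γ * ratMat γ' := by
  simp only [ratMat, Matrix.SpecialLinearGroup.coe_mul]
  exact Matrix.map_mul

lemma complexMat_mul (γ γ' : SL(d, ℤ)) : complexMat (γ * γ') = complexMat γ * complexMat γ' := by
  simp only [complexMat, Matrix.SpecialLinearGroup.coe_mul]
  exact Matrix.map_mul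

lemma complexMat_eq_map (γ : SL(d, ℤ)) :
    complexMat γ = (ratMat γ).map (algebraMap ℚ ℂ) := by
  ext i j; simp

lemma DenseUpTo.trace_eq_zero {D : ℕ} {Γ : Subgroup SL(d, ℤ)} (h : DenseUpTo D Γ)
    (A : Matrix (Fin D → Option (Fin d)) (Fin D → Option (Fin d)) ℚ)
    (hA : ∀ γ ∈ Γ, (A * tpow D (ratMat γ)).trace = 0) (x : SL(d, ℂ)) :
    (A.map (algebraMap ℚ ℂ) * tpow D x.1).trace = 0 := by
  set p : MvPolynomial (Fin d × Fin d) ℚ :=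
    ∑ i, ∑ j, MvPolynomial.C (A i j) * tpow D (mvPolynomialX (Fin d) (Fin d) ℚ) j i with hp
  have hev : ∀ (R : Type) [CommRing R] [Algebra ℚ R] (y : Matrix (Fin d) (Fin d) R),
      MvPolynomial.aeval (fun ij : Fin d × Fin d => y ij.1 ij.2) p =
        (A.map (algebraMap ℚ R) * tpow D y).trace := by
    intro R _ _ y
    have hy := mvPolynomialX_mapMatrix_aeval ℚ y
    simp only [hp, map_sum, map_mul, Matrix.trace, Matrix.diag, Matrix.mul_apply]
    refine Finset.sum_congr rfl fun i _ => Finset.sum_congr rfl fun j _ => ?_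
    congr 1
    · simp
    · conv_rhs => rw [← hy]
      have := congrFun (congrFun (tpow_map D (MvPolynomial.aeval
        (fun ij : Fin d × Fin d => y ij.1 ij.2) : _ →ₐ[ℚ] R).toRingHom
        (mvPolynomialX (Fin d) (Fin d) ℚ)) j) i
      exact this.symm
  rw [← hev ℂ x.1]
  refine h p ?_ ?_ x
  · refine MvPolynomial.totalDegree_finsetSum_le fun i _ =>
      MvPolynomial.totalDegree_finsetSum_le fun j _ => ?_
    refine (MvPolynomial.totalDegree_mul _ _).trans ?_
    simpa using totalDegree_tpow_le D j i
  · intro γ hγ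
    have := hev ℚ (ratMat γ)
    simp only [Matrix.map_apply, Int.coe_castRingHom] at this
    rw [this]
    simpa using hA γ hγ

/-- The algebra in which `tpow D` takes its values, over `ℚ`. -/
abbrev TMat (d D : ℕ) : Type := Matrix (Fin D → Option (Fin d)) (Fin D → Option (Fin d)) ℚ

/-- The Gram matrix of a family in `SL_d(ℤ)` for the pairing `tr (tpow D (x * y))`. -/
def tensorGram {r : ℕ} (D : ℕ) (γ : Fin r → SL(d, ℤ)) : Matrix (Fin r) (Fin r) ℤ :=
  Matrix.of fun i j => (tpow D (γ i * γ j).1).trace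

/-- Words of bounded length span `tpow D (SL_d(ℂ))`, with explicit coefficients. -/
theorem exists_frame (d D : ℕ) :
    ∃ N : ℕ, ∀ S : Set SL(d, ℤ), 1 ∈ S → S⁻¹ = S → DenseUpTo D (Subgroup.closure S) →
      ∃ r ≤ N, ∃ γ : Fin r → SL(d, ℤ), (∀ i, γ i ∈ S ^ N) ∧ (tensorGram D γ).det ≠ 0 ∧
        ∀ x : SL(d, ℂ), tpow D x.1 = ∑ j, (∑ i, (tpow D (x.1 * complexMat (γ i))).trace *
          ((tensorGram D γ).map (Int.castRingHom ℂ))⁻¹ i j) • tpow D (complexMat (γ j)) := by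
  classical
  refine ⟨Module.finrank ℚ (TMat d D), fun S h1 hS hd => ?_⟩
  set f : SL(d, ℤ) → TMat d D := fun γ => tpow D (ratMat γ) with hf
  have hfm : ∀ x y, f (x * y) = f x * f y := fun x y => by
    simp only [hf]; rw [ratMat_mul, tpow_mul]
  obtain ⟨b, hbm, hbs, hbl⟩ := Submodule.exists_fun_fin_finrank_span_eq ℚ
    (f '' (S ^ Module.finrank ℚ (TMat d D)))
  choose γ hγ hγb using hbm
  have hspan : ∀ x ∈ Subgroup.closure S, f x ∈ Submodule.span ℚ (Set.range b) := fun x hx => by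
    rw [hbs]; exact mem_span_image_pow f hfm h1 hS hx
  have hgram : ∀ i j, (tensorGram D γ i j : ℚ) = (b i * b j).trace := by
    intro i j
    rw [← hγb, ← hγb, ← hfm]
    simp only [hf, tensorGram, Matrix.of_apply, ratMat]
    rw [tpow_map, Matrix.trace, Matrix.trace]
    simp
  have hdet : (tensorGram D γ).det ≠ 0 := by
    intro h0
    have h0' : ((tensorGram D γ).map (Int.castRingHom ℚ)).det = 0 := by
      have := (Int.castRingHom ℚ).map_det (tensorGram D γ)
      rw [h0] at this
      simpa using this.symm
    obtain ⟨c, hc, hc0⟩ := Matrix.exists_mulVec_eq_zero_iff.2 h0'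
    set v : TMat d D := ∑ i, c i • b i with hv
    have hbv : ∀ i, (v * b i).trace = 0 := by
      intro i
      have := congrFun hc0 i
      simp only [Matrix.mulVec, dotProduct, Matrix.map_apply, Int.coe_castRingHom, hgram,
        Pi.zero_apply] at this
      rw [Matrix.trace_mul_comm, hv, Finset.mul_sum, Matrix.trace_sum, ← this]
      refine Finset.sum_congr rfl fun j _ => ?_
      rw [mul_smul_comm, Matrix.trace_smul, smul_eq_mul, mul_comm]
    have hxv : ∀ x ∈ Subgroup.closure S, (v * f x).trace = 0 := by
      intro x hx
      have := hspan x hx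
      generalize f x = z at this
      induction this using Submodule.span_induction with
      | mem y hy => obtain ⟨i, rfl⟩ := hy; exact hbv i
      | zero => simp
      | add y z _ _ hy hz => rw [mul_add, Matrix.trace_add, hy, hz, add_zero]
      | smul a y _ hy => rw [mul_smul_comm, Matrix.trace_smul, hy, smul_zero]
    have htr : ∀ i, (v * (b i)ᵀ).trace = 0 := by
      intro i
      have := hd.trace_eq_zero v hxv
        ((γ i).transpose.map (Int.castRingHom ℂ))
      have h2 : ((γ i).transpose.map (Int.castRingHom ℂ)).1 =
          ((ratMat (γ i))ᵀ).map (algebraMap ℚ ℂ) := by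
        ext a c; simp
      rw [h2, tpow_map, tpow_transpose] at this
      have h3 := hγb i
      simp only [hf] at h3
      rw [h3, ← Matrix.map_mul] at this
      have h4 : (algebraMap ℚ ℂ) ((v * (b i)ᵀ).trace) = 0 := by
        rw [← this, Matrix.trace, Matrix.trace, map_sum]; rfl
      simpa using h4
    have hvv : (v * vᵀ).trace = 0 := by
      conv_lhs => arg 1; arg 2; rw [hv]
      rw [Matrix.transpose_sum, Finset.mul_sum, Matrix.trace_sum]
      refine Finset.sum_eq_zero fun i _ => ?_
      rw [Matrix.transpose_smul, mul_smul_comm, Matrix.trace_smul, htr, smul_zero]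
    have hv0 : v = 0 := by
      have := Matrix.trace_mul_conjTranspose_self_eq_zero_iff (A := v)
      rw [Matrix.conjTranspose_eq_transpose_of_trivial] at this
      exact this.1 hvv
    exact hc (funext fun i => Fintype.linearIndependent_iff.1 hbl c hv0 i)
  refine ⟨_, Submodule.finrank_le _, γ, hγ, hdet, fun x => ?_⟩
  set G := (tensorGram D γ).map (Int.castRingHom ℚ) with hG
  have hGu : IsUnit G.det := by
    have := (Int.castRingHom ℚ).map_det (tensorGram D γ)
    rw [isUnit_iff_ne_zero]
    change (((tensorGram D γ).map (Int.castRingHom ℚ))).det ≠ 0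
    rw [RingHom.mapMatrix_apply] at this
    rw [← this]
    simpa using hdet
  have hexp : ∀ y ∈ Subgroup.closure S,
      f y = ∑ j, (∑ i, (f y * b i).trace * G⁻¹ i j) • b j := by
    intro y hy
    obtain ⟨a, ha⟩ := (Submodule.mem_span_range_iff_exists_fun ℚ).1 (hspan y hy)
    have ht : (fun i => (f y * b i).trace) = a ᵥ* G := by
      ext i
      rw [← ha, Finset.sum_mul, Matrix.trace_sum]
      simp only [Matrix.vecMul, dotProduct, hG, Matrix.map_apply, Int.coe_castRingHom, hgram]
      refine Finset.sum_congr rfl fun j _ => ?_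
      rw [smul_mul_assoc, Matrix.trace_smul, smul_eq_mul]
    have ha' : a = (fun i => (f y * b i).trace) ᵥ* G⁻¹ := by
      rw [ht, Matrix.vecMul_vecMul, Matrix.mul_nonsing_inv _ hGu, Matrix.vecMul_one]
    conv_lhs => rw [← ha]
    refine Finset.sum_congr rfl fun j _ => ?_
    conv_lhs => rw [ha']
    rfl
  have hGC : ((tensorGram D γ).map (Int.castRingHom ℂ))⁻¹ = (G⁻¹).map (algebraMap ℚ ℂ) := by
    have h1 : (tensorGram D γ).map (Int.castRingHom ℂ) = G.map (algebraMap ℚ ℂ) := by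
      ext i j; simp [hG]
    rw [h1]
    refine Matrix.inv_eq_right_inv ?_
    rw [← Matrix.map_mul, Matrix.mul_nonsing_inv _ hGu]
    exact Matrix.map_one _ (map_zero _) (map_one _)
  rw [hGC]
  ext ι κ
  have key := hd.trace_eq_zero
    (Matrix.single κ ι 1 - ∑ j, ∑ i, (G⁻¹ i j * b j ι κ) • b i) (fun y hy => by
      have h := congrFun (congrFun (hexp y hy) ι) κ
      rw [sub_mul, Matrix.trace_sub, Matrix.trace_single_mul, sub_eq_zero, one_smul]
      refine h.trans ?_
      rw [Matrix.sum_apply, Finset.sum_mul, Matrix.trace_sum]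
      refine Finset.sum_congr rfl fun j _ => ?_
      rw [Finset.sum_mul, Matrix.trace_sum, Matrix.smul_apply, smul_eq_mul, Finset.sum_mul]
      refine Finset.sum_congr rfl fun i _ => ?_
      rw [smul_mul_assoc, Matrix.trace_smul, smul_eq_mul, Matrix.trace_mul_comm (b i)]
      ring) x
  have hτ : ∀ i, tpow D (complexMat (γ i)) = (b i).map (algebraMap ℚ ℂ) := by
    intro i
    rw [complexMat_eq_map, tpow_map]
    exact congrArg (fun M : TMat d D => M.map (algebraMap ℚ ℂ)) (hγb i)
  rw [Matrix.map_sub _ (by simp), sub_mul, Matrix.trace_sub, sub_eq_zero] at key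
  have hs : (Matrix.single κ ι (1 : ℚ)).map (algebraMap ℚ ℂ) = Matrix.single κ ι (1 : ℂ) := by
    ext a c
    simp [Matrix.single_apply]
  rw [hs, Matrix.trace_single_mul, one_smul] at key
  refine key.trans ?_
  have hm : (∑ j, ∑ i, (G⁻¹ i j * b j ι κ) • b i).map (algebraMap ℚ ℂ) =
      ∑ j, ∑ i, ((algebraMap ℚ ℂ (G⁻¹ i j)) * algebraMap ℚ ℂ (b j ι κ)) •
        (b i).map (algebraMap ℚ ℂ) := by
    ext a c
    simp [Matrix.sum_apply]
  rw [hm, Matrix.sum_apply, Finset.sum_mul, Matrix.trace_sum]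
  refine Finset.sum_congr rfl fun j _ => ?_
  rw [Finset.sum_mul, Matrix.trace_sum, Matrix.smul_apply, smul_eq_mul, Finset.sum_mul]
  refine Finset.sum_congr rfl fun i _ => ?_
  rw [smul_mul_assoc, Matrix.trace_smul, smul_eq_mul, tpow_mul, hτ, hτ,
    Matrix.trace_mul_comm (tpow D x.1)]
  simp only [Matrix.map_apply]
  ring

end Frame

section Escape

attribute [local instance] Matrix.linftyOpNormedRing

lemma norm_apply_le_linfty {n : Type*} [Fintype n] [DecidableEq n] (A : Matrix n n ℂ) (i j : n) :
    ‖A i j‖ ≤ ‖A‖ := by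
  have h : ‖A i j‖₊ ≤ ‖A‖₊ := by
    rw [Matrix.linfty_opNNNorm_def]
    exact (Finset.single_le_sum (f := fun j => ‖A i j‖₊) (by simp) (Finset.mem_univ j)).trans
      (Finset.le_sup (f := fun i => ∑ j, ‖A i j‖₊) (Finset.mem_univ i))
  exact_mod_cast h

lemma linfty_norm_le {n : Type*} [Fintype n] [DecidableEq n] (A : Matrix n n ℂ) {C : ℝ}
    (hC : 0 ≤ C) (h : ∀ i j, ‖A i j‖ ≤ C) : ‖A‖ ≤ Fintype.card n * C := by
  lift C to NNReal using hC
  have h' : ‖A‖₊ ≤ Fintype.card n * C := by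
    rw [Matrix.linfty_opNNNorm_def]
    refine Finset.sup_le fun i _ => ?_
    refine (Finset.sum_le_sum fun j _ => (by exact_mod_cast h i j : ‖A i j‖₊ ≤ C)).trans ?_
    simp
  exact_mod_cast h'

lemma exists_le_two_pow (C : ℝ) : ∃ c : ℕ, C ≤ 2 ^ c :=
  (pow_unbounded_of_one_lt C one_lt_two).imp fun _ => le_of_lt

variable {d : ℕ}

/-- The standard representation of `SL_d(ℤ)`, conjugated by a complex matrix. -/
def conjRep (P : GL (Fin d) ℂ) : SL(d, ℤ) →* SL(d, ℂ) where
  toFun γ := ⟨P.1 * complexMat γ * P⁻¹.1, by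
    rw [Matrix.det_units_conj]
    exact (γ.map (Int.castRingHom ℂ)).2⟩
  map_one' := by
    ext1
    simp [complexMat]
  map_mul' x y := by
    refine Subtype.ext ?_
    change P.1 * complexMat (x * y) * P⁻¹.1 =
      P.1 * complexMat x * P⁻¹.1 * (P.1 * complexMat y * P⁻¹.1)
    have h : P⁻¹.1 * P.1 = 1 := by rw [← Units.val_mul, inv_mul_cancel, Units.val_one]
    calc _ = P.1 * complexMat x * 1 * complexMat y * P⁻¹.1 := by
          rw [complexMat_mul, mul_one]; simp only [mul_assoc]
      _ = _ := by rw [← h]; simp only [mul_assoc]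

lemma conjRep_val (P : GL (Fin d) ℂ) (γ : SL(d, ℤ)) :
    (conjRep P γ).1 = P.1 * complexMat γ * P⁻¹.1 := rfl

lemma norm_conjRep_le [NeZero d] {S : Set SL(d, ℤ)} {P : GL (Fin d) ℂ} {K : ℝ}
    (hS : ∀ s ∈ S, ‖(conjRep P s).1‖ ≤ K) {m : ℕ} {γ : SL(d, ℤ)} (hγ : γ ∈ S ^ m) :
    ‖(conjRep P γ).1‖ ≤ K ^ m := by
  induction m generalizing γ with
  | zero =>
    obtain rfl : γ = 1 := by simpa using hγ
    simp
  | succ m ih =>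
    rw [pow_succ] at hγ
    obtain ⟨x, hx, y, hy, rfl⟩ := hγ
    rw [map_mul, Matrix.SpecialLinearGroup.coe_mul, pow_succ]
    refine (norm_mul_le _ _).trans ?_
    exact mul_le_mul (ih hx) (hS y hy) (norm_nonneg _) ((norm_nonneg _).trans (ih hx))

lemma norm_trace_tpow_le (D : ℕ) (x : Matrix (Fin d) (Fin d) ℂ) {C : ℝ} (hC : 1 ≤ C)
    (hx : ∀ i j, ‖x i j‖ ≤ C) : ‖(tpow D x).trace‖ ≤ ((d : ℝ) + 1) ^ D * C ^ D := by
  have h1 : ∀ i j, ‖oneSum x i j‖ ≤ C := by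
    rintro (_ | i) (_ | j)
    · simpa [oneSum] using hC
    · simpa [oneSum] using zero_le_one.trans hC
    · simpa [oneSum] using zero_le_one.trans hC
    · exact hx i j
  refine (norm_sum_le _ _).trans ((Finset.sum_le_card_nsmul _ _ (C ^ D) fun ι _ => ?_).trans ?_)
  · simp only [Matrix.diag, tpow, Matrix.of_apply, norm_prod]
    refine (Finset.prod_le_prod (fun _ _ => norm_nonneg _) fun a _ => h1 (ι a) (ι a)).trans ?_
    simp
  · simp

lemma norm_inv_apply_le {r : ℕ} (G : Matrix (Fin r) (Fin r) ℂ) {M : ℝ} (hM : 1 ≤ M)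
    (hG : ∀ i j, ‖G i j‖ ≤ M) (hdet : 1 ≤ ‖G.det‖) (i j : Fin r) :
    ‖G⁻¹ i j‖ ≤ r.factorial * M ^ r := by
  rw [Matrix.inv_def, Matrix.smul_apply, Ring.inverse_eq_inv', smul_eq_mul, norm_mul, norm_inv]
  have hadj : ‖G.adjugate i j‖ ≤ r.factorial * M ^ r := by
    rw [Matrix.adjugate_apply]
    have := Matrix.det_le (A := G.updateRow j (Pi.single i 1))
      (abv := NormedField.toAbsoluteValue ℂ)
      (x := M) (fun a b => by
        change ‖G.updateRow j (Pi.single i 1) a b‖ ≤ M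
        rw [Matrix.updateRow_apply]
        split_ifs
        · rw [Pi.single_apply]
          split_ifs
          · simpa using hM
          · simpa using zero_le_one.trans hM
        · exact hG a b)
    rw [Fintype.card_fin, nsmul_eq_mul] at this
    exact this
  calc ‖G.det‖⁻¹ * ‖G.adjugate i j‖ ≤ 1 * (r.factorial * M ^ r) :=
        mul_le_mul (inv_le_one_of_one_le₀ hdet) hadj (norm_nonneg _) zero_le_one
    _ = _ := one_mul _

lemma trace_tpow_conjRep (D : ℕ) (P : GL (Fin d) ℂ) (γ : SL(d, ℤ)) :
    (tpow D (conjRep P γ).1).trace = ((tpow D γ.1).trace : ℤ) := by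
  rw [conjRep_val, tpow_mul, Matrix.trace_mul_comm, ← tpow_mul, ← mul_assoc,
    ← Units.val_mul, inv_mul_cancel, Units.val_one, one_mul, complexMat, tpow_map, Matrix.trace,
    Matrix.trace]
  simp

theorem exists_escape (d D : ℕ) [NeZero d] (B : ℝ) :
    ∃ m c : ℕ, ∀ S : Set SL(d, ℤ), 1 ∈ S → S⁻¹ = S → DenseUpTo D (Subgroup.closure S) →
      ∀ (P : GL (Fin d) ℂ) (K : ℝ), 2 ≤ K → (∀ s ∈ S, ‖(conjRep P s).1‖ ≤ K) →
      ∀ h : SL(d, ℂ), ‖h.1‖ ≤ B → ∀ p : MvPolynomial (Fin d × Fin d) ℂ, p.totalDegree ≤ D →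
      ∃ γ ∈ S ^ m, ‖MvPolynomial.eval (fun ij => h.1 ij.1 ij.2) p‖ ≤
        K ^ c * ‖MvPolynomial.eval (fun ij => (conjRep P γ).1 ij.1 ij.2) p‖ := by
  obtain ⟨N, hN⟩ := exists_frame d D
  obtain ⟨b, hb⟩ := exists_le_two_pow (max B 1)
  obtain ⟨e, he⟩ := exists_le_two_pow (((d : ℝ) + 1) ^ D)
  obtain ⟨n, hn⟩ := exists_le_two_pow (N : ℝ)
  obtain ⟨f, hf⟩ := exists_le_two_pow (N.factorial : ℝ)
  set t := e + (b + 2 * N) * D with ht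
  refine ⟨N, n + (n + (t + (f + t * N))), fun S h1 hS hdense P K hK hSK h hB p hp => ?_⟩
  have hK1 : 1 ≤ K := by linarith
  have hK0 : 0 < K := by linarith
  have h2K : ∀ {C : ℝ} {c : ℕ}, C ≤ 2 ^ c → C ≤ K ^ c := fun {C c} hC =>
    hC.trans (pow_le_pow_left₀ (by norm_num) hK c)
  obtain ⟨r, hrN, γ, hγ, hdet, hexp⟩ := hN S h1 hS hdense
  have hT : ∀ x : Matrix (Fin d) (Fin d) ℂ, ‖x‖ ≤ K ^ (b + 2 * N) →
      ‖(tpow D x).trace‖ ≤ K ^ t := by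
    intro x hx
    refine (norm_trace_tpow_le D x (one_le_pow₀ hK1)
      fun i j => (norm_apply_le_linfty x i j).trans hx).trans ?_
    rw [ht, pow_add K e, pow_mul]
    exact mul_le_mul_of_nonneg_right (h2K he) (by positivity)
  clear_value t
  have hγn : ∀ i, ‖(conjRep P (γ i)).1‖ ≤ K ^ N := fun i => norm_conjRep_le hSK (hγ i)
  set G := (tensorGram D γ).map (Int.castRingHom ℂ)
  have hGn : ∀ i j, ‖G i j‖ ≤ K ^ t := by
    intro i j
    have : G i j = (tpow D (conjRep P (γ i * γ j)).1).trace := by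
      rw [trace_tpow_conjRep]; rfl
    rw [this, map_mul, Matrix.SpecialLinearGroup.coe_mul]
    refine hT _ ((norm_mul_le _ _).trans ?_)
    calc _ ≤ K ^ N * K ^ N := mul_le_mul (hγn i) (hγn j) (norm_nonneg _) (by positivity)
      _ = K ^ (2 * N) := by ring
      _ ≤ _ := pow_le_pow_right₀ hK1 (by omega)
  have hGdet : 1 ≤ ‖G.det‖ := by
    have : G.det = ((tensorGram D γ).det : ℂ) := ((Int.castRingHom ℂ).map_det _).symm
    rw [this, Complex.norm_intCast]
    exact_mod_cast Int.one_le_abs hdet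
  have hGi : ∀ i j, ‖G⁻¹ i j‖ ≤ K ^ (f + t * N) := by
    intro i j
    refine (norm_inv_apply_le G (one_le_pow₀ hK1) hGn hGdet i j).trans ?_
    rw [pow_add K f, pow_mul K t N]
    have h3 : (r.factorial : ℝ) ≤ K ^ f :=
      (by exact_mod_cast Nat.factorial_le hrN : (r.factorial : ℝ) ≤ N.factorial).trans (h2K hf)
    exact mul_le_mul h3 (pow_le_pow_right₀ (one_le_pow₀ hK1) hrN) (by positivity) (by positivity)
  obtain ⟨A, hA⟩ := exists_eval_eq_trace_tpow D p hp
  have hPdet : (P⁻¹.1 * h.1 * P.1).det = 1 := by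
    have := Matrix.det_units_conj P⁻¹ h.1
    rw [inv_inv] at this
    rw [this]; exact h.2
  set x : SL(d, ℂ) := ⟨P⁻¹.1 * h.1 * P.1, hPdet⟩ with hx
  set co : Fin r → ℂ := fun j => ∑ i, (tpow D (x.1 * complexMat (γ i))).trace * G⁻¹ i j
  have hPP : P.1 * P⁻¹.1 = 1 := by rw [← Units.val_mul, mul_inv_cancel, Units.val_one]
  have hPP' : P⁻¹.1 * P.1 = 1 := by rw [← Units.val_mul, inv_mul_cancel, Units.val_one]
  have hcon : ∀ j, ‖co j‖ ≤ K ^ (n + (t + (f + t * N))) := by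
    intro j
    refine (norm_sum_le _ _).trans ((Finset.sum_le_card_nsmul _ _
      (K ^ (t + (f + t * N))) fun i _ => ?_).trans ?_)
    · rw [norm_mul, pow_add]
      refine mul_le_mul ?_ (hGi i j) (norm_nonneg _) (by positivity)
      have : (tpow D (x.1 * complexMat (γ i))).trace =
          (tpow D (h.1 * (conjRep P (γ i)).1)).trace := by
        have h3 : x.1 * complexMat (γ i) = P⁻¹.1 * (h.1 * (conjRep P (γ i)).1 * P.1) := by
          rw [conjRep_val, hx]
          simp only [mul_assoc, hPP', mul_one]
        rw [h3, tpow_mul, Matrix.trace_mul_comm, ← tpow_mul, mul_assoc _ P.1, hPP, mul_one]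
      rw [this]
      refine hT _ ((norm_mul_le _ _).trans ?_)
      rw [pow_add]
      refine mul_le_mul (h2K ?_) ((hγn i).trans (pow_le_pow_right₀ hK1 (by omega)))
        (norm_nonneg _) (by positivity)
      exact hB.trans ((le_max_left _ _).trans hb)
    · rw [pow_add K n, nsmul_eq_mul]
      refine mul_le_mul_of_nonneg_right ?_ (by positivity)
      simpa using (by exact_mod_cast hrN : (r : ℝ) ≤ N).trans (h2K hn)
  have hev : MvPolynomial.eval (fun ij => h.1 ij.1 ij.2) p =
      ∑ j, co j * MvPolynomial.eval (fun ij => (conjRep P (γ j)).1 ij.1 ij.2) p := by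
    have h3 : h.1 = P.1 * (x.1 * P⁻¹.1) := by
      rw [hx]
      simp only [mul_assoc, hPP, mul_one]
      rw [← mul_assoc, hPP, one_mul]
    rw [hA, h3, tpow_mul, tpow_mul, hexp x, Finset.sum_mul, Finset.mul_sum, Finset.mul_sum,
      Matrix.trace_sum]
    refine Finset.sum_congr rfl fun j _ => ?_
    rw [hA, conjRep_val, tpow_mul, tpow_mul, smul_mul_assoc, mul_smul_comm, mul_smul_comm,
      Matrix.trace_smul, smul_eq_mul, mul_assoc (tpow D P.1)]
  rcases Nat.eq_zero_or_pos r with rfl | hr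
  · refine ⟨1, Set.one_mem_pow h1, ?_⟩
    rw [hev]
    simp only [Finset.univ_eq_empty, Finset.sum_empty, norm_zero]
    positivity
  have : Nonempty (Fin r) := ⟨⟨0, hr⟩⟩
  obtain ⟨j, hj⟩ := Finite.exists_max
    fun j => ‖MvPolynomial.eval (fun ij => (conjRep P (γ j)).1 ij.1 ij.2) p‖
  refine ⟨γ j, hγ j, ?_⟩
  rw [hev]
  refine (norm_sum_le _ _).trans ((Finset.sum_le_card_nsmul _ _
      (K ^ (n + (t + (f + t * N))) *
        ‖MvPolynomial.eval (fun ij => (conjRep P (γ j)).1 ij.1 ij.2) p‖) fun i _ => ?_).trans ?_)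
  · rw [norm_mul]
    exact mul_le_mul (hcon i) (hj i) (norm_nonneg _) (by positivity)
  · rw [pow_add K n (n + _), nsmul_eq_mul, mul_assoc (K ^ n)]
    refine mul_le_mul_of_nonneg_right ?_ (by positivity)
    simpa using (by exact_mod_cast hrN : (r : ℝ) ≤ N).trans (h2K hn)

end Escape

section SpectralGrowth

variable {d : ℕ}

lemma trace_tpow_one {R : Type*} [CommRing R] (A : Matrix (Fin d) (Fin d) R) :
    (tpow 1 A).trace = 1 + A.trace := by
  rw [Matrix.trace, Fintype.sum_equiv (Equiv.funUnique (Fin 1) (Option (Fin d))) _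
    (fun o => oneSum A o o) (fun x => by simp [tpow]), Fintype.sum_option]
  simp [oneSum, Matrix.trace]

lemma complexMat_injective : Function.Injective (complexMat (d := d)) := by
  intro x y h
  ext i j
  have := congrFun (congrFun h i) j
  simpa using this

lemma coe_map_castRingHom (γ : SL(d, ℤ)) :
    (γ.map (Int.castRingHom ℂ)).1 = complexMat γ := rfl

lemma tpow_one_injective {R : Type*} [CommRing R] :
    Function.Injective (tpow 1 : Matrix (Fin d) (Fin d) R → _) := by
  intro x y h
  ext i j
  have := congrFun (congrFun h (fun _ => some i)) (fun _ => some j)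
  simpa [tpow, oneSum] using this

lemma trace_complexMat (γ : SL(d, ℤ)) : (complexMat γ).trace = (γ.1.trace : ℤ) := by
  simp [Matrix.trace]

lemma norm_trace_le_of_roots (A : Matrix (Fin d) (Fin d) ℂ) {C : ℝ} (hC : 0 ≤ C)
    (h : ∀ z ∈ A.charpoly.roots, ‖z‖ ≤ C) : ‖A.trace‖ ≤ d * C := by
  rw [Matrix.trace_eq_sum_roots_charpoly]
  refine (norm_multiset_sum_le _).trans ((Multiset.sum_le_card_nsmul _ C ?_).trans ?_)
  · intro x hx
    obtain ⟨z, hz, rfl⟩ := Multiset.mem_map.1 hx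
    exact h z hz
  · rw [nsmul_eq_mul, Multiset.card_map]
    refine mul_le_mul_of_nonneg_right ?_ hC
    have := A.charpoly.card_roots'
    rw [Matrix.charpoly_natDegree_eq_dim, Fintype.card_fin] at this
    exact_mod_cast this

lemma not_denseUpTo_of_ncard_le (hd : 2 ≤ d) {Γ : Subgroup SL(d, ℤ)} (M : ℕ)
    (hfin : (Γ : Set SL(d, ℤ)).Finite) (hM : (Γ : Set SL(d, ℤ)).ncard ≤ M) :
    ¬ DenseUpTo M Γ := by
  intro h
  let a : Fin d := ⟨0, by omega⟩
  let b : Fin d := ⟨1, by omega⟩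
  have hab : a ≠ b := by simp [a, b, Fin.ext_iff]
  have := h (∏ γ ∈ hfin.toFinset, (MvPolynomial.X (a, b) - MvPolynomial.C (γ.1 a b : ℚ))) ?_ ?_
    ⟨transvection a b 2⁻¹, Matrix.det_transvection_of_ne a b hab _⟩
  · rw [map_prod, Finset.prod_eq_zero_iff] at this
    obtain ⟨γ, -, hγ⟩ := this
    have h2 : (2 : ℂ)⁻¹ = (γ.1 a b : ℤ) := by
      simpa [transvection, hab, sub_eq_zero] using hγ
    have h3 : (1 : ℂ) = ((2 * γ.1 a b : ℤ) : ℂ) := by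
      push_cast
      rw [← h2]; norm_num
    have h4 : (1 : ℤ) = 2 * γ.1 a b := by exact_mod_cast h3
    omega
  · refine (MvPolynomial.totalDegree_finsetProd _ _).trans
      ((Finset.sum_le_card_nsmul _ _ 1 fun γ _ => ?_).trans ?_)
    · exact (MvPolynomial.totalDegree_sub_C_le _ _).trans (by simp)
    · rw [smul_eq_mul, mul_one, ← Set.ncard_eq_toFinset_card _ hfin]
      exact hM
  · intro γ hγ
    rw [map_prod]
    exact Finset.prod_eq_zero (hfin.mem_toFinset.2 hγ) (by simp)

/-- Some word of bounded length has an eigenvalue outside the unit disc. -/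
lemma exists_one_lt_norm_root (hd : 2 ≤ d) :
    ∃ L D : ℕ, ∀ S : Set SL(d, ℤ), 1 ∈ S → S⁻¹ = S → DenseUpTo D (Subgroup.closure S) →
      ∃ x ∈ S ^ L, ∃ z ∈ (complexMat x).charpoly.roots, 1 < ‖z‖ := by
  obtain ⟨N, hN⟩ := exists_frame d 1
  set M := (2 * d + 1) ^ N with hM
  have hM1 : 1 ≤ M := Nat.one_le_pow _ _ (by omega)
  refine ⟨M + 1 + N, M, fun S h1 hS hdense => ?_⟩
  by_contra! hroot
  obtain ⟨r, hrN, γ, hγ, -, hexp⟩ := hN S h1 hS (hdense.mono hM1)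
  set T : SL(d, ℤ) → Fin r → ℤ := fun x i => (x * γ i).1.trace
  have hTinj : Function.Injective T := by
    intro x y hxy
    refine complexMat_injective (tpow_one_injective ?_)
    have hx := hexp (x.map (Int.castRingHom ℂ))
    have hy := hexp (y.map (Int.castRingHom ℂ))
    rw [coe_map_castRingHom] at hx hy
    rw [hx, hy]
    refine Finset.sum_congr rfl fun j _ => ?_
    refine congrArg (· • _) (Finset.sum_congr rfl fun i _ => ?_)
    have hi : (x * γ i).1.trace = (y * γ i).1.trace := congrFun hxy i
    rw [← complexMat_mul, ← complexMat_mul, trace_tpow_one, trace_tpow_one, trace_complexMat,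
      trace_complexMat, hi]
  set V : Set (Fin r → ℤ) := Set.Icc (fun _ => -(d : ℤ)) (fun _ => (d : ℤ)) with hV
  have hVfin : V.Finite := Set.finite_Icc _ _
  have hVcard : V.ncard ≤ M := by
    rw [hV, ← Finset.coe_Icc, Set.ncard_coe_finset, Pi.card_Icc]
    simp only [Int.card_Icc, Finset.prod_const, Finset.card_univ, Fintype.card_fin]
    rw [show ((d : ℤ) + 1 - -(d : ℤ)).toNat = 2 * d + 1 by omega]
    exact Nat.pow_le_pow_right (by omega) hrN
  have hTV : ∀ l ≤ M + 1, ∀ x ∈ S ^ l, T x ∈ V := by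
    intro l hl x hx
    have habs : ∀ i, |T x i| ≤ d := by
      intro i
      have hmem : x * γ i ∈ S ^ (M + 1 + N) := by
        refine Set.pow_subset_pow_right h1 (show l + N ≤ M + 1 + N by omega) ?_
        rw [pow_add]
        exact Set.mul_mem_mul hx (hγ i)
      have := norm_trace_le_of_roots _ zero_le_one (hroot _ hmem)
      rw [trace_complexMat, Complex.norm_intCast, mul_one] at this
      exact_mod_cast this
    exact ⟨fun i => (abs_le.1 (habs i)).1, fun i => (abs_le.1 (habs i)).2⟩
  have hfin : ∀ l ≤ M + 1, (S ^ l).Finite := fun l hl =>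
    Set.Finite.of_finite_image (hVfin.subset (Set.image_subset_iff.2 (hTV l hl))) hTinj.injOn
  have hcard : ∀ l ≤ M + 1, (S ^ l).ncard ≤ M := fun l hl =>
    (Set.ncard_le_ncard_of_injOn T (hTV l hl) hTinj.injOn hVfin).trans hVcard
  obtain ⟨l, hl, heq⟩ : ∃ l ≤ M, S ^ l = S ^ (l + 1) := by
    by_contra! hne
    have : ∀ l ≤ M + 1, l ≤ (S ^ l).ncard := by
      intro l
      induction l with
      | zero => simp
      | succ l ih =>
        intro hl
        have h3 := Set.ncard_lt_ncard ((Set.pow_subset_pow_right h1 (Nat.le_succ l)).ssubset_of_ne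
          (hne l (by omega))) (hfin _ hl)
        have := ih (by omega)
        change l + 1 ≤ (S ^ (l + 1)).ncard
        have h4 : (S ^ l).ncard < (S ^ (l + 1)).ncard := h3
        omega
    have := this _ le_rfl
    have := hcard _ le_rfl
    omega
  have hsub : (Subgroup.closure S : Set SL(d, ℤ)) ⊆ S ^ l := by
    intro x hx
    have hx' := mem_submonoid_closure_of_symm hS hx
    clear hx
    induction hx' using Submonoid.closure_induction_left with
    | one => exact Set.one_mem_pow h1
    | mul_left s hs y hy ih =>
      rw [heq, pow_succ']
      exact Set.mul_mem_mul hs ih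
  exact not_denseUpTo_of_ncard_le hd M ((hfin l (by omega)).subset hsub)
    ((Set.ncard_le_ncard hsub (hfin l (by omega))).trans (hcard l (by omega))) hdense

/-- A gap for the spectral radius of integer matrices. -/
lemma exists_root_gap (d : ℕ) : ∃ c : ℝ, 1 < c ∧ ∀ γ : SL(d, ℤ),
    ∀ z ∈ (complexMat γ).charpoly.roots, 1 < ‖z‖ →
      ∃ w ∈ (complexMat γ).charpoly.roots, c ≤ ‖w‖ := by
  classical
  set B : ℝ := (max 2 1 : ℝ) ^ d * (d.choose (d / 2))
  have hU : (Set.Icc (-⌊B⌋) ⌊B⌋).Finite := Set.finite_Icc _ _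
  set T := (⋃ f : Polynomial ℤ, ⋃ (_ : f.natDegree ≤ d ∧
    ∀ i : ℕ, f.coeff i ∈ Set.Icc (-⌊B⌋) ⌊B⌋),
      ((f.map (Int.castRingHom ℂ)).roots.toFinset : Set ℂ))
  have hTfin : T.Finite := Polynomial.bUnion_roots_finite _ d hU
  have hmem : ∀ γ : SL(d, ℤ), (∀ w ∈ (complexMat γ).charpoly.roots, ‖w‖ ≤ 2) →
      ∀ z ∈ (complexMat γ).charpoly.roots, z ∈ T := by
    intro γ hγ z hz
    rw [complexMat, Matrix.charpoly_map] at hγ hz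
    refine Set.mem_iUnion₂.2 ⟨γ.1.charpoly, ⟨?_, fun i => ?_⟩, by simpa using hz⟩
    · rw [Matrix.charpoly_natDegree_eq_dim, Fintype.card_fin]
    · have := Polynomial.coeff_bdd_of_roots_le (Int.castRingHom ℂ) γ.1.charpoly_monic
        (IsAlgClosed.splits _) (d := d) (by
          rw [Matrix.charpoly_natDegree_eq_dim, Fintype.card_fin]) hγ i
      rw [Polynomial.coeff_map, eq_intCast, Complex.norm_intCast, abs_le] at this
      refine ⟨neg_le.1 (Int.le_floor.2 ?_), Int.le_floor.2 this.2⟩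
      push_cast
      linarith [this.1]
  obtain ⟨c, hc1, hc2, hc⟩ : ∃ c : ℝ, 1 < c ∧ c ≤ 2 ∧ ∀ z ∈ T, 1 < ‖z‖ → c ≤ ‖z‖ := by
    rcases (T ∩ {z | 1 < ‖z‖}).eq_empty_or_nonempty with he | hne
    · refine ⟨2, one_lt_two, le_rfl, fun z hz h1 => ?_⟩
      exact absurd (show z ∈ T ∩ {z | 1 < ‖z‖} from ⟨hz, h1⟩) (by simp [he])
    · obtain ⟨w, hw, hmin⟩ := Set.exists_min_image _ (fun z : ℂ => ‖z‖)
        (hTfin.subset Set.inter_subset_left) hne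
      exact ⟨min 2 ‖w‖, lt_min one_lt_two hw.2, min_le_left _ _, fun z hz h1 =>
        (min_le_right _ _).trans (hmin z ⟨hz, h1⟩)⟩
  refine ⟨c, hc1, fun γ z hz h1 => ?_⟩
  by_cases h : ∀ w ∈ (complexMat γ).charpoly.roots, ‖w‖ ≤ 2
  · exact ⟨z, hz, hc z (hmem γ h z hz) h1⟩
  · push Not at h
    obtain ⟨w, hw, hw2⟩ := h
    exact ⟨w, hw, hc2.trans hw2.le⟩

end SpectralGrowth

section ExpandingWord

attribute [local instance] Matrix.linftyOpNormedRing

variable {d : ℕ}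

lemma tpow_one_apply {R : Type*} [CommRing R] (A : Matrix (Fin d) (Fin d) R) (i j : Fin d) :
    tpow 1 A (fun _ => some i) (fun _ => some j) = A i j := by
  simp [tpow, oneSum]

lemma pow_mulVec_of_eigenvector {A : Matrix (Fin d) (Fin d) ℂ} {v : Fin d → ℂ} {z : ℂ}
    (h : A *ᵥ v = z • v) (n : ℕ) : (A ^ n) *ᵥ v = z ^ n • v := by
  induction n with
  | zero => simp
  | succ n ih =>
    rw [pow_succ, ← Matrix.mulVec_mulVec, h, Matrix.mulVec_smul, ih, smul_smul, pow_succ']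

/-- From a finite spanning family one can extract a basis in which all the members of the family
have coordinates of modulus at most `1`. -/
lemma exists_bounded_basis {r : ℕ} (q : Fin r → Fin d → ℂ)
    (hq : Submodule.span ℂ (Set.range q) = ⊤) :
    ∃ (P : GL (Fin d) ℂ) (J : Fin d → Fin r), (∀ a, P.1 a = q (J a)) ∧
      ∀ j b, ‖(q j ᵥ* P⁻¹.1) b‖ ≤ 1 := by
  set Δ : (Fin d → Fin r) → ℂ := fun J => (Matrix.of fun a => q (J a)).det
  obtain ⟨J₀, hJ₀⟩ : ∃ J, Δ J ≠ 0 := by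
    obtain ⟨f, hf, -, hfl⟩ := Submodule.exists_fun_fin_finrank_span_eq ℂ (Set.range q)
    have hr : d = Module.finrank ℂ (Submodule.span ℂ (Set.range q)) := by
      rw [hq, finrank_top, Module.finrank_fin_fun]
    choose J hJ using hf
    refine ⟨fun a => J (Fin.cast hr a), ?_⟩
    have hli : LinearIndependent ℂ fun a => q (J (Fin.cast hr a)) := by
      simp only [hJ]
      exact hfl.comp _ (Fin.cast_injective hr)
    have := Matrix.linearIndependent_rows_iff_isUnit
      (A := Matrix.of fun a => q (J (Fin.cast hr a))) |>.1 hli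
    exact ((Matrix.isUnit_iff_isUnit_det _).1 this).ne_zero
  have : Nonempty (Fin d → Fin r) := ⟨J₀⟩
  obtain ⟨J, hJ⟩ := Finite.exists_max fun J => ‖Δ J‖
  have hJ0 : Δ J ≠ 0 := norm_pos_iff.1 ((norm_pos_iff.2 hJ₀).trans_le (hJ J₀))
  set A : Matrix (Fin d) (Fin d) ℂ := Matrix.of fun a => q (J a) with hA
  refine ⟨Matrix.GeneralLinearGroup.mkOfDetNeZero A hJ0, J, fun a => rfl, fun j b => ?_⟩
  have hinv : (Matrix.GeneralLinearGroup.mkOfDetNeZero A hJ0)⁻¹.1 = A⁻¹ := by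
    rw [Matrix.coe_units_inv]; rfl
  rw [hinv]
  set t := q j ᵥ* A⁻¹ with ht
  have hu : IsUnit A.det := isUnit_iff_ne_zero.2 hJ0
  have hqt : Aᵀ *ᵥ t = q j := by
    rw [Matrix.mulVec_transpose, ht, Matrix.vecMul_vecMul, Matrix.nonsing_inv_mul _ hu,
      Matrix.vecMul_one]
  have hcr : A.det * t b = Δ (Function.update J b j) := by
    have h1 := Matrix.cramer_transpose_apply A (q j) b
    have h2 : (Aᵀ).cramer (q j) = A.det • t := by
      rw [Matrix.cramer_eq_adjugate_mulVec, ← hqt, Matrix.mulVec_mulVec, Matrix.adjugate_mul,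
        Matrix.det_transpose, Matrix.smul_mulVec, Matrix.one_mulVec]
    rw [h2] at h1
    refine h1.trans (congrArg Matrix.det ?_)
    ext a c
    rw [Matrix.updateRow_apply]
    by_cases hab : a = b
    · subst hab; simp
    · simp [hab, hA]
  have h3 := hJ (Function.update J b j)
  rw [← hcr, norm_mul] at h3
  exact le_of_mul_le_mul_left (by simpa using h3) (norm_pos_iff.2 hJ0)

theorem exists_expanding_word (hd : 2 ≤ d) :
    ∃ m D : ℕ, ∀ S : Set SL(d, ℤ), S.Finite → 1 ∈ S → S⁻¹ = S →
      DenseUpTo D (Subgroup.closure S) →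
      ∃ (P : GL (Fin d) ℂ) (K : ℝ), 2 ≤ K ∧ (∀ s ∈ S, ‖(conjRep P s).1‖ ≤ K) ∧
        ∃ x ∈ S ^ m, ∃ v : Fin d → ℂ, v ≠ 0 ∧ ∃ z : ℂ, (conjRep P x).1 *ᵥ v = z • v ∧ K ≤ ‖z‖ := by
  have : NeZero d := ⟨by omega⟩
  obtain ⟨N, hN⟩ := exists_frame d 1
  obtain ⟨L, D, hL⟩ := exists_one_lt_norm_root hd
  obtain ⟨c, hc1, hc⟩ := exists_root_gap d
  have hc0 : 0 < c := one_pos.trans hc1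
  set C : ℝ := d * (N * (N * ((d + 1) * (N.factorial * (d + 1) ^ N)))) with hC
  obtain ⟨e, he⟩ := pow_unbounded_of_one_lt (max C 2) hc1
  set l := e + (N + 1) with hl
  set L' := L + 2 * N + 1 with hL'
  refine ⟨L' * l, max 1 D, fun S hfin h1 hS hdense => ?_⟩
  obtain ⟨r, hrN, γ, hγ, hdet, hexp⟩ := hN S h1 hS (hdense.mono (le_max_left _ _))
  obtain ⟨x₀, hx₀, z₀, hz₀, h1z₀⟩ := hL S h1 hS (hdense.mono (le_max_right _ _))
  have hx₀' : x₀ ∈ S ^ L' := Set.pow_subset_pow_right h1 (by omega) hx₀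
  have hpow : ∀ n, (S ^ n).Finite := fun n => by
    induction n with
    | zero => simp
    | succ n ih => rw [pow_succ]; exact ih.mul hfin
  obtain ⟨x, hx, z, hz, hmax⟩ : ∃ x ∈ S ^ L', ∃ z ∈ (complexMat x).charpoly.roots,
      ∀ y ∈ S ^ L', ∀ w ∈ (complexMat y).charpoly.roots, ‖w‖ ≤ ‖z‖ := by
    set Z : Set ℂ := ⋃ y ∈ S ^ L', {w | w ∈ (complexMat y).charpoly.roots}
    have hZf : Z.Finite := (hpow L').biUnion fun y _ => Multiset.finite_toSet _
    obtain ⟨z, hz, hmax⟩ := Set.exists_max_image Z (fun w => ‖w‖) hZf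
      ⟨z₀, Set.mem_biUnion hx₀' hz₀⟩
    obtain ⟨x, hx, hzx⟩ := Set.mem_iUnion₂.1 hz
    exact ⟨x, hx, z, hzx, fun y hy w hw => hmax w (Set.mem_biUnion hy hw)⟩
  set Λ := ‖z‖
  have hcΛ : c ≤ Λ := by
    obtain ⟨w, hw, hcw⟩ := hc x₀ z₀ hz₀ h1z₀
    exact hcw.trans (hmax x₀ hx₀' w hw)
  have hΛ1 : 1 ≤ Λ := hc1.le.trans hcΛ
  have hΛ0 : 0 < Λ := one_pos.trans_le hΛ1
  have htr : ∀ y ∈ S ^ L', ‖(tpow 1 (complexMat y)).trace‖ ≤ (d + 1) * Λ := by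
    intro y hy
    rw [trace_tpow_one]
    refine (norm_add_le _ _).trans ?_
    have := norm_trace_le_of_roots _ hΛ0.le (hmax y hy)
    rw [norm_one]
    linarith
  have hmemL : ∀ {a b : ℕ} {y w : SL(d, ℤ)}, y ∈ S ^ a → w ∈ S ^ b → a + b ≤ L' →
      y * w ∈ S ^ L' := by
    intro a b y w hy hw hab
    refine Set.pow_subset_pow_right h1 hab ?_
    rw [pow_add]
    exact Set.mul_mem_mul hy hw
  set G := (tensorGram 1 γ).map (Int.castRingHom ℂ) with hG
  have hdΛ : 1 ≤ (d + 1) * Λ := one_le_mul_of_one_le_of_one_le (by simp) hΛ1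
  have hGn : ∀ i j, ‖G i j‖ ≤ (d + 1) * Λ := by
    intro i j
    have : G i j = (tpow 1 (complexMat (γ i * γ j))).trace := by
      rw [complexMat, tpow_map, Matrix.trace]
      simp [hG, tensorGram, Matrix.trace]
    rw [this]
    exact htr _ (hmemL (hγ i) (hγ j) (by omega))
  have hGdet : 1 ≤ ‖G.det‖ := by
    have : G.det = ((tensorGram 1 γ).det : ℂ) := ((Int.castRingHom ℂ).map_det _).symm
    rw [this, Complex.norm_intCast]
    exact_mod_cast Int.one_le_abs hdet
  have hGi : ∀ i j, ‖G⁻¹ i j‖ ≤ N.factorial * ((d + 1) * Λ) ^ N := by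
    intro i j
    refine (norm_inv_apply_le G hdΛ hGn hGdet i j).trans ?_
    have h3 : (r.factorial : ℝ) ≤ N.factorial := by exact_mod_cast Nat.factorial_le hrN
    exact mul_le_mul h3 (pow_le_pow_right₀ hdΛ hrN) (by positivity) (by positivity)
  set q : Fin r → Fin d → ℂ := fun j => complexMat (γ j) 0 with hq
  set co : SL(d, ℂ) → Fin r → ℂ := fun y j =>
    ∑ i, (tpow 1 (y.1 * complexMat (γ i))).trace * G⁻¹ i j with hco
  have hrow : ∀ y : SL(d, ℂ), y.1 0 = ∑ j, co y j • q j := by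
    intro y
    ext b
    have := congrFun (congrFun (hexp y) (fun _ => some 0)) (fun _ => some b)
    rw [Matrix.sum_apply] at this
    rw [Finset.sum_apply]
    simpa only [tpow_one_apply, Matrix.smul_apply, Pi.smul_apply, hco, hq] using this
  have hspan : Submodule.span ℂ (Set.range q) = ⊤ := by
    have hy : ∀ y : SL(d, ℂ), y.1 0 ∈ Submodule.span ℂ (Set.range q) := fun y => by
      rw [hrow]
      exact Submodule.sum_mem _ fun j _ => Submodule.smul_mem _ _
        (Submodule.subset_span (Set.mem_range_self j))
    have hs0 : (Pi.single 0 1 : Fin d → ℂ) ∈ Submodule.span ℂ (Set.range q) := by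
      have := hy 1
      convert this using 1
      ext b
      simp [Matrix.one_apply, Pi.single_apply, eq_comm]
    have hs : ∀ i, (Pi.single i 1 : Fin d → ℂ) ∈ Submodule.span ℂ (Set.range q) := by
      intro i
      by_cases hi : i = 0
      · rw [hi]; exact hs0
      · have := sub_mem (hy ⟨transvection 0 i 1,
          Matrix.det_transvection_of_ne 0 i (Ne.symm hi) 1⟩) hs0
        convert this using 1
        ext b
        simp [transvection, Matrix.one_apply, Pi.single_apply, Matrix.single_apply, eq_comm]
    refine eq_top_iff.2 fun v _ => ?_
    rw [pi_eq_sum_univ' v]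
    exact Submodule.sum_mem _ fun i _ => Submodule.smul_mem _ _ (by
      convert hs i using 1)
  obtain ⟨P, J, hPJ, hP⟩ := exists_bounded_basis q hspan
  have hΛl : C * Λ ^ (N + 1) ≤ Λ ^ l := by
    rw [hl, pow_add Λ e]
    refine mul_le_mul_of_nonneg_right ?_ (by positivity)
    exact ((le_max_left _ _).trans he.le).trans (pow_le_pow_left₀ hc0.le hcΛ e)
  refine ⟨P, Λ ^ l, ?_, fun s hs => ?_, x ^ l, ?_, ?_⟩
  · refine ((le_max_right C 2).trans he.le).trans ((pow_le_pow_left₀ hc0.le hcΛ e).trans ?_)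
    exact pow_le_pow_right₀ hΛ1 (by omega)
  · refine le_trans (linfty_norm_le _ (C := N * (N * ((d + 1) * Λ *
      (N.factorial * ((d + 1) * Λ) ^ N)))) (by positivity) fun a b => ?_) ?_
    · have h1' : (conjRep P s).1 a =
          ∑ k, co ((γ (J a) * s).map (Int.castRingHom ℂ)) k • (q k ᵥ* P⁻¹.1) := by
        have h2 : (P.1 * complexMat s) a =
            ((γ (J a) * s).map (Int.castRingHom ℂ)).1 0 := by
          rw [coe_map_castRingHom, complexMat_mul, Matrix.mul_apply_eq_vecMul,
            Matrix.mul_apply_eq_vecMul, hPJ]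
        rw [conjRep_val, Matrix.mul_apply_eq_vecMul, h2, hrow, Matrix.sum_vecMul]
        simp only [Matrix.smul_vecMul]
      rw [h1', Finset.sum_apply]
      refine (norm_sum_le _ _).trans ((Finset.sum_le_card_nsmul _ _
        (N * ((d + 1) * Λ * (N.factorial * ((d + 1) * Λ) ^ N))) fun k _ => ?_).trans ?_)
      · rw [Pi.smul_apply, norm_smul]
        refine (mul_le_of_le_one_right (norm_nonneg _) (hP k b)).trans ?_
        refine (norm_sum_le _ _).trans ((Finset.sum_le_card_nsmul _ _
          ((d + 1) * Λ * (N.factorial * ((d + 1) * Λ) ^ N)) fun i _ => ?_).trans ?_)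
        · rw [norm_mul]
          refine mul_le_mul ?_ (hGi i k) (norm_nonneg _) (by positivity)
          rw [coe_map_castRingHom, ← complexMat_mul]
          refine htr _ (hmemL (a := N + 1) (b := N) ?_ (hγ i) (by omega))
          rw [pow_succ]
          exact Set.mul_mem_mul (hγ _) hs
        · rw [nsmul_eq_mul]
          refine mul_le_mul_of_nonneg_right ?_ (by positivity)
          simpa using hrN
      · rw [nsmul_eq_mul]
        refine mul_le_mul_of_nonneg_right ?_ (by positivity)
        simpa using hrN
    · rw [Fintype.card_fin]
      refine le_trans (le_of_eq ?_) hΛl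
      rw [hC, mul_pow]
      ring
  · rw [pow_mul]
    exact Set.pow_mem_pow hx
  · have hdet0 : (Matrix.scalar (Fin d) z - complexMat x).det = 0 := by
      rw [← Matrix.eval_charpoly]
      exact (Polynomial.mem_roots'.1 hz).2
    obtain ⟨v, hv, hv0⟩ := Matrix.exists_mulVec_eq_zero_iff.2 hdet0
    have hvz : complexMat x *ᵥ v = z • v := by
      rw [Matrix.sub_mulVec, sub_eq_zero] at hv0
      rw [← hv0]
      ext i
      simp [Matrix.scalar_apply, Matrix.mulVec_diagonal]
    have hPP' : P⁻¹.1 * P.1 = 1 := by rw [← Units.val_mul, inv_mul_cancel, Units.val_one]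
    have hxv : (conjRep P x).1 *ᵥ (P.1 *ᵥ v) = z • (P.1 *ᵥ v) := by
      rw [conjRep_val, Matrix.mulVec_mulVec, mul_assoc, hPP', mul_one, ← Matrix.mulVec_mulVec, hvz,
        Matrix.mulVec_smul]
    refine ⟨P.1 *ᵥ v, fun h0 => hv ?_, z ^ l, ?_, by rw [norm_pow]⟩
    · have := congrArg (fun u => P⁻¹.1 *ᵥ u) h0
      simpa [Matrix.mulVec_mulVec, hPP'] using this
    · rw [map_pow, Matrix.SpecialLinearGroup.coe_pow]
      exact pow_mulVec_of_eigenvector hxv l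

end ExpandingWord

section Compound

variable {d : ℕ} {R : Type*} [CommRing R]

/-- The `k`-th compound matrix, whose entries are the `k × k` minors. -/
def compound (k : ℕ) (x : Matrix (Fin d) (Fin d) R) : Matrix (Fin k ↪o Fin d) (Fin k ↪o Fin d) R :=
  Matrix.of fun e f => (x.submatrix e f).det

lemma compound_apply (k : ℕ) (x : Matrix (Fin d) (Fin d) R) (e f : Fin k ↪o Fin d) :
    compound k x e f = (x.submatrix e f).det := rfl

lemma exists_notMem_range_of_ne {k : ℕ} {e f : Fin k ↪o Fin d} (h : e ≠ f) :
    ∃ i, e i ∉ Set.range f := by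
  by_contra! hc
  have hsub : Set.range e ⊆ Set.range f := by rintro _ ⟨i, rfl⟩; exact hc i
  have heq : Set.range e = Set.range f := by
    refine Set.eq_of_subset_of_ncard_le hsub ?_ (Set.finite_range f)
    rw [← Set.image_univ, ← Set.image_univ, Set.ncard_image_of_injective _ e.injective,
      Set.ncard_image_of_injective _ f.injective]
  exact h (OrderEmbedding.range_inj.1 heq)

lemma compound_diagonal (k : ℕ) (a : Fin d → R) :
    compound k (Matrix.diagonal a) = Matrix.diagonal fun e => ∏ i, a (e i) := by
  ext e f
  rw [compound_apply]
  by_cases h : e = f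
  · subst h
    rw [Matrix.diagonal_apply_eq, Matrix.submatrix_diagonal a e e.injective, Matrix.det_diagonal]
    rfl
  · rw [Matrix.diagonal_apply_ne _ h]
    obtain ⟨i, hi⟩ := exists_notMem_range_of_ne h
    refine Matrix.det_eq_zero_of_row_eq_zero i fun j => ?_
    rw [Matrix.submatrix_apply, Matrix.diagonal_apply_ne _ fun h' => hi ⟨j, h'.symm⟩]

lemma compound_one (k : ℕ) : compound k (1 : Matrix (Fin d) (Fin d) R) = 1 := by
  rw [← Matrix.diagonal_one, compound_diagonal]
  simp

lemma compound_smul (k : ℕ) (c : R) (x : Matrix (Fin d) (Fin d) R) :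
    compound k (c • x) = c ^ k • compound k x := by
  ext e f
  change (c • x.submatrix e f).det = c ^ k * (x.submatrix e f).det
  rw [Matrix.det_smul, Fintype.card_fin]

lemma compound_map (k : ℕ) {R' : Type*} [CommRing R'] (f : R →+* R')
    (x : Matrix (Fin d) (Fin d) R) : compound k (x.map f) = (compound k x).map f := by
  ext a b
  rw [compound_apply, Matrix.map_apply, compound_apply, RingHom.map_det, RingHom.mapMatrix_apply,
    Matrix.submatrix_map]

/-- An injective function from `Fin k` factors uniquely as a permutation followed by an
increasing embedding. -/
lemma exists_orderEmb_perm {k : ℕ} {g : Fin k → Fin d} (hg : Function.Injective g) :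
    ∃ (e : Fin k ↪o Fin d) (σ : Equiv.Perm (Fin k)), ∀ i, e (σ i) = g i := by
  have hcard : (Finset.univ.image g).card = k := by
    rw [Finset.card_image_of_injective _ hg, Finset.card_univ, Fintype.card_fin]
  have hmem : ∀ i, ∃ j, (Finset.univ.image g).orderEmbOfFin hcard j = g i := by
    intro i
    have : g i ∈ Set.range ((Finset.univ.image g).orderEmbOfFin hcard) := by
      rw [Finset.range_orderEmbOfFin]
      simp
    exact this
  choose s hs using hmem
  have hsi : Function.Injective s := fun a b h => hg (by rw [← hs, ← hs, h])
  exact ⟨_, Equiv.ofBijective s (Finite.injective_iff_bijective.1 hsi), hs⟩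

/-- The **Cauchy–Binet formula**. -/
lemma compound_mul (k : ℕ) (x y : Matrix (Fin d) (Fin d) R) :
    compound k (x * y) = compound k x * compound k y := by
  classical
  ext f h
  have h1 : compound k (x * y) f h =
      ∑ g : Fin k → Fin d, (x.submatrix f g).det * ∏ i, y (g i) (h i) := by
    rw [compound_apply, Matrix.det_apply']
    simp only [Matrix.submatrix_apply, Matrix.mul_apply, Finset.prod_univ_sum,
      Fintype.piFinset_univ, Finset.mul_sum]
    rw [Finset.sum_comm]
    refine Finset.sum_congr rfl fun g _ => ?_
    rw [Matrix.det_apply', Finset.sum_mul]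
    refine Finset.sum_congr rfl fun τ _ => ?_
    rw [Finset.prod_mul_distrib, mul_assoc]
    rfl
  rw [h1, Matrix.mul_apply]
  have h2 : ∀ e : Fin k ↪o Fin d, compound k x f e * compound k y e h =
      ∑ σ : Equiv.Perm (Fin k), (x.submatrix f (e ∘ σ)).det * ∏ i, y ((e ∘ σ) i) (h i) := by
    intro e
    rw [compound_apply, compound_apply, Matrix.det_apply' (y.submatrix e h), Finset.mul_sum]
    refine Finset.sum_congr rfl fun σ _ => ?_
    have : x.submatrix f (e ∘ σ) = (x.submatrix f e).submatrix id σ := by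
      ext a b; rfl
    rw [this, Matrix.det_permute']
    simp only [Matrix.submatrix_apply, Function.comp_apply]
    ring
  simp only [h2]
  rw [← Finset.sum_product' (f := fun (e : Fin k ↪o Fin d) (σ : Equiv.Perm (Fin k)) =>
    (x.submatrix f (e ∘ σ)).det * ∏ i, y ((e ∘ σ) i) (h i))]
  symm
  refine Finset.sum_of_injOn (fun p : (Fin k ↪o Fin d) × Equiv.Perm (Fin k) => p.1 ∘ p.2)
    ?_ ?_ ?_ ?_
  · rintro ⟨e, σ⟩ - ⟨e', σ'⟩ - heq
    have he : e = e' := by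
      refine OrderEmbedding.range_inj.1 ?_
      have := congrArg Set.range heq
      simpa [Set.range_comp, σ.surjective.range_eq, σ'.surjective.range_eq] using this
    subst he
    refine Prod.ext rfl (Equiv.ext fun i => e.injective (congrFun heq i))
  · simp
  · intro g _ hg
    have hni : ¬ Function.Injective g := by
      intro hgi
      obtain ⟨e, σ, hσ⟩ := exists_orderEmb_perm hgi
      exact hg ⟨(e, σ), by simp, funext hσ⟩
    rw [Function.Injective] at hni
    push Not at hni
    obtain ⟨i, j, hij, hne⟩ := hni
    rw [Matrix.det_zero_of_column_eq hne fun a => by simp [hij], zero_mul]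
  · simp

lemma compound_partialPerm (k : ℕ) (e₀ f₀ : Fin k ↪o Fin d) :
    compound k (Matrix.of fun i j => if ∃ a, e₀ a = i ∧ f₀ a = j then (1 : R) else 0) =
      Matrix.single e₀ f₀ 1 := by
  classical
  ext e f
  rw [compound_apply, Matrix.single_apply]
  split_ifs with h
  · obtain ⟨rfl, rfl⟩ := h
    rw [← Matrix.det_one (n := Fin k)]
    congr 1
    ext a b
    simp [Matrix.one_apply]
  · by_cases he : e₀ = e
    · have hf : f ≠ f₀ := fun h' => h ⟨he, h'.symm⟩
      obtain ⟨j, hj⟩ := exists_notMem_range_of_ne hf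
      refine Matrix.det_eq_zero_of_column_eq_zero j fun i => ?_
      simp only [Matrix.submatrix_apply, Matrix.of_apply, ite_eq_right_iff]
      rintro ⟨a, -, ha⟩
      exact absurd ⟨a, ha⟩ hj
    · obtain ⟨i, hi⟩ := exists_notMem_range_of_ne (Ne.symm he)
      refine Matrix.det_eq_zero_of_row_eq_zero i fun j => ?_
      simp only [Matrix.submatrix_apply, Matrix.of_apply, ite_eq_right_iff]
      rintro ⟨a, ha, -⟩
      exact absurd ⟨a, ha⟩ hi

lemma norm_compound_apply_le (k : ℕ) (x : Matrix (Fin d) (Fin d) ℂ) {C : ℝ}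
    (hx : ∀ i j, ‖x i j‖ ≤ C) (e f : Fin k ↪o Fin d) :
    ‖compound k x e f‖ ≤ k.factorial * C ^ k := by
  have := Matrix.det_le (A := x.submatrix e f) (abv := NormedField.toAbsoluteValue ℂ)
    (x := C) (fun a b => hx _ _)
  rw [Fintype.card_fin, nsmul_eq_mul] at this
  exact this

end Compound

section Generic

variable {d : ℕ}

/-- The matrix coefficient of the compound matrix attached to a covector and a vector. -/
noncomputable def matCoeff {R : Type*} [CommRing R] (k : ℕ) (ψ v : (Fin k ↪o Fin d) → R)
    (x : Matrix (Fin d) (Fin d) R) : R :=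
  ψ ⬝ᵥ (compound k x *ᵥ v)

lemma eval_matCoeff (k : ℕ) (ψ v : (Fin k ↪o Fin d) → ℂ)
    (Y : Matrix (Fin d) (Fin d) (MvPolynomial (Fin d × Fin d) ℂ)) (z : Fin d × Fin d → ℂ) :
    MvPolynomial.eval z (matCoeff k (MvPolynomial.C ∘ ψ) (MvPolynomial.C ∘ v) Y) =
      matCoeff k ψ v (Y.map (MvPolynomial.eval z)) := by
  unfold matCoeff
  rw [RingHom.map_dotProduct, compound_map]
  have h : ∀ w : (Fin k ↪o Fin d) → ℂ,
      ⇑(MvPolynomial.eval z) ∘ MvPolynomial.C ∘ w = w := fun w => by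
    ext e; simp
  have h2 : ⇑(MvPolynomial.eval z) ∘ (compound k Y *ᵥ (MvPolynomial.C ∘ v)) =
      (compound k Y).map (MvPolynomial.eval z) *ᵥ v := by
    ext e
    rw [Function.comp_apply, RingHom.map_mulVec, h]
  rw [h, h2]

lemma exists_totalDegree_matCoeff_le (k : ℕ)
    (Y : Matrix (Fin d) (Fin d) (MvPolynomial (Fin d × Fin d) ℂ)) :
    ∃ D, ∀ ψ v : (Fin k ↪o Fin d) → ℂ,
      (matCoeff k (MvPolynomial.C ∘ ψ) (MvPolynomial.C ∘ v) Y).totalDegree ≤ D := by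
  refine ⟨∑ e, ∑ f, (compound k Y e f).totalDegree, fun ψ v => ?_⟩
  refine MvPolynomial.totalDegree_finsetSum_le fun e _ => ?_
  refine (MvPolynomial.totalDegree_mul _ _).trans ?_
  rw [Function.comp_apply, MvPolynomial.totalDegree_C, zero_add]
  refine (MvPolynomial.totalDegree_finsetSum_le fun f _ => ?_).trans
    (Finset.single_le_sum (f := fun e => ∑ f, (compound k Y e f).totalDegree) (by simp)
      (Finset.mem_univ e))
  refine (MvPolynomial.totalDegree_mul _ _).trans ?_
  rw [Function.comp_apply, MvPolynomial.totalDegree_C, add_zero]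
  exact Finset.single_le_sum (f := fun f => (compound k Y e f).totalDegree) (by simp)
    (Finset.mem_univ f)

lemma matCoeff_smul_smul {R : Type*} [CommRing R] (k : ℕ) (a b : R) (ψ v : (Fin k ↪o Fin d) → R)
    (x : Matrix (Fin d) (Fin d) R) :
    matCoeff k (a • ψ) (b • v) x = a * b * matCoeff k ψ v x := by
  unfold matCoeff
  rw [Matrix.mulVec_smul, smul_dotProduct, dotProduct_smul, smul_eq_mul, smul_eq_mul, mul_assoc]

lemma matCoeff_smul_right {R : Type*} [CommRing R] (k : ℕ) (c : R) (ψ v : (Fin k ↪o Fin d) → R)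
    (x : Matrix (Fin d) (Fin d) R) :
    matCoeff k ψ v (c • x) = c ^ k * matCoeff k ψ v x := by
  unfold matCoeff
  rw [compound_smul, Matrix.smul_mulVec, dotProduct_smul, smul_eq_mul]

lemma exists_matCoeff_ne_zero (k : ℕ) {ψ v : (Fin k ↪o Fin d) → ℂ} (hψ : ψ ≠ 0) (hv : v ≠ 0) :
    ∃ x, matCoeff k ψ v x ≠ 0 := by
  classical
  obtain ⟨e, he⟩ := Function.ne_iff.1 hψ
  obtain ⟨f, hf⟩ := Function.ne_iff.1 hv
  refine ⟨Matrix.of fun i j => if ∃ a, e a = i ∧ f a = j then (1 : ℂ) else 0, ?_⟩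
  unfold matCoeff
  rw [compound_partialPerm k e f, Matrix.single_mulVec, one_mul]
  have : ψ ⬝ᵥ Function.update 0 e (v f) = ψ e * v f := by
    change ψ ⬝ᵥ Pi.single e (v f) = _
    rw [dotProduct_single]
  rw [this]
  exact mul_ne_zero he hf

lemma exists_eval_ne_zero {p : MvPolynomial (Fin d × Fin d) ℂ} (hp : p ≠ 0) :
    ∃ z, MvPolynomial.eval z p ≠ 0 := by
  by_contra! h
  exact hp (MvPolynomial.funext fun z => by simp [h])

lemma map_eval_mvPolynomialX (z : Fin d × Fin d → ℂ) :
    (Matrix.mvPolynomialX (Fin d) (Fin d) ℂ).map (MvPolynomial.eval z) =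
      Matrix.of fun i j => z (i, j) := by
  ext i j
  simp [Matrix.mvPolynomialX]

lemma matCoeff_mvPolynomialX_ne_zero (k : ℕ) {ψ v : (Fin k ↪o Fin d) → ℂ} (hψ : ψ ≠ 0)
    (hv : v ≠ 0) : matCoeff k (MvPolynomial.C ∘ ψ) (MvPolynomial.C ∘ v)
      (Matrix.mvPolynomialX (Fin d) (Fin d) ℂ) ≠ 0 := by
  obtain ⟨x, hx⟩ := exists_matCoeff_ne_zero k hψ hv
  intro h
  have := congrArg (MvPolynomial.eval fun ij => x ij.1 ij.2) h
  rw [eval_matCoeff, map_eval_mvPolynomialX, map_zero] at this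
  exact hx this

lemma eval_matCoeff_adjugate (k : ℕ) (ψ v : (Fin k ↪o Fin d) → ℂ) (z : Fin d × Fin d → ℂ) :
    MvPolynomial.eval z (matCoeff k (MvPolynomial.C ∘ ψ) (MvPolynomial.C ∘ v)
      (Matrix.mvPolynomialX (Fin d) (Fin d) ℂ).adjugate) =
      matCoeff k ψ v (Matrix.of fun i j => z (i, j)).adjugate := by
  rw [eval_matCoeff, ← RingHom.mapMatrix_apply, RingHom.map_adjugate, RingHom.mapMatrix_apply,
    map_eval_mvPolynomialX]

lemma matCoeff_adjugate_mvPolynomialX_ne_zero (k : ℕ) {ψ v : (Fin k ↪o Fin d) → ℂ} (hψ : ψ ≠ 0)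
    (hv : v ≠ 0) : matCoeff k (MvPolynomial.C ∘ ψ) (MvPolynomial.C ∘ v)
      (Matrix.mvPolynomialX (Fin d) (Fin d) ℂ).adjugate ≠ 0 := by
  obtain ⟨z, hz⟩ := exists_eval_ne_zero (mul_ne_zero (matCoeff_mvPolynomialX_ne_zero k hψ hv)
    (Matrix.det_mvPolynomialX_ne_zero (Fin d) ℂ))
  rw [map_mul, eval_matCoeff, RingHom.map_det, RingHom.mapMatrix_apply,
    map_eval_mvPolynomialX] at hz
  set y : Matrix (Fin d) (Fin d) ℂ := Matrix.of fun i j => z (i, j)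
  have hy : IsUnit y.det := isUnit_iff_ne_zero.2 (right_ne_zero_of_mul hz)
  have hadj : (y⁻¹).adjugate = (y⁻¹).det • y := by
    calc (y⁻¹).adjugate = (y⁻¹).adjugate * (y⁻¹ * y) := by
          rw [Matrix.nonsing_inv_mul _ hy, mul_one]
      _ = _ := by rw [← mul_assoc, Matrix.adjugate_mul, smul_mul_assoc, one_mul]
  intro h
  have := congrArg (MvPolynomial.eval fun ij => y⁻¹ ij.1 ij.2) h
  rw [eval_matCoeff_adjugate, map_zero] at this
  change matCoeff k ψ v (y⁻¹).adjugate = 0 at this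
  rw [hadj, matCoeff_smul_right] at this
  refine (mul_ne_zero (pow_ne_zero _ ?_) (left_ne_zero_of_mul hz)) this
  rw [Matrix.det_nonsing_inv, Ring.inverse_eq_inv']
  exact inv_ne_zero hy.ne_zero

lemma exists_forall_matCoeff_ne_zero [NeZero d] (k r : ℕ) (ψ v : Fin r → (Fin k ↪o Fin d) → ℂ)
    (hψ : ∀ i, ψ i ≠ 0) (hv : ∀ i, v i ≠ 0) :
    ∃ h : SL(d, ℂ), ∀ i, matCoeff k (ψ i) (v i) h.1 ≠ 0 ∧ matCoeff k (ψ i) (v i) (h⁻¹).1 ≠ 0 := by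
  obtain ⟨z, hz⟩ := exists_eval_ne_zero (mul_ne_zero
    (Finset.prod_ne_zero_iff.2 fun i (_ : i ∈ Finset.univ) =>
      mul_ne_zero (matCoeff_mvPolynomialX_ne_zero k (hψ i) (hv i))
        (matCoeff_adjugate_mvPolynomialX_ne_zero k (hψ i) (hv i)))
    (Matrix.det_mvPolynomialX_ne_zero (Fin d) ℂ))
  rw [map_mul, map_prod, RingHom.map_det, RingHom.mapMatrix_apply, map_eval_mvPolynomialX] at hz
  simp only [map_mul, eval_matCoeff_adjugate] at hz
  simp only [eval_matCoeff, map_eval_mvPolynomialX] at hz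
  set x : Matrix (Fin d) (Fin d) ℂ := Matrix.of fun i j => z (i, j)
  have hx := right_ne_zero_of_mul hz
  obtain ⟨t, ht⟩ := IsAlgClosed.exists_pow_nat_eq (x.det)⁻¹ (Nat.pos_of_ne_zero (NeZero.ne d))
  have ht0 : t ≠ 0 := by
    rintro rfl
    rw [zero_pow (NeZero.ne d)] at ht
    exact inv_ne_zero hx ht.symm
  have hdet : (t • x).det = 1 := by
    rw [Matrix.det_smul, Fintype.card_fin, ht, inv_mul_cancel₀ hx]
  refine ⟨⟨t • x, hdet⟩, fun i => ?_⟩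
  have hi := Finset.prod_ne_zero_iff.1 (left_ne_zero_of_mul hz) i (Finset.mem_univ i)
  change matCoeff k (ψ i) (v i) (t • x) ≠ 0 ∧ matCoeff k (ψ i) (v i) (t • x).adjugate ≠ 0
  rw [Matrix.adjugate_smul, matCoeff_smul_right, matCoeff_smul_right]
  exact ⟨mul_ne_zero (pow_ne_zero _ ht0) (left_ne_zero_of_mul hi),
    mul_ne_zero (pow_ne_zero _ (pow_ne_zero _ ht0)) (right_ne_zero_of_mul hi)⟩

end Generic

section Uniform

attribute [local instance] Matrix.linftyOpNormedRing

variable {d : ℕ}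

lemma exists_uniform_matCoeff [NeZero d] (k r : ℕ) :
    ∃ B δ : ℝ, 0 < δ ∧ ∀ ψ v : Fin r → (Fin k ↪o Fin d) → ℂ, (∀ i, ‖ψ i‖ = 1) → (∀ i, ‖v i‖ = 1) →
      ∃ h : SL(d, ℂ), ‖h.1‖ ≤ B ∧
        δ ≤ ∏ i, (‖matCoeff k (ψ i) (v i) h.1‖ * ‖matCoeff k (ψ i) (v i) (h⁻¹).1‖) := by
  set X : Set ((Fin r → (Fin k ↪o Fin d) → ℂ) × (Fin r → (Fin k ↪o Fin d) → ℂ)) :=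
    (Set.univ.pi fun _ => Metric.sphere 0 1) ×ˢ (Set.univ.pi fun _ => Metric.sphere 0 1) with hX
  have hXc : IsCompact X := (isCompact_univ_pi fun _ => isCompact_sphere 0 1).prod
    (isCompact_univ_pi fun _ => isCompact_sphere 0 1)
  set F : SL(d, ℂ) → ((Fin r → (Fin k ↪o Fin d) → ℂ) × (Fin r → (Fin k ↪o Fin d) → ℂ)) → ℝ :=
    fun h q => ∏ i, (‖matCoeff k (q.1 i) (q.2 i) h.1‖ * ‖matCoeff k (q.1 i) (q.2 i) (h⁻¹).1‖)
    with hF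
  have hFc : ∀ h, Continuous (F h) := by
    intro h
    simp only [hF, matCoeff, dotProduct, Matrix.mulVec]
    fun_prop
  obtain ⟨n, hn⟩ := hXc.elim_directed_cover
    (fun n : ℕ => ⋃ h ∈ {h : SL(d, ℂ) | ‖h.1‖ ≤ n}, {q | 1 / ((n : ℝ) + 1) < F h q})
    (fun n => isOpen_biUnion fun h _ => isOpen_lt continuous_const (hFc h))
    (fun q hq => by
      have hq1 : ∀ i, q.1 i ≠ 0 := fun i h0 => by
        have := hq.1 i trivial
        simp [h0] at this
      have hq2 : ∀ i, q.2 i ≠ 0 := fun i h0 => by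
        have := hq.2 i trivial
        simp [h0] at this
      obtain ⟨h, hh⟩ := exists_forall_matCoeff_ne_zero k r q.1 q.2 hq1 hq2
      have hpos : 0 < F h q := Finset.prod_pos fun i _ =>
        mul_pos (norm_pos_iff.2 (hh i).1) (norm_pos_iff.2 (hh i).2)
      obtain ⟨n₁, hn₁⟩ := exists_nat_ge ‖h.1‖
      obtain ⟨n₂, hn₂⟩ := exists_nat_one_div_lt hpos
      refine Set.mem_iUnion.2 ⟨max n₁ n₂, Set.mem_iUnion₂.2 ⟨h, ?_, ?_⟩⟩
      · exact hn₁.trans (by exact_mod_cast le_max_left _ _)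
      · refine lt_of_le_of_lt (one_div_le_one_div_of_le (by positivity) ?_) hn₂
        push_cast
        gcongr
        exact le_max_right _ _)
    (directed_of_isDirected_le fun a b hab => by
      refine Set.iUnion₂_subset fun h hh => ?_
      intro q hq
      refine Set.mem_iUnion₂.2 ⟨h, ?_, ?_⟩
      · exact (show ‖h.1‖ ≤ a from hh).trans (Nat.cast_le.2 hab)
      · refine lt_of_le_of_lt (one_div_le_one_div_of_le (by positivity) ?_)
          (show 1 / ((a : ℝ) + 1) < F h q from hq)
        gcongr)
  refine ⟨n, 1 / ((n : ℝ) + 1), by positivity, fun ψ v hψ hv => ?_⟩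
  have hq : (ψ, v) ∈ X := ⟨fun i _ => by simpa using hψ i, fun i _ => by simpa using hv i⟩
  obtain ⟨h, hh, hlt⟩ := Set.mem_iUnion₂.1 (hn hq)
  exact ⟨h, hh, le_of_lt hlt⟩

lemma norm_matCoeff_le (k : ℕ) (ψ v : (Fin k ↪o Fin d) → ℂ) (x : Matrix (Fin d) (Fin d) ℂ) {C : ℝ}
    (hx : ‖x‖ ≤ C) : ‖matCoeff k ψ v x‖ ≤
      (Fintype.card (Fin k ↪o Fin d) : ℝ) ^ 2 * k.factorial * C ^ k * (‖ψ‖ * ‖v‖) := by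
  have hC : 0 ≤ C := (norm_nonneg _).trans hx
  have h1 : ∀ e, ‖(compound k x *ᵥ v) e‖ ≤
      (Fintype.card (Fin k ↪o Fin d)) * (k.factorial * C ^ k * ‖v‖) := fun e => by
    refine (norm_sum_le _ _).trans ((Finset.sum_le_card_nsmul _ _
      (k.factorial * C ^ k * ‖v‖) fun f _ => ?_).trans ?_)
    · rw [norm_mul]
      exact mul_le_mul (norm_compound_apply_le k x
        (fun i j => (norm_apply_le_linfty x i j).trans hx) e f) (norm_le_pi_norm v f)
        (norm_nonneg _) (by positivity)
    · simp
  refine (norm_sum_le _ _).trans ((Finset.sum_le_card_nsmul _ _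
      (‖ψ‖ * ((Fintype.card (Fin k ↪o Fin d)) * (k.factorial * C ^ k * ‖v‖)))
      fun f _ => ?_).trans ?_)
  · rw [norm_mul]
    exact mul_le_mul (norm_le_pi_norm ψ f) (h1 f) (norm_nonneg _) (norm_nonneg _)
  · rw [nsmul_eq_mul, Finset.card_univ]
    apply le_of_eq
    ring


lemma le_mul_pow_of_le_prod {r : ℕ} {a : Fin r → ℝ} {δ M : ℝ} (h0 : ∀ i, 0 ≤ a i)
    (hM : ∀ i, a i ≤ M) (hM1 : 1 ≤ M) (h : δ ≤ ∏ i, a i) (i : Fin r) : δ ≤ a i * M ^ r := by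
  classical
  rw [← Finset.mul_prod_erase _ _ (Finset.mem_univ i)] at h
  refine h.trans (mul_le_mul_of_nonneg_left ?_ (h0 i))
  refine (Finset.prod_le_prod (fun j _ => h0 j) fun j _ => hM j).trans ?_
  rw [Finset.prod_const]
  exact pow_le_pow_right₀ hM1 ((Finset.card_le_univ _).trans (by simp))

lemma inv_mem_pow_of_symm {G : Type*} [Group G] {S : Set G} (hS : S⁻¹ = S) {m : ℕ} {x : G}
    (hx : x ∈ S ^ m) : x⁻¹ ∈ S ^ m := by
  rw [← Set.inv_mem_inv, ← inv_pow, hS] at hx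
  exact hx

lemma exists_generic_unit (d k r : ℕ) [NeZero d] :
    ∃ m c D : ℕ, ∀ S : Set SL(d, ℤ), 1 ∈ S → S⁻¹ = S → DenseUpTo D (Subgroup.closure S) →
      ∀ (P : GL (Fin d) ℂ) (K : ℝ), 2 ≤ K → (∀ s ∈ S, ‖(conjRep P s).1‖ ≤ K) →
      ∀ ψ v : Fin r → (Fin k ↪o Fin d) → ℂ, (∀ i, ‖ψ i‖ = 1) → (∀ i, ‖v i‖ = 1) →
      ∃ γ ∈ S ^ m, ∀ i, 1 ≤ K ^ c * ‖matCoeff k (ψ i) (v i) (conjRep P γ).1‖ ∧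
        1 ≤ K ^ c * ‖matCoeff k (ψ i) (v i) (conjRep P γ⁻¹).1‖ := by
  obtain ⟨B, δ, hδ, hB⟩ := exists_uniform_matCoeff (d := d) k r
  obtain ⟨D₁, hD₁⟩ := exists_totalDegree_matCoeff_le (d := d) k
    (Matrix.mvPolynomialX (Fin d) (Fin d) ℂ)
  obtain ⟨D₂, hD₂⟩ := exists_totalDegree_matCoeff_le (d := d) k
    (Matrix.mvPolynomialX (Fin d) (Fin d) ℂ).adjugate
  obtain ⟨m, c₀, hm⟩ := exists_escape d (r * (D₁ + D₂)) B
  obtain ⟨b, hb⟩ := exists_le_two_pow ((Fintype.card (Fin k ↪o Fin d) : ℝ) ^ 2 * k.factorial)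
  obtain ⟨a, ha⟩ := exists_le_two_pow δ⁻¹
  set t := b + m * k with ht
  refine ⟨m, a + c₀ + 2 * t * r + t, r * (D₁ + D₂), fun S h1 hS hD P K hK hSK ψ v hψ hv => ?_⟩
  have hK1 : 1 ≤ K := by linarith
  have hK0 : 0 < K := by linarith
  have h2K : ∀ {C : ℝ} {c : ℕ}, C ≤ 2 ^ c → C ≤ K ^ c := fun {C c} hC =>
    hC.trans (pow_le_pow_left₀ (by norm_num) hK c)
  obtain ⟨h, hh, hδh⟩ := hB ψ v hψ hv
  set p : MvPolynomial (Fin d × Fin d) ℂ := ∏ i,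
    (matCoeff k (MvPolynomial.C ∘ ψ i) (MvPolynomial.C ∘ v i)
      (Matrix.mvPolynomialX (Fin d) (Fin d) ℂ) *
     matCoeff k (MvPolynomial.C ∘ ψ i) (MvPolynomial.C ∘ v i)
      (Matrix.mvPolynomialX (Fin d) (Fin d) ℂ).adjugate) with hp
  have hpd : p.totalDegree ≤ r * (D₁ + D₂) := by
    refine (MvPolynomial.totalDegree_finsetProd _ _).trans
      ((Finset.sum_le_card_nsmul _ _ (D₁ + D₂) fun i _ => ?_).trans (by simp))
    exact (MvPolynomial.totalDegree_mul _ _).trans (add_le_add (hD₁ _ _) (hD₂ _ _))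
  have hpe : ∀ g : SL(d, ℂ), ‖MvPolynomial.eval (fun ij => g.1 ij.1 ij.2) p‖ =
      ∏ i, (‖matCoeff k (ψ i) (v i) g.1‖ * ‖matCoeff k (ψ i) (v i) (g⁻¹).1‖) := by
    intro g
    rw [hp, map_prod, norm_prod]
    refine Finset.prod_congr rfl fun i _ => ?_
    rw [map_mul, norm_mul, eval_matCoeff_adjugate, eval_matCoeff, map_eval_mvPolynomialX]
    rfl
  obtain ⟨γ, hγ, hle⟩ := hm S h1 hS hD P K hK hSK h hh p hpd
  rw [hpe, hpe, ← map_inv] at hle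
  have hbd : ∀ γ ∈ S ^ m, ∀ i, ‖matCoeff k (ψ i) (v i) (conjRep P γ).1‖ ≤ K ^ t := by
    intro γ hγ i
    refine (norm_matCoeff_le k _ _ _ (norm_conjRep_le hSK hγ)).trans ?_
    rw [hψ, hv, one_mul, mul_one, ht, pow_add, pow_mul]
    exact mul_le_mul_of_nonneg_right (h2K hb) (by positivity)
  have hγ' := inv_mem_pow_of_symm hS hγ
  have hδK : 1 ≤ K ^ a * δ := by
    calc 1 = δ⁻¹ * δ := (inv_mul_cancel₀ hδ.ne').symm
      _ ≤ _ := mul_le_mul_of_nonneg_right (h2K ha) hδ.le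
  have hδK' : 1 ≤ K ^ (a + c₀) * ∏ i, (‖matCoeff k (ψ i) (v i) (conjRep P γ).1‖ *
      ‖matCoeff k (ψ i) (v i) (conjRep P γ⁻¹).1‖) := by
    refine hδK.trans ?_
    rw [pow_add, mul_assoc]
    exact mul_le_mul_of_nonneg_left (hδh.trans hle) (by positivity)
  have key : ∀ i, 1 ≤ K ^ (a + c₀) * ((‖matCoeff k (ψ i) (v i) (conjRep P γ).1‖ *
      ‖matCoeff k (ψ i) (v i) (conjRep P γ⁻¹).1‖) * (K ^ (2 * t)) ^ r) := fun i => by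
    refine hδK'.trans (mul_le_mul_of_nonneg_left ?_ (by positivity))
    refine le_mul_pow_of_le_prod (fun i => by positivity) (fun i => ?_) (one_le_pow₀ hK1) le_rfl i
    rw [two_mul, pow_add]
    exact mul_le_mul (hbd γ hγ i) (hbd _ hγ' i) (norm_nonneg _) (by positivity)
  refine ⟨γ, hγ, fun i => ⟨(key i).trans ?_, (key i).trans ?_⟩⟩
  · calc _ = K ^ (a + c₀ + 2 * t * r) * ‖matCoeff k (ψ i) (v i) (conjRep P γ).1‖ *
          ‖matCoeff k (ψ i) (v i) (conjRep P γ⁻¹).1‖ := by ring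
      _ ≤ K ^ (a + c₀ + 2 * t * r) * ‖matCoeff k (ψ i) (v i) (conjRep P γ).1‖ * K ^ t :=
        mul_le_mul_of_nonneg_left (hbd _ hγ' i) (by positivity)
      _ = _ := by ring
  · calc _ = K ^ (a + c₀ + 2 * t * r) * ‖matCoeff k (ψ i) (v i) (conjRep P γ⁻¹).1‖ *
          ‖matCoeff k (ψ i) (v i) (conjRep P γ).1‖ := by ring
      _ ≤ K ^ (a + c₀ + 2 * t * r) * ‖matCoeff k (ψ i) (v i) (conjRep P γ⁻¹).1‖ * K ^ t :=
        mul_le_mul_of_nonneg_left (hbd _ hγ i) (by positivity)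
      _ = _ := by ring

/-- Finitely many pairs of a covector and a vector are simultaneously put in general position by
a word of bounded length. -/
theorem exists_generic (d k r : ℕ) [NeZero d] :
    ∃ m c D : ℕ, ∀ S : Set SL(d, ℤ), 1 ∈ S → S⁻¹ = S → DenseUpTo D (Subgroup.closure S) →
      ∀ (P : GL (Fin d) ℂ) (K : ℝ), 2 ≤ K → (∀ s ∈ S, ‖(conjRep P s).1‖ ≤ K) →
      ∀ ψ v : Fin r → (Fin k ↪o Fin d) → ℂ,
      ∃ γ ∈ S ^ m, ∀ i, ‖ψ i‖ * ‖v i‖ ≤ K ^ c * ‖matCoeff k (ψ i) (v i) (conjRep P γ).1‖ ∧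
        ‖ψ i‖ * ‖v i‖ ≤ K ^ c * ‖matCoeff k (ψ i) (v i) (conjRep P γ⁻¹).1‖ := by
  obtain ⟨m, c, D, H⟩ := exists_generic_unit d k r
  refine ⟨m, c, D, fun S h1 hS hD P K hK hSK ψ v => ?_⟩
  rcases isEmpty_or_nonempty (Fin k ↪o Fin d) with hI | hI
  · refine ⟨1, Set.one_mem_pow h1, fun i => ?_⟩
    have : ‖ψ i‖ = 0 := by rw [Subsingleton.elim (ψ i) 0, norm_zero]
    rw [this, zero_mul]
    constructor <;> positivity
  have hunit : ∀ w : (Fin k ↪o Fin d) → ℂ, ∃ w' : (Fin k ↪o Fin d) → ℂ,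
      ‖w'‖ = 1 ∧ w = (‖w‖ : ℂ) • w' := by
    intro w
    by_cases hw : w = 0
    · exact ⟨fun _ => 1, by simp [pi_norm_const], by simp [hw]⟩
    · have hw' : (‖w‖ : ℂ) ≠ 0 := by simpa using hw
      exact ⟨(‖w‖ : ℂ)⁻¹ • w, by simp [norm_smul, hw], by
        rw [smul_smul, mul_inv_cancel₀ hw', one_smul]⟩
  choose u hu1 hu using hunit
  obtain ⟨γ, hγ, h⟩ := H S h1 hS hD P K hK hSK (fun i => u (ψ i)) (fun i => u (v i))
    (fun i => hu1 _) (fun i => hu1 _)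
  have hsc : ∀ i x, ‖matCoeff k (ψ i) (v i) x‖ =
      ‖ψ i‖ * ‖v i‖ * ‖matCoeff k (u (ψ i)) (u (v i)) x‖ := fun i x => by
    conv_lhs => rw [hu (ψ i), hu (v i), matCoeff_smul_smul]
    simp
  refine ⟨γ, hγ, fun i => ?_⟩
  rw [hsc, hsc]
  constructor
  · calc _ = ‖ψ i‖ * ‖v i‖ * 1 := (mul_one _).symm
      _ ≤ ‖ψ i‖ * ‖v i‖ * _ := mul_le_mul_of_nonneg_left (h i).1 (by positivity)
      _ = _ := by ring
  · calc _ = ‖ψ i‖ * ‖v i‖ * 1 := (mul_one _).symm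
      _ ≤ ‖ψ i‖ * ‖v i‖ * _ := mul_le_mul_of_nonneg_left (h i).2 (by positivity)
      _ = _ := by ring

end Uniform

section Sequence

attribute [local instance] Matrix.linftyOpNormedRing

variable {d : ℕ}

lemma norm_compound_mulVec_le (k : ℕ) (v : (Fin k ↪o Fin d) → ℂ) (x : Matrix (Fin d) (Fin d) ℂ)
    {C : ℝ} (hx : ‖x‖ ≤ C) : ‖compound k x *ᵥ v‖ ≤
      (Fintype.card (Fin k ↪o Fin d) : ℝ) * k.factorial * C ^ k * ‖v‖ := by
  have hC : 0 ≤ C := (norm_nonneg _).trans hx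
  refine (pi_norm_le_iff_of_nonneg (by positivity)).2 fun e => ?_
  refine (norm_sum_le _ _).trans ((Finset.sum_le_card_nsmul _ _
    (k.factorial * C ^ k * ‖v‖) fun f _ => ?_).trans ?_)
  · rw [norm_mul]
    exact mul_le_mul (norm_compound_apply_le k x
      (fun i j => (norm_apply_le_linfty x i j).trans hx) e f) (norm_le_pi_norm v f)
      (norm_nonneg _) (by positivity)
  · rw [nsmul_eq_mul, Finset.card_univ]
    apply le_of_eq
    ring

lemma norm_vecMul_compound_le (k : ℕ) (v : (Fin k ↪o Fin d) → ℂ) (x : Matrix (Fin d) (Fin d) ℂ)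
    {C : ℝ} (hx : ‖x‖ ≤ C) : ‖v ᵥ* compound k x‖ ≤
      (Fintype.card (Fin k ↪o Fin d) : ℝ) * k.factorial * C ^ k * ‖v‖ := by
  have hC : 0 ≤ C := (norm_nonneg _).trans hx
  refine (pi_norm_le_iff_of_nonneg (by positivity)).2 fun e => ?_
  refine (norm_sum_le _ _).trans ((Finset.sum_le_card_nsmul _ _
    (k.factorial * C ^ k * ‖v‖) fun f _ => ?_).trans ?_)
  · rw [norm_mul, mul_comm]
    exact mul_le_mul (norm_compound_apply_le k x
      (fun i j => (norm_apply_le_linfty x i j).trans hx) f e) (norm_le_pi_norm v f)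
      (norm_nonneg _) (by positivity)
  · rw [nsmul_eq_mul, Finset.card_univ]
    apply le_of_eq
    ring

lemma matCoeff_mul_left {R : Type*} [CommRing R] (k : ℕ) (ψ v : (Fin k ↪o Fin d) → R)
    (x y : Matrix (Fin d) (Fin d) R) :
    matCoeff k ψ v (x * y) = matCoeff k (ψ ᵥ* compound k x) v y := by
  unfold matCoeff
  rw [compound_mul, ← Matrix.mulVec_mulVec, Matrix.dotProduct_mulVec]

lemma matCoeff_mul_right {R : Type*} [CommRing R] (k : ℕ) (ψ v : (Fin k ↪o Fin d) → R)
    (x y : Matrix (Fin d) (Fin d) R) :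
    matCoeff k ψ v (x * y) = matCoeff k ψ (compound k y *ᵥ v) x := by
  unfold matCoeff
  rw [compound_mul, ← Matrix.mulVec_mulVec]

theorem exists_generic_fintype (d k : ℕ) [NeZero d] (ι : Type) [Fintype ι] :
    ∃ m c D : ℕ, ∀ S : Set SL(d, ℤ), 1 ∈ S → S⁻¹ = S → DenseUpTo D (Subgroup.closure S) →
      ∀ (P : GL (Fin d) ℂ) (K : ℝ), 2 ≤ K → (∀ s ∈ S, ‖(conjRep P s).1‖ ≤ K) →
      ∀ ψ v : ι → (Fin k ↪o Fin d) → ℂ,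
      ∃ γ ∈ S ^ m, ∀ i, ‖ψ i‖ * ‖v i‖ ≤ K ^ c * ‖matCoeff k (ψ i) (v i) (conjRep P γ).1‖ ∧
        ‖ψ i‖ * ‖v i‖ ≤ K ^ c * ‖matCoeff k (ψ i) (v i) (conjRep P γ⁻¹).1‖ := by
  obtain ⟨m, c, D, H⟩ := exists_generic d k (Fintype.card ι)
  refine ⟨m, c, D, fun S h1 hS hD P K hK hSK ψ v => ?_⟩
  obtain ⟨γ, hγ, h⟩ := H S h1 hS hD P K hK hSK (ψ ∘ (Fintype.equivFin ι).symm)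
    (v ∘ (Fintype.equivFin ι).symm)
  refine ⟨γ, hγ, fun i => ?_⟩
  simpa using h (Fintype.equivFin ι i)

/-- A sequence of words of bounded length in mutually general position. -/
theorem exists_generic_sequence (d k : ℕ) [NeZero d] (n : ℕ) :
    ∃ m c D : ℕ, ∀ S : Set SL(d, ℤ), 1 ∈ S → S⁻¹ = S → DenseUpTo D (Subgroup.closure S) →
      ∀ (P : GL (Fin d) ℂ) (K : ℝ), 2 ≤ K → (∀ s ∈ S, ‖(conjRep P s).1‖ ≤ K) →
      ∀ (φ : Bool → (Fin k ↪o Fin d) → ℂ) (χ v : (Fin k ↪o Fin d) → ℂ),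
      ∃ u : ℕ → SL(d, ℤ), u 0 = 1 ∧ (∀ i, u i ∈ S ^ m) ∧
        (∀ i ≤ n, ∀ j ≤ n, i ≠ j → ∀ b, ‖φ b‖ * ‖v‖ ≤
          K ^ c * ‖matCoeff k (φ b) v (conjRep P ((u i)⁻¹ * u j)).1‖) ∧
        ∀ i ≤ n, i ≠ 0 → ‖χ‖ * ‖v‖ ≤ K ^ c * ‖matCoeff k χ v (conjRep P (u i)).1‖ := by
  induction n with
  | zero =>
    refine ⟨0, 0, 0, fun S h1 hS hD P K hK hSK φ χ v => ⟨fun _ => 1, rfl, fun _ => by simp, ?_, ?_⟩⟩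
    · intro i hi j hj hij
      omega
    · intro i hi hi0
      omega
  | succ n ih =>
    obtain ⟨m₁, c₁, D₁, H₁⟩ := ih
    obtain ⟨m₂, c₂, D₂, H₂⟩ := exists_generic_fintype d k
      ((Bool × Fin (n + 1)) ⊕ (Bool × Fin (n + 1)) ⊕ Unit)
    obtain ⟨b, hb⟩ := exists_le_two_pow ((Fintype.card (Fin k ↪o Fin d) : ℝ) * k.factorial)
    set t := b + m₁ * k with ht
    refine ⟨max m₁ m₂, c₁ + t + c₂, max D₁ D₂, fun S h1 hS hD P K hK hSK φ χ v => ?_⟩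
    have hK1 : 1 ≤ K := by linarith
    have hK0 : 0 < K := by linarith
    have h2K : ∀ {C : ℝ} {c : ℕ}, C ≤ 2 ^ c → C ≤ K ^ c := fun {C c} hC =>
      hC.trans (pow_le_pow_left₀ (by norm_num) hK c)
    have hwk : ∀ {c c' : ℕ} {A B : ℝ}, c ≤ c' → 0 ≤ B → A ≤ K ^ c * B → A ≤ K ^ c' * B :=
      fun hc hB hA => hA.trans (mul_le_mul_of_nonneg_right (pow_le_pow_right₀ hK1 hc) hB)
    obtain ⟨u, hu0, huS, hu, huχ⟩ := H₁ S h1 hS (hD.mono (le_max_left _ _)) P K hK hSK φ χ v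
    obtain ⟨γ, hγ, h⟩ := H₂ S h1 hS (hD.mono (le_max_right _ _)) P K hK hSK
      (Sum.elim (fun q => φ q.1)
        (Sum.elim (fun q => φ q.1 ᵥ* compound k (conjRep P (u q.2)⁻¹).1) fun _ => χ))
      (Sum.elim (fun q => compound k (conjRep P (u q.2)).1 *ᵥ v) (fun _ => v))
    have hbase : (Fintype.card (Fin k ↪o Fin d) : ℝ) * k.factorial * (K ^ m₁) ^ k ≤ K ^ t := by
      rw [ht, pow_add, pow_mul]
      exact mul_le_mul_of_nonneg_right (h2K hb) (by positivity)
    have hv : ∀ i, ‖v‖ ≤ K ^ t * ‖compound k (conjRep P (u i)).1 *ᵥ v‖ := by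
      intro i
      have h3 : v = compound k (conjRep P (u i)⁻¹).1 *ᵥ (compound k (conjRep P (u i)).1 *ᵥ v) := by
        rw [Matrix.mulVec_mulVec, ← compound_mul, ← Matrix.SpecialLinearGroup.coe_mul, ← map_mul,
          inv_mul_cancel, map_one, Matrix.SpecialLinearGroup.coe_one, compound_one,
          Matrix.one_mulVec]
      conv_lhs => rw [h3]
      exact (norm_compound_mulVec_le k _ _ (norm_conjRep_le hSK
        (inv_mem_pow_of_symm hS (huS i)))).trans
          (mul_le_mul_of_nonneg_right hbase (norm_nonneg _))
    have hφ : ∀ i b, ‖φ b‖ ≤ K ^ t * ‖φ b ᵥ* compound k (conjRep P (u i)⁻¹).1‖ := by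
      intro i b
      have h3 : φ b =
          (φ b ᵥ* compound k (conjRep P (u i)⁻¹).1) ᵥ* compound k (conjRep P (u i)).1 := by
        rw [Matrix.vecMul_vecMul, ← compound_mul, ← Matrix.SpecialLinearGroup.coe_mul, ← map_mul,
          inv_mul_cancel, map_one, Matrix.SpecialLinearGroup.coe_one, compound_one,
          Matrix.vecMul_one]
      conv_lhs => rw [h3]
      exact (norm_vecMul_compound_le k _ _ (norm_conjRep_le hSK (huS i))).trans
          (mul_le_mul_of_nonneg_right hbase (norm_nonneg _))
    refine ⟨fun i => if i = n + 1 then γ else u i, by simpa using hu0, ?_, ?_, ?_⟩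
    · intro i
      dsimp only
      split_ifs
      · exact Set.pow_subset_pow_right h1 (le_max_right _ _) hγ
      · exact Set.pow_subset_pow_right h1 (le_max_left _ _) (huS i)
    · intro i hi j hj hij b
      dsimp only
      split_ifs with h3 h4 h4
      · omega
      · have := (h (Sum.inl (b, ⟨j, by omega⟩))).2
        simp only [Sum.elim_inl] at this
        rw [map_mul, Matrix.SpecialLinearGroup.coe_mul, matCoeff_mul_right]
        refine hwk (c := t + c₂) (by omega) (norm_nonneg _) ?_
        calc _ ≤ ‖φ b‖ * (K ^ t * ‖compound k (conjRep P (u j)).1 *ᵥ v‖) :=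
              mul_le_mul_of_nonneg_left (hv j) (norm_nonneg _)
          _ = K ^ t * (‖φ b‖ * ‖compound k (conjRep P (u j)).1 *ᵥ v‖) := by ring
          _ ≤ K ^ t * _ := mul_le_mul_of_nonneg_left this (by positivity)
          _ = _ := by rw [pow_add]; ring
      · have := (h (Sum.inr (Sum.inl (b, ⟨i, by omega⟩)))).1
        simp only [Sum.elim_inl, Sum.elim_inr] at this
        rw [map_mul, Matrix.SpecialLinearGroup.coe_mul, matCoeff_mul_left]
        refine hwk (c := t + c₂) (by omega) (norm_nonneg _) ?_
        calc _ ≤ K ^ t * ‖φ b ᵥ* compound k (conjRep P (u i)⁻¹).1‖ * ‖v‖ :=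
              mul_le_mul_of_nonneg_right (hφ i b) (norm_nonneg _)
          _ = K ^ t * (‖φ b ᵥ* compound k (conjRep P (u i)⁻¹).1‖ * ‖v‖) := by ring
          _ ≤ K ^ t * _ := mul_le_mul_of_nonneg_left this (by positivity)
          _ = _ := by rw [pow_add]; ring
      · exact hwk (by omega) (norm_nonneg _) (hu i (by omega) j (by omega) hij b)
    · intro i hi hi0
      dsimp only
      split_ifs with h3
      · exact hwk (by omega) (norm_nonneg _) (h (Sum.inr (Sum.inr ()))).1
      · exact hwk (by omega) (norm_nonneg _) (huχ i (by omega) hi0)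

end Sequence

section PingPong

lemma freelyGens_of_pingPong {G X : Type*} [Group G] (ρ : G → X → X)
    (hρ1 : ∀ w, ρ 1 w = w) (hρ : ∀ g h w, ρ (g * h) w = ρ g (ρ h w)) {x y : G}
    (g : Bool × Bool → G) (hg : ∀ b, g (b, true) = if b then x else y)
    (hg' : ∀ b, g (b, false) = (if b then x else y)⁻¹) (U : Bool × Bool → Set X) (v : X)
    (hv : ∀ s, v ∉ U s) (hvU : ∀ s, ρ (g s) v ∈ U s)
    (hU : ∀ s t : Bool × Bool, (s.1 = t.1 → s.2 = t.2) → ∀ w ∈ U t, ρ (g s) w ∈ U s) :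
    FreelyGens x y := by
  refine (injective_iff_map_eq_one _).2 fun w hw => ?_
  have hprod : ∀ L : List (Bool × Bool),
      FreeGroup.lift (fun b : Bool => if b then x else y) (FreeGroup.mk L) = (L.map g).prod := by
    intro L
    rw [FreeGroup.lift_mk]
    congr 1
    refine List.map_congr_left fun s _ => ?_
    obtain ⟨b, _ | _⟩ := s
    · rw [hg']; rfl
    · rw [hg]; rfl
  have key : ∀ (L : List (Bool × Bool)) (s : Bool × Bool), FreeGroup.IsReduced (s :: L) →
      ρ (((s :: L).map g).prod) v ∈ U s := by
    intro L
    induction L with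
    | nil => intro s _; simpa using hvU s
    | cons t L ih =>
      intro s hs
      rw [FreeGroup.isReduced_cons_cons] at hs
      rw [List.map_cons, List.prod_cons, hρ]
      exact hU s t hs.1 _ (ih t hs.2)
  have hred : FreeGroup.IsReduced w.toWord := FreeGroup.isReduced_toWord
  rw [← FreeGroup.mk_toWord (x := w), hprod] at hw
  rcases hL : w.toWord with _ | ⟨s, L⟩
  · exact FreeGroup.toWord_eq_nil_iff.1 hL
  · rw [hL] at hw hred
    have := key L s hred
    rw [hw, hρ1] at this
    exact absurd this (hv s)

variable {ι : Type*} [Fintype ι] [DecidableEq ι]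

/-- Ping-pong for matrices close to rank one, in general position. -/
lemma freelyGens_of_near_rank_one {G : Type*} [Group G] (A : G →* Matrix ι ι ℂ) {x y : G}
    (g : Bool × Bool → G) (hg : ∀ b, g (b, true) = if b then x else y)
    (hg' : ∀ b, g (b, false) = (if b then x else y)⁻¹) {δ M ε : ℝ} (hδ : 0 < δ) (hδ1 : δ ≤ 1)
    (hM : 1 ≤ M) (hε0 : 0 ≤ ε) (hε : 8 * M ^ 2 * ε ≤ δ ^ 2) (c : ℂ) (hc : c ≠ 0)
    (ψ v : Bool × Bool → ι → ℂ) (e : ι → ℂ) (he : ‖e‖ = 1) (i₁ : ι) (hi₁ : e i₁ = 0)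
    (hA : ∀ s w, ‖A (g s) *ᵥ w - (c * (ψ s ⬝ᵥ w)) • v s‖ ≤ ‖c‖ * ε * ‖w‖)
    (hψM : ∀ s w, ‖ψ s ⬝ᵥ w‖ ≤ M * ‖w‖) (hvM : ∀ s, ‖v s‖ ≤ M)
    (hψv : ∀ s t : Bool × Bool, (s.1 = t.1 → s.2 = t.2) → δ ≤ ‖ψ s ⬝ᵥ v t‖)
    (hψe : ∀ s, δ ≤ ‖ψ s ⬝ᵥ e‖) (hv : ∀ s, δ ≤ ‖v s i₁‖) : FreelyGens x y := by
  have hM0 : 0 < M := by linarith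
  set η := δ / (2 * M) with hη
  have hηM : M * η = δ / 2 := by rw [hη]; field_simp
  have hη0 : 0 < η := by positivity
  have hη1 : η ≤ δ / 2 := by nlinarith
  have hεη : ε * (2 * M) ≤ η * (δ / 2) := by
    have h1 : M * (ε * (2 * M)) ≤ M * (η * (δ / 2)) := by
      rw [← mul_assoc M η, hηM]
      nlinarith
    exact le_of_mul_le_mul_left h1 hM0
  refine freelyGens_of_pingPong (fun g w => A g *ᵥ w) (fun w => by simp)
    (fun g h w => by simp [Matrix.mulVec_mulVec]) g hg hg'
    (fun s => {w | ∃ a : ℂ, a ≠ 0 ∧ ‖w - a • v s‖ ≤ η * ‖a‖}) e ?_ ?_ ?_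
  · rintro s ⟨a, ha, h⟩
    have h1 := (norm_le_pi_norm _ i₁).trans h
    rw [Pi.sub_apply, hi₁, Pi.smul_apply, zero_sub, norm_neg, smul_eq_mul, norm_mul] at h1
    have ha' := norm_pos_iff.2 ha
    nlinarith [hv s]
  · intro s
    have h2 : 0 < ‖ψ s ⬝ᵥ e‖ := hδ.trans_le (hψe s)
    refine ⟨c * (ψ s ⬝ᵥ e), mul_ne_zero hc (norm_pos_iff.1 h2), (hA s e).trans ?_⟩
    rw [he, mul_one, norm_mul]
    have : ε ≤ η * ‖ψ s ⬝ᵥ e‖ := by nlinarith [hψe s]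
    nlinarith [norm_nonneg c]
  · rintro s t hst w ⟨a, ha, h⟩
    have ha' := norm_pos_iff.2 ha
    have h1 : ‖ψ s ⬝ᵥ w‖ ≥ ‖a‖ * (δ / 2) := by
      have h2 : ψ s ⬝ᵥ w = a * (ψ s ⬝ᵥ v t) + ψ s ⬝ᵥ (w - a • v t) := by
        rw [dotProduct_sub, dotProduct_smul, smul_eq_mul]; ring
      have h3 := norm_sub_le_norm_add (a * (ψ s ⬝ᵥ v t)) (ψ s ⬝ᵥ (w - a • v t))
      rw [← h2, norm_mul] at h3
      have h4 := hψM s (w - a • v t)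
      have h5 : M * ‖w - a • v t‖ ≤ δ / 2 * ‖a‖ := by
        rw [← hηM, mul_assoc]
        exact mul_le_mul_of_nonneg_left h hM0.le
      have h6 := mul_le_mul_of_nonneg_left (hψv s t hst) ha'.le
      linarith
    have h2 : ‖w‖ ≤ ‖a‖ * (2 * M) := by
      have h3 : ‖w‖ ≤ ‖w - a • v t‖ + ‖a • v t‖ := by
        simpa using norm_add_le (w - a • v t) (a • v t)
      rw [norm_smul] at h3
      have h4 := mul_le_mul_of_nonneg_left (hvM t) ha'.le
      have h5 : η ≤ M := by linarith
      nlinarith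
    have h3 : 0 < ‖ψ s ⬝ᵥ w‖ := by
      have : 0 < ‖a‖ * (δ / 2) := by positivity
      linarith
    refine ⟨c * (ψ s ⬝ᵥ w), mul_ne_zero hc (norm_pos_iff.1 h3), (hA s w).trans ?_⟩
    rw [norm_mul]
    have h4 : ε * ‖w‖ ≤ η * ‖ψ s ⬝ᵥ w‖ := by
      calc ε * ‖w‖ ≤ ε * (‖a‖ * (2 * M)) := mul_le_mul_of_nonneg_left h2 hε0
        _ = ‖a‖ * (ε * (2 * M)) := by ring
        _ ≤ ‖a‖ * (η * (δ / 2)) := mul_le_mul_of_nonneg_left hεη ha'.le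
        _ = η * (‖a‖ * (δ / 2)) := by ring
        _ ≤ _ := mul_le_mul_of_nonneg_left h1 hη0.le
    calc ‖c‖ * ε * ‖w‖ = ‖c‖ * (ε * ‖w‖) := by ring
      _ ≤ ‖c‖ * (η * ‖ψ s ⬝ᵥ w‖) := mul_le_mul_of_nonneg_left h4 (norm_nonneg _)
      _ = _ := by ring

/-- Two conjugates-up-to-translation of an element `z` which, together with its inverse, is close
to a rank one matrix. -/
lemma freelyGens_of_translates {G : Type*} [Group G] (A : G →* Matrix ι ι ℂ) (z : G) (u : ℕ → G)
    (hu0 : u 0 = 1) {δ T ε : ℝ} (hδ : 0 < δ) (hδ1 : δ ≤ 1)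
    (hT : 1 ≤ T) (hε0 : 0 ≤ ε) (hε : 8 * T ^ 6 * ε ≤ δ ^ 2) (c : ℂ) (hc : c ≠ 0)
    (ψ : Bool → ι → ℂ) (e : ι → ℂ) (he : ‖e‖ = 1) (i₁ : ι) (hi₁ : e i₁ = 0)
    (hz : ∀ w, ‖A z *ᵥ w - (c * (ψ true ⬝ᵥ w)) • e‖ ≤ ‖c‖ * ε * ‖w‖)
    (hz' : ∀ w, ‖A z⁻¹ *ᵥ w - (c * (ψ false ⬝ᵥ w)) • e‖ ≤ ‖c‖ * ε * ‖w‖)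
    (hψT : ∀ b w, ‖ψ b ⬝ᵥ w‖ ≤ T * ‖w‖) (huT : ∀ i w, ‖A (u i) *ᵥ w‖ ≤ T * ‖w‖)
    (huT' : ∀ i w, ‖A (u i)⁻¹ *ᵥ w‖ ≤ T * ‖w‖)
    (hψu : ∀ i ≤ 4, ∀ j ≤ 4, i ≠ j → ∀ b, δ ≤ ‖ψ b ⬝ᵥ (A ((u i)⁻¹ * u j) *ᵥ e)‖)
    (hχ : ∀ i ≤ 4, i ≠ 0 → δ ≤ ‖(A (u i) *ᵥ e) i₁‖) :
    FreelyGens (u 1 * z * (u 2)⁻¹) (u 3 * z * (u 4)⁻¹) := by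
  have hT0 : 0 ≤ T := by linarith
  set o : Bool × Bool → ℕ := fun s => if s.1 then (if s.2 then 1 else 2) else (if s.2 then 3 else 4)
    with ho
  have ho4 : ∀ s, o s ≤ 4 := by decide
  have ho0 : ∀ s, o s ≠ 0 := by decide
  have hoi : ∀ s t : Bool × Bool, (s.1 = t.1 → s.2 = t.2) → o (s.1, !s.2) ≠ o t := by decide
  have hw : ∀ (s : Bool × Bool) w, (ψ s.2 ᵥ* A (u (o (s.1, !s.2)))⁻¹) ⬝ᵥ w =
      ψ s.2 ⬝ᵥ (A (u (o (s.1, !s.2)))⁻¹ *ᵥ w) := fun s w => (Matrix.dotProduct_mulVec _ _ _).symm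
  refine freelyGens_of_near_rank_one A
    (fun s => u (o s) * (if s.2 then z else z⁻¹) * (u (o (s.1, !s.2)))⁻¹) ?_ ?_
    (M := T ^ 2) (ε := T ^ 2 * ε) hδ hδ1 (one_le_pow₀ hT) (by positivity)
    (by calc _ = 8 * T ^ 6 * ε := by ring
          _ ≤ _ := hε) c hc
    (fun s => ψ s.2 ᵥ* A (u (o (s.1, !s.2)))⁻¹) (fun s => A (u (o s)) *ᵥ e) e he i₁ hi₁
    ?_ ?_ ?_ ?_ ?_ ?_
  · rintro (_ | _) <;> simp [ho]
  · rintro (_ | _) <;> simp [ho, mul_assoc]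
  · intro s w
    set w' := A (u (o (s.1, !s.2)))⁻¹ *ᵥ w with hw'
    have h1 : ∀ w, ‖A (if s.2 then z else z⁻¹) *ᵥ w - (c * (ψ s.2 ⬝ᵥ w)) • e‖ ≤ ‖c‖ * ε * ‖w‖ := by
      intro w
      cases s.2
      · exact hz' w
      · exact hz w
    have h2 : A (u (o s) * (if s.2 then z else z⁻¹) * (u (o (s.1, !s.2)))⁻¹) *ᵥ w -
        (c * ((ψ s.2 ᵥ* A (u (o (s.1, !s.2)))⁻¹) ⬝ᵥ w)) • (A (u (o s)) *ᵥ e) =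
        A (u (o s)) *ᵥ (A (if s.2 then z else z⁻¹) *ᵥ w' - (c * (ψ s.2 ⬝ᵥ w')) • e) := by
      rw [hw, ← hw', Matrix.mulVec_sub, Matrix.mulVec_smul, map_mul, map_mul, hw',
        Matrix.mulVec_mulVec, Matrix.mulVec_mulVec, mul_assoc]
    rw [h2]
    calc _ ≤ T * ‖A (if s.2 then z else z⁻¹) *ᵥ w' - (c * (ψ s.2 ⬝ᵥ w')) • e‖ := huT _ _
      _ ≤ T * (‖c‖ * ε * ‖w'‖) := mul_le_mul_of_nonneg_left (h1 w') hT0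
      _ ≤ T * (‖c‖ * ε * (T * ‖w‖)) := by
        have := huT' (o (s.1, !s.2)) w
        gcongr
      _ = _ := by ring
  · intro s w
    rw [hw]
    calc _ ≤ T * ‖A (u (o (s.1, !s.2)))⁻¹ *ᵥ w‖ := hψT _ _
      _ ≤ T * (T * ‖w‖) := mul_le_mul_of_nonneg_left (huT' _ _) hT0
      _ = _ := by ring
  · intro s
    refine (huT _ _).trans ?_
    rw [he]
    nlinarith
  · intro s t hst
    rw [hw, Matrix.mulVec_mulVec, ← map_mul]
    exact hψu _ (ho4 _) _ (ho4 _) (hoi s t hst) _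
  · intro s
    rw [hw]
    have := hψu _ (ho4 (s.1, !s.2)) 0 (by norm_num) (ho0 _) s.2
    rwa [hu0, mul_one] at this
  · intro s
    exact hχ _ (ho4 _) (ho0 _)

end PingPong

section SingularValues

variable {d : ℕ}

open scoped ComplexOrder in
/-- The **singular value decomposition** of an invertible matrix. -/
lemma exists_svd (Y : Matrix (Fin d) (Fin d) ℂ) (hY : IsUnit Y.det) :
    ∃ U ∈ Matrix.unitaryGroup (Fin d) ℂ, ∃ V ∈ Matrix.unitaryGroup (Fin d) ℂ, ∃ a : Fin d → ℝ,
      (∀ i, 0 < a i) ∧ Y = U * Matrix.diagonal (fun i => (a i : ℂ)) * star V := by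
  have hpd : (Yᴴ * Y).PosDef := by
    refine Matrix.PosDef.conjTranspose_mul_self Y ?_
    exact Matrix.mulVec_injective_iff_isUnit.2 ((Matrix.isUnit_iff_isUnit_det Y).2 hY)
  set hH := hpd.isHermitian
  set W := hH.eigenvectorUnitary
  set l := hH.eigenvalues
  have hl0 : ∀ i, 0 < l i := hpd.eigenvalues_pos
  have hsp : star W.1 * (Yᴴ * Y) * W.1 = Matrix.diagonal fun i => (l i : ℂ) := by
    have := Matrix.IsHermitian.conjStarAlgAut_star_eigenvectorUnitary hpd.isHermitian
    rw [Unitary.conjStarAlgAut_star_apply] at this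
    exact this
  have hWW : W.1 * star W.1 = 1 := Unitary.mul_star_self_of_mem W.2
  have ha0 : ∀ i, (Real.sqrt (l i) : ℂ) ≠ 0 := fun i => by
    exact_mod_cast (Real.sqrt_pos.2 (hl0 i)).ne'
  have hinv : (Matrix.diagonal fun i => (Real.sqrt (l i) : ℂ)⁻¹) *
      Matrix.diagonal (fun i => (Real.sqrt (l i) : ℂ)) = 1 := by
    rw [Matrix.diagonal_mul_diagonal, ← Matrix.diagonal_one]
    congr 1
    ext i
    exact inv_mul_cancel₀ (ha0 i)
  refine ⟨Y * W.1 * Matrix.diagonal fun i => (Real.sqrt (l i) : ℂ)⁻¹, ?_, W.1, W.2,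
    fun i => Real.sqrt (l i), fun i => Real.sqrt_pos.2 (hl0 i), ?_⟩
  · rw [Matrix.mem_unitaryGroup_iff']
    have hs : star (Matrix.diagonal fun i => (Real.sqrt (l i) : ℂ)⁻¹) =
        Matrix.diagonal fun i => (Real.sqrt (l i) : ℂ)⁻¹ := by
      rw [Matrix.star_eq_conjTranspose, Matrix.diagonal_conjTranspose]
      congr 1
      ext i
      simp
    rw [star_mul, star_mul, hs, Matrix.star_eq_conjTranspose Y]
    calc _ = Matrix.diagonal (fun i => (Real.sqrt (l i) : ℂ)⁻¹) * (star W.1 * (Yᴴ * Y) * W.1) *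
          Matrix.diagonal (fun i => (Real.sqrt (l i) : ℂ)⁻¹) := by simp only [mul_assoc]
      _ = 1 := by
        rw [hsp, Matrix.diagonal_mul_diagonal, Matrix.diagonal_mul_diagonal, ← Matrix.diagonal_one]
        congr 1
        ext i
        have h1 : (l i : ℂ) = (Real.sqrt (l i) : ℂ) * (Real.sqrt (l i) : ℂ) := by
          exact_mod_cast (Real.mul_self_sqrt (hl0 i).le).symm
        have := ha0 i
        rw [h1]
        field_simp
  · rw [mul_assoc (Y * W.1), hinv, mul_one, mul_assoc, hWW, mul_one]

lemma exists_gap {a : Fin d → ℝ} {R : ℝ} (hR : 1 ≤ R) (hsmall : ∃ i, a i ≤ 1)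
    (hbig : ∃ i, R ^ d ≤ a i) :
    ∃ t : ℝ, 0 < t ∧ (∀ i, a i ≤ t ∨ t * R ≤ a i) ∧ (∃ i, a i ≤ t) ∧ ∃ i, t * R ≤ a i := by
  obtain ⟨i₀, hi₀⟩ := hbig
  obtain ⟨i₁, hi₁⟩ := hsmall
  have hR0 : 0 < R := by linarith
  suffices h : ∃ j < d, ∀ i, a i ≤ R ^ j ∨ R ^ j * R ≤ a i by
    obtain ⟨j, hj, h⟩ := h
    refine ⟨R ^ j, by positivity, h, ⟨i₁, hi₁.trans (one_le_pow₀ hR)⟩, ⟨i₀, le_trans ?_ hi₀⟩⟩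
    rw [← pow_succ]
    exact pow_le_pow_right₀ hR hj
  by_contra! hc
  have : Nonempty (Fin d) := ⟨i₀⟩
  choose! f hf1 hf2 using hc
  have hmono : ∀ j j', j < j' → j' < d → a (f j) < a (f j') := by
    intro j j' hjj hj'
    refine (hf2 j (hjj.trans hj')).trans_le (le_trans ?_ (hf1 j' hj').le)
    rw [← pow_succ]
    exact pow_le_pow_right₀ hR hjj
  have hinj : Function.Injective fun j : Fin d => f j := by
    intro j j' h
    dsimp only at h
    rcases lt_trichotomy j j' with hl | hl | hl
    · exact absurd (hmono j j' hl j'.2) (by rw [h]; exact lt_irrefl _)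
    · exact hl
    · exact absurd (hmono j' j hl j.2) (by rw [h]; exact lt_irrefl _)
  obtain ⟨j, hj⟩ := (Finite.injective_iff_surjective.1 hinj) i₀
  have h1 := hf2 j j.2
  rw [show f j = i₀ from hj, ← pow_succ] at h1
  exact absurd (hi₀.trans_lt h1) (not_lt.2 (pow_le_pow_right₀ hR j.2))

lemma prod_orderEmb {k : ℕ} (e : Fin k ↪o Fin d) (a : Fin d → ℝ) :
    ∏ i, a (e i) = ∏ i ∈ Finset.univ.map e.toEmbedding, a i := by
  rw [Finset.prod_map]
  rfl

lemma exists_dominant_minor {a : Fin d → ℝ} (ha : ∀ i, 0 < a i) {R : ℝ}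
    (hsmall : ∃ i, a i ≤ 1) (hbig : ∃ i, R ^ d ≤ a i) (hR : 1 < R) :
    ∃ k ≤ d, ∃ e₀ e₁ : Fin k ↪o Fin d, e₁ ≠ e₀ ∧
      ∀ e, e ≠ e₀ → R * ∏ i, a (e i) ≤ ∏ i, a (e₀ i) := by
  classical
  obtain ⟨t, ht, htR, ⟨i₁, hi₁⟩, i₀, hi₀⟩ := exists_gap hR.le hsmall hbig
  have hR0 : 0 < R := by linarith
  set s : Finset (Fin d) := Finset.univ.filter fun i => t * R ≤ a i with hs
  have his : ∀ i, i ∉ s → a i ≤ t := fun i hi => by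
    rcases htR i with h | h
    · exact h
    · exact absurd (by simp [hs, h]) hi
  have hi₁s : i₁ ∉ s := by
    simp only [hs, Finset.mem_filter, Finset.mem_univ, true_and, not_le]
    nlinarith
  have hi₀s : i₀ ∈ s := by simp [hs, hi₀]
  have hcard' : (insert i₁ (s.erase i₀)).card = s.card := by
    rw [Finset.card_insert_of_notMem (fun h => hi₁s (Finset.mem_of_mem_erase h)),
      Finset.card_erase_add_one hi₀s]
  have hmap : ∀ (u : Finset (Fin d)) (hu : u.card = s.card),
      Finset.univ.map (u.orderEmbOfFin hu).toEmbedding = u := fun u hu => by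
    rw [← Finset.coe_inj, Finset.coe_map]
    simp
  refine ⟨s.card, (Finset.card_le_univ s).trans (by simp), s.orderEmbOfFin rfl,
    (insert i₁ (s.erase i₀)).orderEmbOfFin hcard', ?_, ?_⟩
  · intro h
    have := hmap _ hcard'
    rw [h, hmap] at this
    exact hi₁s (this ▸ Finset.mem_insert_self _ _)
  · intro e he
    rw [prod_orderEmb, prod_orderEmb, hmap]
    set u := Finset.univ.map e.toEmbedding with hu
    have hucard : u.card = s.card := by simp [hu]
    have hne : u ≠ s := by
      intro h
      apply he
      refine OrderEmbedding.range_inj.1 ?_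
      have h' : (u : Set (Fin d)) = s := by rw [h]
      rw [Finset.range_orderEmbOfFin, ← h', hu, Finset.coe_map]
      simp
    have hq : (u \ s).card = (s \ u).card := Finset.card_sdiff_comm hucard
    have hq0 : 1 ≤ (u \ s).card := by
      rw [Nat.one_le_iff_ne_zero, Ne, Finset.card_eq_zero, Finset.sdiff_eq_empty_iff_subset]
      intro h
      exact hne (Finset.eq_of_subset_of_card_le h hucard.ge)
    have h1 : ∏ i ∈ u \ s, a i ≤ t ^ (u \ s).card :=
      (Finset.prod_le_prod (fun i _ => (ha i).le) fun i hi =>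
        his i (Finset.mem_sdiff.1 hi).2).trans_eq (Finset.prod_const _)
    have h2 : (t * R) ^ (u \ s).card ≤ ∏ i ∈ s \ u, a i := by
      rw [hq]
      refine (Finset.prod_const (t * R)).symm.trans_le (Finset.prod_le_prod
        (fun i _ => by positivity) fun i hi => ?_)
      exact (Finset.mem_filter.1 (Finset.mem_sdiff.1 hi).1).2
    have h3 : R * ∏ i ∈ u \ s, a i ≤ ∏ i ∈ s \ u, a i := by
      refine le_trans ?_ h2
      rw [mul_pow, mul_comm]
      exact mul_le_mul h1 (le_self_pow₀ hR.le (by omega)) hR0.le (by positivity)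
    rw [← Finset.prod_inter_mul_prod_sdiff u s, ← Finset.prod_inter_mul_prod_sdiff s u,
      Finset.inter_comm s u]
    have h4 : 0 ≤ ∏ i ∈ u ∩ s, a i := Finset.prod_nonneg fun i _ => (ha i).le
    calc _ = (∏ i ∈ u ∩ s, a i) * (R * ∏ i ∈ u \ s, a i) := by ring
      _ ≤ _ := mul_le_mul_of_nonneg_left h3 h4

/-- Conjugating by a diagonal matrix with a dominant minor gives a compound matrix close to a
rank one matrix. -/
lemma norm_compound_diagonal_conj_sub_le {k : ℕ} {a : Fin d → ℝ} (ha : ∀ i, 0 < a i) {R : ℝ}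
    (hR : 0 < R) (e₀ : Fin k ↪o Fin d)
    (α : (Fin k ↪o Fin d) → ℝ) (hα : ∀ e, α e = ∏ i, a (e i))
    (he₀ : ∀ e, e ≠ e₀ → R * α e ≤ α e₀) (t₀ : Fin k ↪o Fin d) (ht₀ : ∀ e, α t₀ ≤ α e)
    (F : Matrix (Fin d) (Fin d) ℂ) {C : ℝ}
    (hF : ∀ e f, ‖compound k F e f‖ ≤ C) (w : (Fin k ↪o Fin d) → ℂ) :
    ‖compound k (Matrix.diagonal (fun i => (a i : ℂ)) * F *
        Matrix.diagonal (fun i => (a i : ℂ)⁻¹)) *ᵥ w -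
      (α e₀ * (α t₀ : ℂ)⁻¹ *
        ((fun t => compound k F e₀ t * (α t₀ * (α t : ℂ)⁻¹)) ⬝ᵥ w)) • Pi.single e₀ (1 : ℂ)‖ ≤
      ‖α e₀ * (α t₀ : ℂ)⁻¹‖ * (Fintype.card (Fin k ↪o Fin d) * C / R) * ‖w‖ := by
  classical
  have hα0 : ∀ e, 0 < α e := fun e => hα e ▸ Finset.prod_pos fun i _ => ha _
  have hα0' : ∀ e, (α e : ℂ) ≠ 0 := fun e => by exact_mod_cast (hα0 e).ne'
  have hC : 0 ≤ C := (norm_nonneg _).trans (hF e₀ e₀)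
  set ψ : (Fin k ↪o Fin d) → (Fin k ↪o Fin d) → ℂ :=
    fun e t => compound k F e t * ((α t₀ : ℂ) * (α t : ℂ)⁻¹) with hψ
  have hentry : ∀ e, (compound k (Matrix.diagonal (fun i => (a i : ℂ)) * F *
      Matrix.diagonal (fun i => (a i : ℂ)⁻¹)) *ᵥ w) e = α e * (α t₀ : ℂ)⁻¹ * (ψ e ⬝ᵥ w) := by
    intro e
    rw [compound_mul, compound_mul, compound_diagonal, compound_diagonal, Matrix.mulVec,
      dotProduct, dotProduct, Finset.mul_sum]
    refine Finset.sum_congr rfl fun t _ => ?_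
    rw [Matrix.mul_diagonal, Matrix.diagonal_mul, hψ, Finset.prod_inv_distrib]
    have h1 : ∀ e : Fin k ↪o Fin d, ∏ i, (a (e i) : ℂ) = (α e : ℂ) := fun e => by
      rw [hα]; push_cast; rfl
    rw [h1, h1]
    have := hα0' t₀
    field_simp
  have hψn : ∀ e, ‖ψ e ⬝ᵥ w‖ ≤ Fintype.card (Fin k ↪o Fin d) * C * ‖w‖ := by
    intro e
    refine (norm_sum_le _ _).trans ((Finset.sum_le_card_nsmul _ _ (C * ‖w‖) fun t _ => ?_).trans ?_)
    · have h2 : ‖(α t₀ : ℂ) * (α t : ℂ)⁻¹‖ ≤ 1 := by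
        rw [norm_mul, norm_inv, Complex.norm_real, Complex.norm_real,
          Real.norm_of_nonneg (hα0 _).le, Real.norm_of_nonneg (hα0 _).le, ← div_eq_mul_inv]
        exact div_le_one_of_le₀ (ht₀ t) (hα0 _).le
      rw [norm_mul, hψ, norm_mul]
      refine mul_le_mul ?_ (norm_le_pi_norm w t) (norm_nonneg _) hC
      calc _ ≤ C * 1 := mul_le_mul (hF e t) h2 (norm_nonneg _) hC
        _ = C := mul_one C
    · rw [nsmul_eq_mul, Finset.card_univ, mul_assoc]
  refine (pi_norm_le_iff_of_nonneg (by positivity)).2 fun e => ?_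
  rw [Pi.sub_apply, hentry, Pi.smul_apply]
  by_cases he : e = e₀
  · subst he
    rw [Pi.single_eq_same, smul_eq_mul, mul_one, sub_self, norm_zero]
    positivity
  · rw [Pi.single_eq_of_ne he, smul_zero, sub_zero, norm_mul]
    have h1 : ‖(α e : ℂ) * (α t₀ : ℂ)⁻¹‖ ≤ ‖(α e₀ : ℂ) * (α t₀ : ℂ)⁻¹‖ / R := by
      rw [le_div_iff₀ hR, norm_mul, norm_mul, Complex.norm_real, Complex.norm_real,
        Real.norm_of_nonneg (hα0 _).le, Real.norm_of_nonneg (hα0 _).le]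
      have := mul_le_mul_of_nonneg_right (he₀ e he) (norm_nonneg (α t₀ : ℂ)⁻¹)
      calc _ = R * α e * ‖(α t₀ : ℂ)⁻¹‖ := by ring
        _ ≤ _ := this
    calc _ ≤ ‖(α e₀ : ℂ) * (α t₀ : ℂ)⁻¹‖ / R * (Fintype.card (Fin k ↪o Fin d) * C * ‖w‖) :=
          mul_le_mul h1 (hψn e) (norm_nonneg _) (by positivity)
      _ = _ := by ring

end SingularValues

section Frames

variable {d : ℕ}

attribute [local instance] Matrix.linftyOpNormedRing

theorem exists_generic_sequence_uniform (d : ℕ) [NeZero d] (n : ℕ) :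
    ∃ m c D : ℕ, ∀ k ≤ d, ∀ S : Set SL(d, ℤ), 1 ∈ S → S⁻¹ = S →
      DenseUpTo D (Subgroup.closure S) →
      ∀ (P : GL (Fin d) ℂ) (K : ℝ), 2 ≤ K → (∀ s ∈ S, ‖(conjRep P s).1‖ ≤ K) →
      ∀ (φ : Bool → (Fin k ↪o Fin d) → ℂ) (χ v : (Fin k ↪o Fin d) → ℂ),
      ∃ u : ℕ → SL(d, ℤ), u 0 = 1 ∧ (∀ i, u i ∈ S ^ m) ∧
        (∀ i ≤ n, ∀ j ≤ n, i ≠ j → ∀ b, ‖φ b‖ * ‖v‖ ≤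
          K ^ c * ‖matCoeff k (φ b) v (conjRep P ((u i)⁻¹ * u j)).1‖) ∧
        ∀ i ≤ n, i ≠ 0 → ‖χ‖ * ‖v‖ ≤ K ^ c * ‖matCoeff k χ v (conjRep P (u i)).1‖ := by
  choose m c D H using fun k => exists_generic_sequence d k n
  have hle : ∀ (f : ℕ → ℕ), ∀ k ≤ d, f k ≤ (Finset.range (d + 1)).sup f := fun f k hk =>
    Finset.le_sup (f := f) (Finset.mem_range.2 (Nat.lt_succ_of_le hk))
  refine ⟨(Finset.range (d + 1)).sup m, (Finset.range (d + 1)).sup c,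
    (Finset.range (d + 1)).sup D, fun k hk S h1 hS hD P K hK hSK φ χ v => ?_⟩
  obtain ⟨u, hu0, hu, h, h'⟩ := H k S h1 hS (DenseUpTo.mono (hle D k hk) hD) P K hK hSK φ χ v
  have hKc := pow_le_pow_right₀ (by linarith : (1 : ℝ) ≤ K) (hle c k hk)
  refine ⟨u, hu0, fun i => Set.pow_subset_pow_right h1 (hle m k hk) (hu i), ?_, ?_⟩
  · exact fun i hi j hj hij b => (h i hi j hj hij b).trans
      (mul_le_mul_of_nonneg_right hKc (norm_nonneg _))
  · exact fun i hi hi0 => (h' i hi hi0).trans (mul_le_mul_of_nonneg_right hKc (norm_nonneg _))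

lemma norm_le_of_mem_unitaryGroup {U : Matrix (Fin d) (Fin d) ℂ}
    (hU : U ∈ Matrix.unitaryGroup (Fin d) ℂ) : ‖U‖ ≤ d := by
  have := linfty_norm_le U zero_le_one fun i j => entry_norm_bound_of_unitary hU i j
  simpa using this

lemma norm_conj_le {U : Matrix (Fin d) (Fin d) ℂ} (hU : U ∈ Matrix.unitaryGroup (Fin d) ℂ)
    (X : Matrix (Fin d) (Fin d) ℂ) : ‖star U * X * U‖ ≤ d ^ 2 * ‖X‖ := by
  have h1 := norm_le_of_mem_unitaryGroup hU
  have h2 := norm_le_of_mem_unitaryGroup (Unitary.star_mem hU)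
  calc _ ≤ ‖star U‖ * ‖X‖ * ‖U‖ :=
        (norm_mul_le _ _).trans (mul_le_mul_of_nonneg_right (norm_mul_le _ _) (norm_nonneg _))
    _ ≤ d * ‖X‖ * d := by gcongr
    _ = _ := by ring

/-- A unitary matrix as an invertible matrix. -/
noncomputable def unitaryUnit (U : Matrix (Fin d) (Fin d) ℂ)
    (hU : U ∈ Matrix.unitaryGroup (Fin d) ℂ) : GL (Fin d) ℂ :=
  ⟨star U, U, Unitary.star_mul_self_of_mem hU, Unitary.mul_star_self_of_mem hU⟩

lemma conjRep_unitaryUnit_mul {U : Matrix (Fin d) (Fin d) ℂ}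
    (hU : U ∈ Matrix.unitaryGroup (Fin d) ℂ) (P : GL (Fin d) ℂ) (γ : SL(d, ℤ)) :
    (conjRep (unitaryUnit U hU * P) γ).1 = star U * (conjRep P γ).1 * U := by
  rw [conjRep_val, conjRep_val, _root_.mul_inv_rev, Units.val_mul, Units.val_mul]
  change star U * P.1 * complexMat γ * (P⁻¹.1 * U) = _
  simp only [mul_assoc]

/-- The frames on both sides of the singular value decomposition of an element. -/
lemma exists_adapted_frames (d : ℕ) [NeZero d] : ∃ l : ℕ, ∀ (P : GL (Fin d) ℂ) (K : ℝ), 2 ≤ K →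
    ∀ y : SL(d, ℤ), ∃ (P₁ P₂ : GL (Fin d) ℂ) (a : Fin d → ℝ), (∀ i, 0 < a i) ∧ (∃ i, a i ≤ 1) ∧
      (∃ i, ‖(conjRep P y).1‖ ≤ K ^ l * a i) ∧
      (∀ γ, ‖(conjRep P₁ γ).1‖ ≤ K ^ l * ‖(conjRep P γ).1‖) ∧
      (∀ γ, ‖(conjRep P₂ γ).1‖ ≤ K ^ l * ‖(conjRep P γ).1‖) ∧
      ∀ γ, (conjRep P₂ (y * γ * y⁻¹)).1 = Matrix.diagonal (fun i => (a i : ℂ)) *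
        (conjRep P₁ γ).1 * Matrix.diagonal (fun i => (a i : ℂ)⁻¹) := by
  obtain ⟨l, hl⟩ := exists_le_two_pow ((d : ℝ) ^ 3)
  refine ⟨l, fun P K hK y => ?_⟩
  have hd1 : (1 : ℝ) ≤ d := by exact_mod_cast NeZero.one_le
  have hlK : (d : ℝ) ^ 3 ≤ K ^ l := hl.trans (pow_le_pow_left₀ (by norm_num) hK l)
  have hlK2 : (d : ℝ) ^ 2 ≤ K ^ l := (pow_le_pow_right₀ hd1 (by norm_num)).trans hlK
  obtain ⟨U, hU, V, hV, a, ha, hY⟩ := exists_svd (conjRep P y).1 (by rw [(conjRep P y).2]; simp)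
  have ha0 : ∀ i, (a i : ℂ) ≠ 0 := fun i => by exact_mod_cast (ha i).ne'
  have hUU : star U * U = 1 := Unitary.star_mul_self_of_mem hU
  have hVV : star V * V = 1 := Unitary.star_mul_self_of_mem hV
  have hDD : Matrix.diagonal (fun i => (a i : ℂ)) * Matrix.diagonal (fun i => (a i : ℂ)⁻¹) = 1 := by
    rw [Matrix.diagonal_mul_diagonal, ← Matrix.diagonal_one]
    congr 1
    ext i
    exact mul_inv_cancel₀ (ha0 i)
  refine ⟨unitaryUnit V hV * P, unitaryUnit U hU * P, a, ha, ?_, ?_, ?_, ?_, ?_⟩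
  · by_contra! h
    have hdet := congrArg (fun M => ‖Matrix.det M‖) hY
    simp only [(conjRep P y).2, Matrix.det_mul, Matrix.det_diagonal, norm_mul, norm_one] at hdet
    have hnU : ∀ {W : Matrix (Fin d) (Fin d) ℂ}, W ∈ Matrix.unitaryGroup (Fin d) ℂ →
        ‖W.det‖ = 1 := fun hW => by
      have := Matrix.det_of_mem_unitary hW
      exact CStarRing.norm_of_mem_unitary this
    rw [hnU hU, hnU (Unitary.star_mem hV), one_mul, mul_one, norm_prod] at hdet
    have h1 : ∏ i : Fin d, (1 : ℝ) < ∏ i, ‖(a i : ℂ)‖ := by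
      refine Finset.prod_lt_prod_of_nonempty (fun _ _ => one_pos) (fun i _ => ?_)
        Finset.univ_nonempty
      rw [Complex.norm_real, Real.norm_of_nonneg (ha i).le]
      exact h i
    rw [Finset.prod_const_one, ← hdet] at h1
    exact lt_irrefl _ h1
  · obtain ⟨i, hi⟩ := Finite.exists_max a
    refine ⟨i, ?_⟩
    have hD : ‖Matrix.diagonal (fun i => (a i : ℂ))‖ ≤ d * a i := by
      have := linfty_norm_le (Matrix.diagonal fun i => (a i : ℂ)) (ha i).le fun j k => by
        rw [Matrix.diagonal_apply]
        split_ifs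
        · rw [Complex.norm_real, Real.norm_of_nonneg (ha j).le]
          exact hi j
        · rw [norm_zero]
          exact (ha i).le
      simpa using this
    have hai := (ha i).le
    have h1 := norm_le_of_mem_unitaryGroup hU
    have h2 := norm_le_of_mem_unitaryGroup (Unitary.star_mem hV)
    rw [hY]
    calc _ ≤ ‖U‖ * ‖Matrix.diagonal (fun i => (a i : ℂ))‖ * ‖star V‖ :=
          (norm_mul_le _ _).trans (mul_le_mul_of_nonneg_right (norm_mul_le _ _) (norm_nonneg _))
      _ ≤ d * (d * a i) * d := by gcongr
      _ = d ^ 3 * a i := by ring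
      _ ≤ _ := mul_le_mul_of_nonneg_right hlK (ha i).le
  · intro γ
    rw [conjRep_unitaryUnit_mul]
    exact (norm_conj_le hV _).trans (mul_le_mul_of_nonneg_right hlK2 (norm_nonneg _))
  · intro γ
    rw [conjRep_unitaryUnit_mul]
    exact (norm_conj_le hU _).trans (mul_le_mul_of_nonneg_right hlK2 (norm_nonneg _))
  · intro γ
    rw [conjRep_unitaryUnit_mul, conjRep_unitaryUnit_mul, map_mul, map_mul,
      Matrix.SpecialLinearGroup.coe_mul, Matrix.SpecialLinearGroup.coe_mul]
    have hinv : (conjRep P y⁻¹).1 * (conjRep P y).1 = 1 := by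
      rw [← Matrix.SpecialLinearGroup.coe_mul, ← map_mul, inv_mul_cancel, map_one,
        Matrix.SpecialLinearGroup.coe_one]
    have h1 : (conjRep P y⁻¹).1 * U = V * Matrix.diagonal (fun i => (a i : ℂ)⁻¹) := by
      have h2 := congrArg (fun M => M * (V * Matrix.diagonal (fun i => (a i : ℂ)⁻¹))) hinv
      simp only [one_mul] at h2
      rw [← h2, hY]
      calc _ = (conjRep P y⁻¹).1 * U * (Matrix.diagonal (fun i => (a i : ℂ)) *
            Matrix.diagonal (fun i => (a i : ℂ)⁻¹)) := by rw [hDD, mul_one]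
        _ = (conjRep P y⁻¹).1 * U * (Matrix.diagonal (fun i => (a i : ℂ)) * ((star V * V) *
            Matrix.diagonal (fun i => (a i : ℂ)⁻¹))) := by rw [hVV, one_mul]
        _ = _ := by simp only [mul_assoc]
    calc _ = star U * (conjRep P y).1 * (conjRep P γ).1 * ((conjRep P y⁻¹).1 * U) := by
          simp only [mul_assoc]
      _ = (star U * U) * Matrix.diagonal (fun i => (a i : ℂ)) * star V * (conjRep P γ).1 *
          (V * Matrix.diagonal (fun i => (a i : ℂ)⁻¹)) := by
          rw [h1, hY]; simp only [mul_assoc]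
      _ = _ := by rw [hUU, one_mul]; simp only [mul_assoc]

end Frames

section FreePair

variable {d : ℕ}

attribute [local instance] Matrix.linftyOpNormedRing

/-- The compound representation in the frame `P`. -/
noncomputable def compoundRep (k : ℕ) (P : GL (Fin d) ℂ) :
    SL(d, ℤ) →* Matrix (Fin k ↪o Fin d) (Fin k ↪o Fin d) ℂ where
  toFun γ := compound k (conjRep P γ).1
  map_one' := by rw [map_one, Matrix.SpecialLinearGroup.coe_one, compound_one]
  map_mul' γ η := by rw [map_mul, Matrix.SpecialLinearGroup.coe_mul, compound_mul]

lemma compoundRep_apply (k : ℕ) (P : GL (Fin d) ℂ) (γ : SL(d, ℤ)) :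
    compoundRep k P γ = compound k (conjRep P γ).1 := rfl

lemma matCoeff_single {R : Type*} [CommRing R] (k : ℕ) (e : Fin k ↪o Fin d)
    (v : (Fin k ↪o Fin d) → R) (x : Matrix (Fin d) (Fin d) R) :
    matCoeff k (Pi.single e 1) v x = (compound k x *ᵥ v) e := by
  unfold matCoeff
  rw [single_one_dotProduct]

lemma exists_freelyGens_of_gap (d : ℕ) [NeZero d] : ∃ m q D : ℕ, 0 < q ∧
    ∀ k ≤ d, ∀ S : Set SL(d, ℤ), 1 ∈ S → S⁻¹ = S → DenseUpTo D (Subgroup.closure S) →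
    ∀ (P₁ P₂ : GL (Fin d) ℂ) (K : ℝ), 2 ≤ K → (∀ s ∈ S, ‖(conjRep P₁ s).1‖ ≤ K) →
    (∀ s ∈ S, ‖(conjRep P₂ s).1‖ ≤ K) → ∀ a : Fin d → ℝ, (∀ i, 0 < a i) → ∀ y : SL(d, ℤ),
    (∀ γ, (conjRep P₂ (y * γ * y⁻¹)).1 = Matrix.diagonal (fun i => (a i : ℂ)) *
        (conjRep P₁ γ).1 * Matrix.diagonal (fun i => (a i : ℂ)⁻¹)) →
    ∀ e₀ e₁ : Fin k ↪o Fin d, e₁ ≠ e₀ →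
    (∀ e, e ≠ e₀ → K ^ q * ∏ i, a (e i) ≤ ∏ i, a (e₀ i)) →
    ∃ f ∈ S ^ m, ∃ u : ℕ → SL(d, ℤ), (∀ i, u i ∈ S ^ m) ∧
      FreelyGens (u 1 * (y * f * y⁻¹) * (u 2)⁻¹) (u 3 * (y * f * y⁻¹) * (u 4)⁻¹) := by
  classical
  obtain ⟨m, c, D, H⟩ := exists_generic_sequence_uniform d 4
  obtain ⟨b, hb⟩ : ∃ b : ℕ, ∀ k ≤ d,
      (Fintype.card (Fin k ↪o Fin d) : ℝ) * k.factorial ≤ 2 ^ b := by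
    choose b hb using fun k : ℕ =>
      exists_le_two_pow ((Fintype.card (Fin k ↪o Fin d) : ℝ) * k.factorial)
    refine ⟨(Finset.range (d + 1)).sup b, fun k hk => (hb k).trans ?_⟩
    exact pow_le_pow_right₀ one_le_two
      (Finset.le_sup (f := b) (Finset.mem_range.2 (Nat.lt_succ_of_le hk)))
  set t := b + m * d with ht
  refine ⟨m, 3 + 7 * t + 4 * c, D, by omega,
    fun k hk S h1 hS hD P₁ P₂ K hK hK₁ hK₂ a ha y hy e₀ e₁ he hdom => ?_⟩
  have hK1 : 1 ≤ K := by linarith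
  have hK0 : 0 < K := by linarith
  set N : ℝ := (Fintype.card (Fin k ↪o Fin d) : ℝ)
  have hN0 : 0 ≤ N := Nat.cast_nonneg _
  have hNt : N * (k.factorial * (K ^ m) ^ k) ≤ K ^ t := by
    rw [← mul_assoc, ht, pow_add, pow_mul]
    refine mul_le_mul ((hb k hk).trans (pow_le_pow_left₀ (by norm_num) hK b))
      (pow_le_pow_right₀ (one_le_pow₀ hK1) hk) (by positivity) (by positivity)
  set α : (Fin k ↪o Fin d) → ℝ := fun e => ∏ i, a (e i)
  have hα0 : ∀ e, 0 < α e := fun e => Finset.prod_pos fun i _ => ha _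
  have : Nonempty (Fin k ↪o Fin d) := ⟨e₀⟩
  obtain ⟨t₀, ht₀⟩ := Finite.exists_min α
  have hns : ∀ e : Fin k ↪o Fin d, ‖(Pi.single e (1 : ℂ) : (Fin k ↪o Fin d) → ℂ)‖ = 1 :=
    fun e => by rw [Pi.norm_single, norm_one]
  obtain ⟨f, hf0, hfm, hf, -⟩ := H k hk S h1 hS hD P₁ K hK hK₁ (fun _ => Pi.single e₀ 1) 0
    (Pi.single t₀ 1)
  set F : Bool → SL(d, ℤ) := fun b => if b then f 1 else (f 1)⁻¹ with hF
  have hFm : ∀ b, F b ∈ S ^ m := fun b => by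
    rw [hF]
    dsimp only
    split_ifs
    · exact hfm 1
    · exact inv_mem_pow_of_symm hS (hfm 1)
  have hFc : ∀ b, 1 ≤ K ^ c * ‖compound k (conjRep P₁ (F b)).1 e₀ t₀‖ := by
    intro b
    have key : ∀ x : Matrix (Fin d) (Fin d) ℂ,
        matCoeff k (Pi.single e₀ 1) (Pi.single t₀ 1) x = compound k x e₀ t₀ := fun x => by
      rw [matCoeff_single, Matrix.mulVec_single_one, Matrix.col_apply]
    cases b
    · have := hf 1 (by norm_num) 0 (by norm_num) (by norm_num) true
      rwa [hns, hns, one_mul, key, hf0, mul_one] at this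
    · have := hf 0 (by norm_num) 1 (by norm_num) (by norm_num) true
      rwa [hns, hns, one_mul, key, hf0, inv_one, one_mul] at this
  have hFC : ∀ b e e', ‖compound k (conjRep P₁ (F b)).1 e e'‖ ≤ k.factorial * (K ^ m) ^ k :=
    fun b e e' => norm_compound_apply_le k _ (fun i j => (norm_apply_le_linfty _ i j).trans
      (norm_conjRep_le hK₁ (hFm b))) e e'
  set ψ : Bool → (Fin k ↪o Fin d) → ℂ := fun b e =>
    compound k (conjRep P₁ (F b)).1 e₀ e * ((α t₀ : ℂ) * (α e : ℂ)⁻¹) with hψ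
  have hψn : ∀ b e, ‖ψ b e‖ ≤ k.factorial * (K ^ m) ^ k := by
    intro b e
    have h2 : ‖(α t₀ : ℂ) * (α e : ℂ)⁻¹‖ ≤ 1 := by
      rw [norm_mul, norm_inv, Complex.norm_real, Complex.norm_real, Real.norm_of_nonneg (hα0 _).le,
        Real.norm_of_nonneg (hα0 _).le, ← div_eq_mul_inv]
      exact div_le_one_of_le₀ (ht₀ e) (hα0 _).le
    rw [hψ, norm_mul]
    exact (mul_le_of_le_one_right (norm_nonneg _) h2).trans (hFC b e₀ e)
  have hψ1 : ∀ b, 1 ≤ K ^ c * ‖ψ b‖ := by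
    intro b
    refine (hFc b).trans (mul_le_mul_of_nonneg_left ?_ (by positivity))
    refine le_trans (le_of_eq ?_) (norm_le_pi_norm (ψ b) t₀)
    have h0 : (α t₀ : ℂ) ≠ 0 := by exact_mod_cast (hα0 t₀).ne'
    simp only [hψ, mul_inv_cancel₀ h0, mul_one]
  have hz : ∀ b w, ‖compoundRep k P₂ (y * F b * y⁻¹) *ᵥ w -
      (α e₀ * (α t₀ : ℂ)⁻¹ * (ψ b ⬝ᵥ w)) • Pi.single e₀ (1 : ℂ)‖ ≤
      ‖α e₀ * (α t₀ : ℂ)⁻¹‖ * (N * (k.factorial * (K ^ m) ^ k) / K ^ (3 + 7 * t + 4 * c)) * ‖w‖ :=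
    fun b w => by
      rw [compoundRep_apply, hy]
      exact norm_compound_diagonal_conj_sub_le ha (by positivity) e₀ α (fun _ => rfl) hdom t₀ ht₀ _
        (hFC b) w
  obtain ⟨u, hu0, hum, hu, hu'⟩ := H k hk S h1 hS hD P₂ K hK hK₂ ψ (Pi.single e₁ 1)
    (Pi.single e₀ 1)
  refine ⟨f 1, hfm 1, u, hum, ?_⟩
  have huT : ∀ g ∈ S ^ m, ∀ w, ‖compoundRep k P₂ g *ᵥ w‖ ≤ K ^ t * ‖w‖ := fun g hg w => by
    refine (norm_compound_mulVec_le k w _ (norm_conjRep_le hK₂ hg)).trans ?_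
    rw [mul_assoc (Fintype.card (Fin k ↪o Fin d) : ℝ)]
    exact mul_le_mul_of_nonneg_right hNt (norm_nonneg _)
  have hδ : ∀ r : ℝ, 1 ≤ K ^ (2 * c) * r → (K ^ (2 * c))⁻¹ ≤ r := fun r hr =>
    (inv_le_iff_one_le_mul₀' (by positivity)).2 hr
  refine freelyGens_of_translates (compoundRep k P₂) (y * f 1 * y⁻¹) u hu0
    (δ := (K ^ (2 * c))⁻¹) (T := K ^ t)
    (ε := N * (k.factorial * (K ^ m) ^ k) / K ^ (3 + 7 * t + 4 * c)) (by positivity)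
    (inv_le_one_of_one_le₀ (one_le_pow₀ hK1)) (one_le_pow₀ hK1) (by positivity) ?_
    (α e₀ * (α t₀ : ℂ)⁻¹) ?_ ψ (Pi.single e₀ 1) (hns e₀) e₁ (Pi.single_eq_of_ne he _)
    (hz true) (fun w => ?_) (fun b w => ?_) (fun i w => huT _ (hum i) w)
    (fun i w => huT _ (inv_mem_pow_of_symm hS (hum i)) w) (fun i hi j hj hij b => hδ _ ?_)
    (fun i hi hi0 => hδ _ ?_)
  · have h8 : (8 : ℝ) ≤ K ^ 3 := by
      calc (8 : ℝ) = 2 ^ 3 := by norm_num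
        _ ≤ _ := pow_le_pow_left₀ (by norm_num) hK 3
    calc _ ≤ K ^ 3 * (K ^ t) ^ 6 * (K ^ t / K ^ (3 + 7 * t + 4 * c)) := by gcongr
      _ = _ := by
        field_simp
        ring
  · refine mul_ne_zero ?_ (inv_ne_zero ?_) <;> exact_mod_cast (hα0 _).ne'
  · have := hz false w
    rwa [show y * F false * y⁻¹ = (y * f 1 * y⁻¹)⁻¹ by simp [hF, mul_assoc]] at this
  · refine (norm_sum_le _ _).trans ((Finset.sum_le_card_nsmul _ _
      (k.factorial * (K ^ m) ^ k * ‖w‖) fun e _ => ?_).trans ?_)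
    · rw [norm_mul]
      exact mul_le_mul (hψn b e) (norm_le_pi_norm w e) (norm_nonneg _) (by positivity)
    · rw [nsmul_eq_mul, Finset.card_univ, ← mul_assoc]
      exact mul_le_mul_of_nonneg_right hNt (norm_nonneg _)
  · have h2 := hu i hi j hj hij b
    rw [hns, mul_one] at h2
    calc (1 : ℝ) ≤ K ^ c * ‖ψ b‖ := hψ1 b
      _ ≤ K ^ c * (K ^ c * _) := mul_le_mul_of_nonneg_left h2 (by positivity)
      _ = _ := by rw [← mul_assoc, ← pow_add, ← two_mul]; rfl
  · have h2 := hu' i hi hi0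
    rw [hns, hns, mul_one, matCoeff_single] at h2
    refine h2.trans (mul_le_mul_of_nonneg_right (pow_le_pow_right₀ hK1 (by omega)) (norm_nonneg _))

theorem exists_freelyGens_of_expanding_word (d : ℕ) [NeZero d] (m₀ : ℕ) : ∃ m D : ℕ,
    ∀ S : Set SL(d, ℤ), 1 ∈ S → S⁻¹ = S → DenseUpTo D (Subgroup.closure S) →
    ∀ (P : GL (Fin d) ℂ) (K : ℝ), 2 ≤ K → (∀ s ∈ S, ‖(conjRep P s).1‖ ≤ K) →
    ∀ x ∈ S ^ m₀, ∀ v ≠ 0, ∀ z : ℂ, (conjRep P x).1 *ᵥ v = z • v → K ≤ ‖z‖ →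
    ∃ a ∈ S ^ m, ∃ b ∈ S ^ m, FreelyGens a b := by
  obtain ⟨m, q, D, hq, H⟩ := exists_freelyGens_of_gap d
  obtain ⟨l, hl⟩ := exists_adapted_frames d
  set n := l + (l + 1) * q * d with hn
  refine ⟨m + (m₀ * n + m + m₀ * n) + m, D, fun S h1 hS hD P K hK hSK x hx v hv z hxz hz => ?_⟩
  have hK1 : 1 ≤ K := by linarith
  have hK0 : 0 < K := by linarith
  obtain ⟨P₁, P₂, a, ha, hsmall, ⟨i, hi⟩, hP₁, hP₂, hy⟩ := hl P K hK (x ^ n)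
  have hbig : (K ^ ((l + 1) * q)) ^ d ≤ a i := by
    have h2 : ‖z ^ n‖ ≤ ‖(conjRep P (x ^ n)).1‖ := by
      have h3 := Matrix.linfty_opNorm_mulVec (conjRep P (x ^ n)).1 v
      rw [map_pow, Matrix.SpecialLinearGroup.coe_pow, pow_mulVec_of_eigenvector hxz n,
        norm_smul] at h3
      rw [map_pow, Matrix.SpecialLinearGroup.coe_pow]
      exact le_of_mul_le_mul_right h3 (norm_pos_iff.2 hv)
    have h3 : K ^ n ≤ ‖z ^ n‖ := by
      rw [norm_pow]
      exact pow_le_pow_left₀ hK0.le hz n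
    have h4 := h3.trans (h2.trans hi)
    rw [hn, pow_add] at h4
    rw [← pow_mul]
    exact le_of_mul_le_mul_left h4 (by positivity)
  have hKl : K ≤ K ^ (l + 1) := le_self_pow₀ hK1 (by omega)
  have hK1' : 2 ≤ K ^ (l + 1) := hK.trans hKl
  have hframe : ∀ Q : GL (Fin d) ℂ, (∀ γ, ‖(conjRep Q γ).1‖ ≤ K ^ l * ‖(conjRep P γ).1‖) →
      ∀ s ∈ S, ‖(conjRep Q s).1‖ ≤ K ^ (l + 1) := fun Q hQ s hs =>
    (hQ s).trans ((mul_le_mul_of_nonneg_left (hSK s hs) (by positivity)).trans_eq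
      (pow_succ K l).symm)
  rw [pow_mul] at hbig
  obtain ⟨k, hk, e₀, e₁, he, hdom⟩ := exists_dominant_minor ha hsmall ⟨i, hbig⟩
    (one_lt_pow₀ (by linarith) hq.ne')
  obtain ⟨f, hf, u, hu, hfree⟩ := H k hk S h1 hS hD P₁ P₂ (K ^ (l + 1)) hK1' (hframe P₁ hP₁)
    (hframe P₂ hP₂) a ha (x ^ n) hy e₀ e₁ he hdom
  have hxn : x ^ n ∈ S ^ (m₀ * n) := by
    rw [pow_mul]
    exact Set.pow_mem_pow hx
  have hmem : ∀ i j, u i * (x ^ n * f * (x ^ n)⁻¹) * (u j)⁻¹ ∈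
      S ^ (m + (m₀ * n + m + m₀ * n) + m) := fun i j => by
    simp only [pow_add]
    exact Set.mul_mem_mul (Set.mul_mem_mul (hu i) (Set.mul_mem_mul (Set.mul_mem_mul hxn hf)
      (inv_mem_pow_of_symm hS hxn))) (inv_mem_pow_of_symm hS (hu j))
  exact ⟨_, hmem 1 2, _, hmem 3 4, hfree⟩

end FreePair

section FiniteReduction

variable {d : ℕ}

lemma exists_finite_subset_mem_closure {G : Type*} [Group G] {S : Set G} {g : G}
    (hg : g ∈ Subgroup.closure S) : ∃ T ⊆ S, T.Finite ∧ g ∈ Subgroup.closure T := by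
  induction hg using Subgroup.closure_induction with
  | mem x hx => exact ⟨{x}, by simpa using hx, Set.finite_singleton x,
      Subgroup.subset_closure (Set.mem_singleton x)⟩
  | one => exact ⟨∅, Set.empty_subset S, Set.finite_empty, one_mem _⟩
  | mul x y _ _ hx hy =>
    obtain ⟨T, hT, hTf, hxT⟩ := hx
    obtain ⟨U, hU, hUf, hyU⟩ := hy
    exact ⟨T ∪ U, Set.union_subset hT hU, hTf.union hUf,
      mul_mem (Subgroup.closure_mono Set.subset_union_left hxT)
        (Subgroup.closure_mono Set.subset_union_right hyU)⟩
  | inv x _ hx =>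
    obtain ⟨T, hT, hTf, hxT⟩ := hx
    exact ⟨T, hT, hTf, inv_mem hxT⟩

lemma exists_finite_denseUpTo (D : ℕ) {S : Set SL(d, ℤ)}
    (hD : DenseUpTo D (Subgroup.closure S)) :
    ∃ T ⊆ S, T.Finite ∧ DenseUpTo D (Subgroup.closure T) := by
  obtain ⟨κ, a, -, hspan, hlin⟩ := exists_linearIndependent' ℚ
    fun γ : Subgroup.closure S => tpow D (ratMat γ.1)
  have : Finite κ := hlin.finite
  choose T hTS hTf hT using fun i : κ => exists_finite_subset_mem_closure (a i).2
  refine ⟨⋃ i, T i, Set.iUnion_subset hTS, Set.finite_iUnion hTf, fun p hp hv => hD p hp ?_⟩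
  obtain ⟨A, hA⟩ := exists_eval_eq_trace_tpow D p hp
  intro γ hγ
  rw [MvPolynomial.aeval_eq_eval]
  refine (hA (ratMat γ)).trans ?_
  have hle : Submodule.span ℚ (Set.range fun γ : Subgroup.closure S => tpow D (ratMat γ.1)) ≤
      LinearMap.ker (Matrix.traceLinearMap _ ℚ ℚ ∘ₗ LinearMap.mulLeft ℚ A) := by
    rw [← hspan, Submodule.span_le]
    rintro _ ⟨i, rfl⟩
    have h := hv (a i) (Subgroup.closure_mono (Set.subset_iUnion T i) (hT i))
    rw [MvPolynomial.aeval_eq_eval] at h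
    exact (hA (ratMat (a i).1)).symm.trans h
  exact hle (Submodule.subset_span ⟨⟨γ, hγ⟩, rfl⟩)

lemma exists_finite_symm_denseUpTo (D : ℕ) {S : Set SL(d, ℤ)} (h1 : 1 ∈ S) (hS : S⁻¹ = S)
    (hD : DenseUpTo D (Subgroup.closure S)) :
    ∃ T ⊆ S, T.Finite ∧ 1 ∈ T ∧ T⁻¹ = T ∧ DenseUpTo D (Subgroup.closure T) := by
  obtain ⟨T, hTS, hTf, hT⟩ := exists_finite_denseUpTo D hD
  refine ⟨insert 1 (T ∪ T⁻¹), Set.insert_subset h1 (Set.union_subset hTS ?_),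
    (hTf.union hTf.inv).insert 1, Set.mem_insert 1 _, ?_, fun p hp hv => hT p hp fun γ hγ =>
      hv γ (Subgroup.closure_mono (Set.subset_union_left.trans (Set.subset_insert 1 _)) hγ)⟩
  · rw [← hS]
    exact Set.inv_subset_inv.2 hTS
  · ext x
    simp [or_comm]

end FiniteReduction

end SpecialLinear

theorem stmt1 {d : ℕ} (hd : 2 ≤ d) :
    ∃ m : ℕ, ∀ S : Set (Matrix.SpecialLinearGroup (Fin d) ℤ),
      (1 : Matrix.SpecialLinearGroup (Fin d) ℤ) ∈ S → S⁻¹ = S →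
      ZariskiDenseSLZ d (Subgroup.closure S) →
      ∃ x ∈ S ^ m, ∃ y ∈ S ^ m, FreelyGens x y := by
  have : NeZero d := ⟨by omega⟩
  obtain ⟨m₀, D₀, H₀⟩ := exists_expanding_word hd
  obtain ⟨m, D, H⟩ := exists_freelyGens_of_expanding_word d m₀
  refine ⟨m, fun S h1 hS hZ => ?_⟩
  have hD : DenseUpTo (max D₀ D) (Subgroup.closure S) := fun p _ => hZ p
  obtain ⟨T, hTS, hTf, hT1, hTi, hTD⟩ := exists_finite_symm_denseUpTo _ h1 hS hD
  obtain ⟨P, K, hK, hTK, x, hx, v, hv, z, hxz, hz⟩ :=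
    H₀ T hTf hT1 hTi (hTD.mono (le_max_left _ _))
  obtain ⟨a, ha, b, hb, hab⟩ :=
    H T hT1 hTi (hTD.mono (le_max_right _ _)) P K hK hTK x hx v hv z hxz hz
  exact ⟨a, Set.pow_subset_pow_left hTS ha, b, Set.pow_subset_pow_left hTS hb, hab⟩
end

section
/- For every d ≥ 1 there exists a constant c > 0 (depending only on d) such that for every nonempty compact subset Q ⊆ M_d(ℂ) there exists an integer i with 1 ≤ i ≤ d² satisfying Δ(Q)^i ≥ Λ(Q^i) ≥ c·Δ(Q)^i. Here Δ(Q) = inf_{g ∈ SL_d(ℂ)} max_{a ∈ Q} ‖g a g⁻¹‖, Q^i is the set of all products of i elements of Q, and Λ(Q^i) is the maximum over a ∈ Q^i of the spectral radius of a. -/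
open scoped Pointwise

/-- The operator norm of a complex matrix, induced by the Hermitian norm on `ℂ^d`. -/
noncomputable def opNormC {d : ℕ} (A : Matrix (Fin d) (Fin d) ℂ) : ℝ :=
  ‖LinearMap.toContinuousLinearMap (Matrix.toEuclideanLin A)‖

/-- The spectral radius of a complex matrix. -/
noncomputable def specRad {d : ℕ} (A : Matrix (Fin d) (Fin d) ℂ) : ℝ :=
  (spectralRadius ℂ A).toReal

/-- `Λ(Q)`: the maximal spectral radius over elements of `Q`. -/
noncomputable def LamC {d : ℕ} (Q : Set (Matrix (Fin d) (Fin d) ℂ)) : ℝ :=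
  sSup (specRad '' Q)

/-- `Δ(Q) = inf_{g ∈ SL_d(ℂ)} max_{a ∈ Q} ‖g a g⁻¹‖`. -/
noncomputable def DeltaC {d : ℕ} (Q : Set (Matrix (Fin d) (Fin d) ℂ)) : ℝ :=
  ⨅ g : Matrix.SpecialLinearGroup (Fin d) ℂ,
    sSup ((fun a => opNormC ((g : Matrix (Fin d) (Fin d) ℂ) * a *
      ((g⁻¹ : Matrix.SpecialLinearGroup (Fin d) ℂ) : Matrix (Fin d) (Fin d) ℂ))) '' Q)

section NilAlgebra

variable {K V : Type*} [Field K] [AddCommGroup V] [Module K V]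

open Polynomial in
/-- In characteristic zero, an endomorphism all of whose positive powers are traceless is
nilpotent. -/
theorem Module.End.isNilpotent_of_trace_pow_eq_zero [CharZero K] [FiniteDimensional K V]
    {f : Module.End K V} (hf : ∀ k : ℕ, 1 ≤ k → LinearMap.trace K V (f ^ k) = 0) :
    IsNilpotent f := by
  have htr : ∀ p : K[X], LinearMap.trace K V (aeval f (X * p)) = 0 := by
    intro p
    induction p using Polynomial.induction_on' with
    | add p q hp hq => rw [mul_add, map_add, map_add, hp, hq, add_zero]
    | monomial n a =>
      rw [← C_mul_X_pow_eq_monomial, mul_left_comm, ← pow_succ', ← smul_eq_C_mul, map_smul,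
        map_smul, map_pow, aeval_X, hf _ (by omega), smul_zero]
  obtain ⟨q, hq, hXq⟩ := exists_eq_pow_rootMultiplicity_mul_and_not_dvd f.charpoly
    f.charpoly_monic.ne_zero 0
  rw [C_0, sub_zero] at hq hXq
  set k := rootMultiplicity 0 f.charpoly
  have hkq : aeval f (X ^ (k + 1) * q) = 0 := by
    rw [pow_succ', mul_assoc, ← hq, map_mul, LinearMap.aeval_self_charpoly, mul_zero]
  have hcop : IsCoprime (X ^ (k + 1)) q :=
    ((irreducible_X.coprime_iff_not_dvd).2 hXq).pow_left
  obtain ⟨u, v, huv⟩ := hcop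
  have hidem : IsIdempotentElem (aeval f (u * X ^ (k + 1))) := by
    have h : u * X ^ (k + 1) * (u * X ^ (k + 1)) =
        u * X ^ (k + 1) - u * v * (X ^ (k + 1) * q) := by
      linear_combination u * X ^ (k + 1) * huv
    rw [IsIdempotentElem, ← map_mul, h, map_sub, map_mul _ (u * v), hkq, mul_zero, sub_zero]
  have hzero : aeval f (u * X ^ (k + 1)) = 0 := by
    refine (LinearMap.IsIdempotentElem.trace_eq_zero_iff hidem).1 ?_
    rw [pow_succ', mul_left_comm]
    exact htr _
  refine ⟨k + 1, ?_⟩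
  have h : X ^ (k + 1) = X ^ (k + 1) * (u * X ^ (k + 1)) + v * (X ^ (k + 1) * q) := by
    linear_combination -(X ^ (k + 1)) * huv
  rw [← aeval_X_pow (R := K), h, map_add, map_mul, map_mul _ v, hzero, hkq, mul_zero, mul_zero,
    add_zero]

/-- A nil algebra of endomorphisms of a finite-dimensional space is nilpotent. -/
theorem Submodule.exists_pow_eq_bot_of_isNilpotent [FiniteDimensional K V]
    {A : Submodule K (Module.End K V)} (hmul : A * A ≤ A) (hnil : ∀ a ∈ A, IsNilpotent a) :
    ∃ N : ℕ, A ^ N = ⊥ := by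
  let _ : LieRing (Module.End K V) := LieRing.ofAssociativeRing
  let L : LieSubalgebra K (Module.End K V) :=
    { A with
      lie_mem' := fun {x y} hx hy =>
        A.sub_mem (hmul (Submodule.mul_mem_mul hx hy)) (hmul (Submodule.mul_mem_mul hy hx)) }
  have hL : LieModule.IsNilpotent L V :=
    (LieModule.isNilpotent_iff_forall' (R := K)).2 fun x => hnil x x.2
  obtain ⟨N, hN⟩ := (LieModule.isNilpotent_iff K L V).1 hL
  have hlcs : ∀ n : ℕ, ∀ a ∈ A ^ n, ∀ v : V, a v ∈ LieModule.lowerCentralSeries K L V n := by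
    intro n
    induction n with
    | zero => intro a _ v; simp
    | succ n ih =>
      intro a ha v
      rw [pow_succ'] at ha
      refine Submodule.mul_induction_on ha (fun m hm b hb => ?_) fun x y hx hy => add_mem hx hy
      rw [LieModule.lowerCentralSeries_succ]
      exact LieSubmodule.lie_mem_lie (x := (⟨m, hm⟩ : L)) (LieSubmodule.mem_top _) (ih b hb v)
  refine ⟨N, (Submodule.eq_bot_iff _).2 fun a ha => LinearMap.ext fun v => ?_⟩
  have := hlcs N a ha v
  rw [hN] at this
  simpa using this

/-- A subspace `M` of a finite-dimensional algebra lies in a multiplicatively closed subspace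
contained in the sum of the powers of `M` of exponent between `1` and the dimension. -/
theorem Submodule.exists_le_mul_self_le {R : Type*} [Ring R] [Algebra K R] [FiniteDimensional K R]
    (M : Submodule K R) : ∃ A : Submodule K R, M ≤ A ∧ A * A ≤ A ∧
      A ≤ ⨆ i ∈ Finset.Icc 1 (Module.finrank K R), M ^ i := by
  let S : ℕ → Submodule K R := fun k => ⨆ i ∈ Finset.Icc 1 k, M ^ i
  have hsucc : ∀ k, S (k + 1) = M ⊔ M * S k := by
    intro k
    apply le_antisymm
    · refine iSup₂_le fun i hi => ?_
      rw [Finset.mem_Icc] at hi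
      obtain ⟨j, rfl⟩ := Nat.exists_eq_add_of_le' hi.1
      rcases Nat.eq_zero_or_pos j with rfl | hj
      · simp
      · refine le_sup_of_le_right ?_
        rw [pow_succ']
        exact mul_le_mul' le_rfl
          (le_iSup₂_of_le j (Finset.mem_Icc.2 ⟨hj, by omega⟩) le_rfl)
    · refine sup_le (le_iSup₂_of_le 1 (by simp) (by simp)) ?_
      simp only [S, Submodule.mul_iSup]
      refine iSup₂_le fun i hi => ?_
      rw [Finset.mem_Icc] at hi
      rw [← pow_succ']
      exact le_iSup₂_of_le (i + 1) (Finset.mem_Icc.2 ⟨by omega, by omega⟩) le_rfl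
  have hmono : Monotone S := fun a b hab =>
    biSup_mono fun i hi => by simp only [Finset.mem_Icc] at hi ⊢; omega
  obtain ⟨k, hk, hstab⟩ : ∃ k ≤ Module.finrank K R, S (k + 1) = S k := by
    by_contra! h
    have hrank : ∀ k ≤ Module.finrank K R + 1, k ≤ Module.finrank K (S k) := by
      intro k
      induction k with
      | zero => intro _; exact Nat.zero_le _
      | succ k ih =>
        intro hk
        have := Submodule.finrank_lt_finrank_of_lt
          (lt_of_le_of_ne (hmono (Nat.le_add_right k 1)) (h k (by omega)).symm)
        have := ih (by omega)
        omega
    have := hrank _ le_rfl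
    have := Submodule.finrank_le (S (Module.finrank K R + 1))
    omega
  have hM : M ≤ S k := by rw [← hstab, hsucc]; exact le_sup_left
  have hMS : M * S k ≤ S k := by
    conv_rhs => rw [← hstab, hsucc]
    exact le_sup_right
  have hpow : ∀ i, M ^ i * S k ≤ S k := by
    intro i
    induction i with
    | zero => simp
    | succ i ih =>
      rw [pow_succ, mul_assoc]
      exact (mul_le_mul' le_rfl hMS).trans ih
  refine ⟨S k, hM, ?_, hmono hk⟩
  conv_lhs => enter [1]; simp only [S]
  simp only [Submodule.iSup_mul]
  exact iSup₂_le fun i _ => hpow i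

/-- A space `M` of endomorphisms is nilpotent as soon as the powers of `M` of exponent at most
`dim (End V)` consist of traceless endomorphisms. -/
theorem Submodule.exists_pow_eq_bot_of_trace_eq_zero [CharZero K] [FiniteDimensional K V]
    (M : Submodule K (Module.End K V))
    (hM : ∀ i : ℕ, 1 ≤ i → i ≤ Module.finrank K (Module.End K V) →
      ∀ x ∈ M ^ i, LinearMap.trace K V x = 0) :
    ∃ N : ℕ, M ^ N = ⊥ := by
  obtain ⟨A, hMA, hmul, hA⟩ := M.exists_le_mul_self_le
  have htr : ∀ x ∈ A, LinearMap.trace K V x = 0 := by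
    have : A ≤ LinearMap.ker (LinearMap.trace K V) :=
      hA.trans (iSup₂_le fun i hi x hx =>
        hM i (Finset.mem_Icc.1 hi).1 (Finset.mem_Icc.1 hi).2 x hx)
    exact fun x hx => this hx
  have hpow : ∀ x ∈ A, ∀ k : ℕ, x ^ (k + 1) ∈ A := by
    intro x hx k
    induction k with
    | zero => simpa using hx
    | succ k ih => rw [pow_succ]; exact hmul (Submodule.mul_mem_mul ih hx)
  obtain ⟨N, hN⟩ := Submodule.exists_pow_eq_bot_of_isNilpotent hmul fun x hx =>
    Module.End.isNilpotent_of_trace_pow_eq_zero fun k hk => by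
      obtain ⟨j, rfl⟩ := Nat.exists_eq_add_of_le' hk
      exact htr _ (hpow x hx j)
  exact ⟨N, le_bot_iff.1 (hN ▸ pow_le_pow_left' hMA N)⟩

end NilAlgebra

section L2Norm

open scoped Matrix.Norms.L2Operator

/-- Conjugation by an element of `SL_d(ℂ)`, as an algebra homomorphism. -/
noncomputable def conjSL {d : ℕ} (g : Matrix.SpecialLinearGroup (Fin d) ℂ) :
    Matrix (Fin d) (Fin d) ℂ →ₐ[ℂ] Matrix (Fin d) (Fin d) ℂ :=
  AlgHom.ofLinearMap
    (LinearMap.mulLeft ℂ (g : Matrix (Fin d) (Fin d) ℂ) ∘ₗ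
      LinearMap.mulRight ℂ ((g⁻¹ : Matrix.SpecialLinearGroup (Fin d) ℂ) : Matrix (Fin d) (Fin d) ℂ))
    (by simp [← Matrix.SpecialLinearGroup.coe_mul, -Matrix.SpecialLinearGroup.coe_inv])
    (fun x y => by
      have h : ((g⁻¹ : Matrix.SpecialLinearGroup (Fin d) ℂ) : Matrix (Fin d) (Fin d) ℂ) *
          (g : Matrix (Fin d) (Fin d) ℂ) = 1 := by
        rw [← Matrix.SpecialLinearGroup.coe_mul, inv_mul_cancel, Matrix.SpecialLinearGroup.coe_one]
      simp only [LinearMap.comp_apply, LinearMap.mulLeft_apply, LinearMap.mulRight_apply]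
      rw [show ∀ a b a' b' u v : Matrix (Fin d) (Fin d) ℂ,
        a * (u * b) * (a' * (v * b')) = a * (u * (b * a') * (v * b')) by intros; noncomm_ring,
        h, mul_one, mul_assoc x])

section Conjugation

variable {d : ℕ}

theorem conjSL_apply (g : Matrix.SpecialLinearGroup (Fin d) ℂ) (a : Matrix (Fin d) (Fin d) ℂ) :
    conjSL g a = (g : Matrix (Fin d) (Fin d) ℂ) * a *
      ((g⁻¹ : Matrix.SpecialLinearGroup (Fin d) ℂ) : Matrix (Fin d) (Fin d) ℂ) :=
  (mul_assoc _ _ _).symm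

theorem conjSL_mul (g h : Matrix.SpecialLinearGroup (Fin d) ℂ) (a : Matrix (Fin d) (Fin d) ℂ) :
    conjSL (g * h) a = conjSL g (conjSL h a) := by
  simp only [conjSL_apply, mul_inv_rev, Matrix.SpecialLinearGroup.coe_mul, mul_assoc]

theorem continuous_conjSL (g : Matrix.SpecialLinearGroup (Fin d) ℂ) : Continuous (conjSL g) :=
  (conjSL g).toLinearMap.continuous_of_finiteDimensional

theorem trace_conjSL (g : Matrix.SpecialLinearGroup (Fin d) ℂ) (a : Matrix (Fin d) (Fin d) ℂ) :
    (conjSL g a).trace = a.trace := by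
  rw [conjSL_apply, Matrix.trace_mul_comm, ← mul_assoc, ← Matrix.SpecialLinearGroup.coe_mul,
    inv_mul_cancel, Matrix.SpecialLinearGroup.coe_one, one_mul]

theorem specRad_conjSL (g : Matrix.SpecialLinearGroup (Fin d) ℂ) (a : Matrix (Fin d) (Fin d) ℂ) :
    specRad (conjSL g a) = specRad a := by
  have h := spectrum.units_conjugate (R := ℂ) (a := a) (u := Matrix.SpecialLinearGroup.toGL g)
  rw [specRad, specRad, spectralRadius, spectralRadius, ← h, ← map_inv, conjSL_apply]
  rfl

open scoped MatrixOrder ComplexOrder in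
/-- A finite family of matrices spanning a nilpotent space can be conjugated into the unit ball:
the solution of `H = 1 + ∑ j, (f j)ᴴ * H * f j` is an adapted Hermitian form. -/
theorem exists_norm_conjSL_le_one [NeZero d] {ι : Type*} [Fintype ι]
    (f : ι → Matrix (Fin d) (Fin d) ℂ) (M : Submodule ℂ (Matrix (Fin d) (Fin d) ℂ))
    (hf : ∀ j, f j ∈ M) {N : ℕ} (hM : M ^ N = ⊥) :
    ∃ g : Matrix.SpecialLinearGroup (Fin d) ℂ, ∀ j, ‖conjSL g (f j)‖ ≤ 1 := by
  let Φ : Module.End ℂ (Matrix (Fin d) (Fin d) ℂ) :=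
    ∑ j, LinearMap.mulLeft ℂ (star (f j)) ∘ₗ LinearMap.mulRight ℂ (f j)
  have hΦ : ∀ X, Φ X = ∑ j, star (f j) * X * f j := fun X => by
    simp [Φ, LinearMap.sum_apply, mul_assoc]
  have hΦ_nonneg : ∀ X, 0 ≤ X → 0 ≤ Φ X := fun X hX => by
    rw [hΦ]
    exact Finset.sum_nonneg fun j _ => star_left_conjugate_nonneg hX _
  have hpow_mem : ∀ k, (Φ ^ k) 1 ∈ (⊤ : Submodule ℂ (Matrix (Fin d) (Fin d) ℂ)) * M ^ k := by
    intro k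
    induction k with
    | zero => simp
    | succ k ih =>
      rw [pow_succ' Φ, Module.End.mul_apply, hΦ, pow_succ M, ← mul_assoc]
      refine Submodule.sum_mem _ fun j _ => Submodule.mul_mem_mul ?_ (hf j)
      have : (⊤ : Submodule ℂ (Matrix (Fin d) (Fin d) ℂ)) * (⊤ * M ^ k) ≤ ⊤ * M ^ k := by
        rw [← mul_assoc]
        exact mul_le_mul' le_top le_rfl
      exact this (Submodule.mul_mem_mul Submodule.mem_top ih)
  have hpow_zero : (Φ ^ N) 1 = 0 := by simpa [hM] using hpow_mem N
  have hpow_nonneg : ∀ k, 0 ≤ (Φ ^ k) 1 := by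
    intro k
    induction k with
    | zero => simp
    | succ k ih => rw [pow_succ', Module.End.mul_apply]; exact hΦ_nonneg _ ih
  let H : Matrix (Fin d) (Fin d) ℂ := ∑ k ∈ Finset.range N, (Φ ^ k) 1
  have hH_nonneg : 0 ≤ H := Finset.sum_nonneg fun k _ => hpow_nonneg k
  have hH : H = Φ H + 1 := by
    calc H = ∑ k ∈ Finset.range (N + 1), (Φ ^ k) 1 := by
          rw [Finset.sum_range_succ, hpow_zero, add_zero]
      _ = Φ H + 1 := by
          rw [Finset.sum_range_succ']
          simp only [H, map_sum, pow_succ', Module.End.mul_apply, pow_zero, Module.End.one_apply]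
  have hfH : ∀ j, star (f j) * H * f j ≤ H := fun j => by
    calc star (f j) * H * f j ≤ Φ H := by
          rw [hΦ]
          exact Finset.single_le_sum
            (f := fun j => star (f j) * H * f j)
            (fun i _ => star_left_conjugate_nonneg hH_nonneg _) (Finset.mem_univ j)
      _ ≤ Φ H + 1 := le_add_of_nonneg_right zero_le_one
      _ = H := hH.symm
  have hH_det : H.det ≠ 0 := by
    have : H.PosDef := by
      rw [hH]
      exact Matrix.PosDef.posSemidef_add
        (Matrix.nonneg_iff_posSemidef.1 (hΦ_nonneg _ hH_nonneg)) Matrix.PosDef.one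
    exact this.det_pos.ne'
  obtain ⟨B, hB⟩ := CStarAlgebra.nonneg_iff_eq_star_mul_self.1 hH_nonneg
  have hB_det : B.det ≠ 0 := fun h => hH_det (by rw [hB, Matrix.det_mul, h, mul_zero])
  obtain ⟨c, hc⟩ := IsAlgClosed.exists_pow_nat_eq B.det⁻¹ (NeZero.pos d)
  let g : Matrix.SpecialLinearGroup (Fin d) ℂ :=
    ⟨c • B, by rw [Matrix.det_smul, Fintype.card_fin, hc, inv_mul_cancel₀ hB_det]⟩
  refine ⟨g, fun j => ?_⟩
  set G : Matrix (Fin d) (Fin d) ℂ := (g : Matrix (Fin d) (Fin d) ℂ)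
  have hG : G = c • B := rfl
  set G' : Matrix (Fin d) (Fin d) ℂ :=
    ((g⁻¹ : Matrix.SpecialLinearGroup (Fin d) ℂ) : Matrix (Fin d) (Fin d) ℂ) with hG'
  have hGG' : G * G' = 1 := by
    rw [hG', ← Matrix.SpecialLinearGroup.coe_mul, mul_inv_cancel, Matrix.SpecialLinearGroup.coe_one]
  have hfG : star (f j) * (star G * G) * f j ≤ star G * G := by
    obtain ⟨Y, hY⟩ := CStarAlgebra.nonneg_iff_eq_star_mul_self.1 (sub_nonneg.2 (hfH j))
    have h : star G * G - star (f j) * (star G * G) * f j = star (c • Y) * (c • Y) := by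
      rw [hG, star_smul c B, star_smul c Y, smul_mul_smul_comm, smul_mul_smul_comm, ← hY, ← hB,
        smul_sub, mul_smul_comm, smul_mul_assoc]
    exact sub_nonneg.1 (h ▸ star_mul_self_nonneg _)
  have hle : star (conjSL g (f j)) * conjSL g (f j) ≤ 1 := by
    calc star (conjSL g (f j)) * conjSL g (f j)
        = star G' * (star (f j) * (star G * G) * f j) * G' := by
          rw [conjSL_apply]
          simp only [star_mul, mul_assoc]
          rfl
      _ ≤ star G' * (star G * G) * G' := star_left_conjugate_le_conjugate hfG _
      _ = star (G * G') * (G * G') := by simp only [star_mul, mul_assoc]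
      _ = 1 := by rw [hGG', star_one, one_mul]
  have := (CStarAlgebra.norm_le_one_iff_of_nonneg _ (star_mul_self_nonneg _)).2 hle
  rw [CStarRing.norm_star_mul_self] at this
  nlinarith [norm_nonneg (conjSL g (f j))]

theorem exists_norm_conjSL_le [NeZero d] {M : Submodule ℂ (Matrix (Fin d) (Fin d) ℂ)} {N : ℕ}
    (hM : M ^ N = ⊥) {ε : ℝ} (hε : 0 < ε) :
    ∃ g : Matrix.SpecialLinearGroup (Fin d) ℂ, ∀ a ∈ M, ‖conjSL g a‖ ≤ ε * ‖a‖ := by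
  let b := Module.finBasis ℂ M
  let C : ℝ := ‖LinearMap.toContinuousLinearMap b.equivFun.toLinearMap‖
  have hC : ∀ (a : M) i, ‖b.equivFun a i‖ ≤ C * ‖a‖ := fun a i =>
    (norm_le_pi_norm _ i).trans
      ((LinearMap.toContinuousLinearMap b.equivFun.toLinearMap).le_opNorm a)
  have hC0 : 0 ≤ C := ContinuousLinearMap.opNorm_nonneg _
  let m : ℝ := Module.finrank ℂ M
  have hm : 0 ≤ m := Nat.cast_nonneg _
  let s : ℝ := (m * C + 1) / ε
  have hs : 0 < s := by positivity
  obtain ⟨g, hg⟩ := exists_norm_conjSL_le_one (fun i => (s : ℂ) • (b i : Matrix (Fin d) (Fin d) ℂ))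
    M (fun i => M.smul_mem _ (b i).2) hM
  refine ⟨g, fun a ha => ?_⟩
  have hgb : ∀ i, ‖conjSL g (b i)‖ ≤ s⁻¹ := fun i => by
    have := hg i
    rw [map_smul, norm_smul, Complex.norm_real, Real.norm_of_nonneg hs.le] at this
    rwa [← one_div, le_div_iff₀' hs]
  have hsum : a = ∑ i, b.equivFun ⟨a, ha⟩ i • (b i : Matrix (Fin d) (Fin d) ℂ) := by
    have h := congrArg M.subtype (b.sum_equivFun ⟨a, ha⟩)
    rw [map_sum] at h
    exact h.symm
  calc ‖conjSL g a‖ = ‖∑ i, b.equivFun ⟨a, ha⟩ i • conjSL g (b i)‖ := by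
        conv_lhs => rw [hsum]
        simp only [map_sum, map_smul]
    _ ≤ ∑ i, ‖b.equivFun ⟨a, ha⟩ i • conjSL g (b i)‖ := norm_sum_le _ _
    _ ≤ ∑ _i : Fin (Module.finrank ℂ M), C * ‖a‖ * s⁻¹ := Finset.sum_le_sum fun i _ => by
        rw [norm_smul]
        exact mul_le_mul (hC ⟨a, ha⟩ i) (hgb i) (norm_nonneg _) (by positivity)
    _ = (m * C / (m * C + 1)) * ε * ‖a‖ := by
        simp only [Finset.sum_const, Finset.card_univ, Fintype.card_fin, nsmul_eq_mul, s, inv_div,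
          m]
        ring
    _ ≤ 1 * ε * ‖a‖ := by
        gcongr
        exact div_le_one_of_le₀ (by linarith) (by positivity)
    _ = ε * ‖a‖ := by rw [one_mul]

end Conjugation

section SpectralRadius

variable {d : ℕ}

theorem spectralRadius_ne_top [NeZero d] (a : Matrix (Fin d) (Fin d) ℂ) :
    spectralRadius ℂ a ≠ ⊤ :=
  ne_top_of_le_ne_top ENNReal.coe_ne_top (spectrum.spectralRadius_le_nnnorm a)

theorem specRad_nonneg (a : Matrix (Fin d) (Fin d) ℂ) : 0 ≤ specRad a := ENNReal.toReal_nonneg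

theorem specRad_le_norm [NeZero d] (a : Matrix (Fin d) (Fin d) ℂ) : specRad a ≤ ‖a‖ :=
  ENNReal.toReal_mono ENNReal.coe_ne_top (spectrum.spectralRadius_le_nnnorm a)

theorem norm_trace_le_mul_specRad [NeZero d] (a : Matrix (Fin d) (Fin d) ℂ) :
    ‖a.trace‖ ≤ d * specRad a := by
  have hroot : ∀ z ∈ a.charpoly.roots.map (fun z => ‖z‖), z ≤ specRad a := by
    intro r hr
    obtain ⟨z, hz, rfl⟩ := Multiset.mem_map.1 hr
    have hz' : z ∈ spectrum ℂ a :=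
      Matrix.mem_spectrum_iff_isRoot_charpoly.2 (Polynomial.isRoot_of_mem_roots hz)
    have h : (‖z‖₊ : ENNReal) ≤ spectralRadius ℂ a :=
      le_iSup₂ (f := fun k (_ : k ∈ spectrum ℂ a) => (‖k‖₊ : ENNReal)) z hz'
    exact ENNReal.toReal_mono (spectralRadius_ne_top a) h
  rw [Matrix.trace_eq_sum_roots_charpoly]
  calc ‖a.charpoly.roots.sum‖ ≤ (a.charpoly.roots.map (fun z => ‖z‖)).sum :=
        norm_multiset_sum_le _
    _ ≤ (a.charpoly.roots.map (fun z => ‖z‖)).card • specRad a :=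
        Multiset.sum_le_card_nsmul _ _ hroot
    _ ≤ d * specRad a := by
        rw [nsmul_eq_mul, Multiset.card_map]
        have : a.charpoly.roots.card ≤ d := by
          simpa using a.charpoly.card_roots'
        gcongr
        exact specRad_nonneg a

end SpectralRadius

section MinimalNorm

variable {d : ℕ} {Q : Set (Matrix (Fin d) (Fin d) ℂ)}

theorem DeltaC_eq (Q : Set (Matrix (Fin d) (Fin d) ℂ)) :
    DeltaC Q = ⨅ g : Matrix.SpecialLinearGroup (Fin d) ℂ,
      sSup ((fun a => ‖conjSL g a‖) '' Q) := by
  simp only [conjSL_apply]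
  rfl

theorem sSup_norm_conjSL_nonneg (g : Matrix.SpecialLinearGroup (Fin d) ℂ)
    (Q : Set (Matrix (Fin d) (Fin d) ℂ)) : 0 ≤ sSup ((fun a => ‖conjSL g a‖) '' Q) :=
  Real.sSup_nonneg (by rintro _ ⟨a, _, rfl⟩; exact norm_nonneg _)

theorem DeltaC_le_sSup (g : Matrix.SpecialLinearGroup (Fin d) ℂ)
    (Q : Set (Matrix (Fin d) (Fin d) ℂ)) : DeltaC Q ≤ sSup ((fun a => ‖conjSL g a‖) '' Q) := by
  rw [DeltaC_eq]
  exact ciInf_le ⟨0, by rintro _ ⟨g, rfl⟩; exact sSup_norm_conjSL_nonneg g Q⟩ g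

theorem DeltaC_le (g : Matrix.SpecialLinearGroup (Fin d) ℂ) (hQ : Q.Nonempty) {r : ℝ}
    (h : ∀ a ∈ Q, ‖conjSL g a‖ ≤ r) : DeltaC Q ≤ r :=
  (DeltaC_le_sSup g Q).trans
    (csSup_le (hQ.image _) (by rintro _ ⟨a, ha, rfl⟩; exact h a ha))

theorem norm_conjSL_le_sSup (hQ : Bornology.IsBounded Q)
    (g : Matrix.SpecialLinearGroup (Fin d) ℂ) {a : Matrix (Fin d) (Fin d) ℂ} (ha : a ∈ Q) :
    ‖conjSL g a‖ ≤ sSup ((fun a => ‖conjSL g a‖) '' Q) := by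
  refine le_csSup ?_ (Set.mem_image_of_mem _ ha)
  obtain ⟨C, hC⟩ := hQ.exists_norm_le
  refine ⟨‖LinearMap.toContinuousLinearMap (conjSL g).toLinearMap‖ * C, ?_⟩
  rintro _ ⟨b, hb, rfl⟩
  exact ((LinearMap.toContinuousLinearMap (conjSL g).toLinearMap).le_opNorm_of_le (hC b hb))

theorem norm_le_pow_of_mem_pow [NeZero d] {r : ℝ} (h : ∀ a ∈ Q, ‖a‖ ≤ r) :
    ∀ (i : ℕ), ∀ a ∈ Q ^ i, ‖a‖ ≤ r ^ i := by
  intro i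
  induction i with
  | zero => intro a ha; simp_all
  | succ i ih =>
    intro a ha
    rw [pow_succ] at ha
    obtain ⟨x, hx, y, hy, rfl⟩ := Set.mem_mul.1 ha
    rw [pow_succ]
    exact (norm_mul_le _ _).trans (mul_le_mul (ih x hx) (h y hy) (norm_nonneg _)
      ((norm_nonneg _).trans (ih x hx)))

theorem specRad_le_sSup_norm_conjSL_pow [NeZero d] (hQ : Bornology.IsBounded Q)
    (g : Matrix.SpecialLinearGroup (Fin d) ℂ) (i : ℕ) {a : Matrix (Fin d) (Fin d) ℂ}
    (ha : a ∈ Q ^ i) : specRad a ≤ sSup ((fun a => ‖conjSL g a‖) '' Q) ^ i := by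
  rw [← specRad_conjSL g]
  refine (specRad_le_norm _).trans (norm_le_pow_of_mem_pow (Q := conjSL g '' Q) ?_ i _ ?_)
  · rintro _ ⟨b, hb, rfl⟩
    exact norm_conjSL_le_sSup hQ g hb
  · rw [← Set.image_pow]
    exact Set.mem_image_of_mem _ ha

theorem specRad_le_LamC_pow [NeZero d] (hQ : Bornology.IsBounded Q) (i : ℕ)
    {a : Matrix (Fin d) (Fin d) ℂ} (ha : a ∈ Q ^ i) : specRad a ≤ LamC (Q ^ i) :=
  le_csSup ⟨_, by rintro _ ⟨b, hb, rfl⟩; exact specRad_le_sSup_norm_conjSL_pow hQ 1 i hb⟩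
    (Set.mem_image_of_mem _ ha)

theorem LamC_nonneg (Q : Set (Matrix (Fin d) (Fin d) ℂ)) : 0 ≤ LamC Q :=
  Real.sSup_nonneg (by rintro _ ⟨a, _, rfl⟩; exact specRad_nonneg a)

theorem LamC_pow_le_DeltaC_pow [NeZero d] (hQ : Q.Nonempty) (hQb : Bornology.IsBounded Q)
    (i : ℕ) : LamC (Q ^ i) ≤ DeltaC Q ^ i := by
  refine ge_of_tendsto (x := nhdsWithin (DeltaC Q) (Set.Ioi (DeltaC Q))) (f := fun r : ℝ => r ^ i)
    (((continuous_pow i).tendsto _).mono_left nhdsWithin_le_nhds) ?_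
  filter_upwards [self_mem_nhdsWithin] with r hr
  obtain ⟨g, hg⟩ := exists_lt_of_ciInf_lt ((DeltaC_eq Q).symm.trans_lt hr)
  refine csSup_le (hQ.pow.image _) ?_
  rintro _ ⟨a, ha, rfl⟩
  exact (specRad_le_sSup_norm_conjSL_pow hQb g i ha).trans
    (pow_le_pow_left₀ (sSup_norm_conjSL_nonneg g Q) hg.le i)

end MinimalNorm

section Limit

open Filter Topology

variable {d : ℕ}

theorem Matrix.exists_span_pow_eq_bot_of_trace_eq_zero {S : Set (Matrix (Fin d) (Fin d) ℂ)}
    (hS : ∀ i : ℕ, 1 ≤ i → i ≤ d ^ 2 → ∀ x ∈ S ^ i, x.trace = 0) :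
    ∃ N : ℕ, Submodule.span ℂ S ^ N = ⊥ := by
  let e : Matrix (Fin d) (Fin d) ℂ ≃ₐ[ℂ] Module.End ℂ (Fin d → ℂ) := Matrix.toLinAlgEquiv'
  have hmap : ∀ i, (Submodule.span ℂ S).map e.toLinearMap ^ i =
      (Submodule.span ℂ S ^ i).map e.toLinearMap := fun i =>
    (Submodule.map_pow (Submodule.span ℂ S) e.toAlgHom i).symm
  obtain ⟨N, hN⟩ := ((Submodule.span ℂ S).map e.toLinearMap).exists_pow_eq_bot_of_trace_eq_zero
    (by
      intro i hi hid x hx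
      rw [hmap, Submodule.span_pow] at hx
      obtain ⟨y, hy, rfl⟩ := hx
      have hid' : i ≤ d ^ 2 := by
        rwa [← e.toLinearEquiv.finrank_eq, Module.finrank_matrix, Module.finrank_self,
          Fintype.card_fin, mul_one, ← sq] at hid
      have hle : Submodule.span ℂ (S ^ i) ≤
          LinearMap.ker (Matrix.traceLinearMap (Fin d) ℂ ℂ) :=
        Submodule.span_le.2 fun z hz => hS i hi hid' z hz
      exact (Matrix.trace_toLin'_eq y).trans (hle hy))
  refine ⟨N, ?_⟩
  rw [hmap] at hN
  exact Submodule.map_injective_of_injective (f := e.toLinearMap) e.injective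
    (hN.trans (Submodule.map_bot _).symm)

/-- The set of all limits along `U` of sequences of points `f n ∈ P n`. -/
def ultraLimit {X : Type*} [TopologicalSpace X] (U : Ultrafilter ℕ) (P : ℕ → Set X) : Set X :=
  {x | ∃ f : ℕ → X, (∀ n, f n ∈ P n) ∧ Tendsto f U (𝓝 x)}

theorem ultraLimit_pow_subset {X : Type*} [TopologicalSpace X] [Monoid X] [ContinuousMul X]
    (U : Ultrafilter ℕ) (P : ℕ → Set X) (i : ℕ) :
    ultraLimit U P ^ i ⊆ ultraLimit U fun n => P n ^ i := by
  induction i with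
  | zero =>
    rintro x hx
    exact ⟨fun _ => x, fun n => by simpa using hx, tendsto_const_nhds⟩
  | succ i ih =>
    intro x hx
    rw [pow_succ] at hx
    obtain ⟨y, hy, z, hz, rfl⟩ := Set.mem_mul.1 hx
    obtain ⟨f, hf, hfy⟩ := ih hy
    obtain ⟨h, hh, hhz⟩ := hz
    refine ⟨fun n => f n * h n, fun n => ?_, hfy.mul hhz⟩
    simpa only [pow_succ] using Set.mul_mem_mul (hf n) (hh n)

theorem exists_mem_ultraLimit {X : Type*} [TopologicalSpace X] {K : Set X} (hK : IsCompact K)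
    (U : Ultrafilter ℕ) {P : ℕ → Set X} (hP : ∀ n, P n ⊆ K) {f : ℕ → X} (hf : ∀ n, f n ∈ P n) :
    ∃ x ∈ K, x ∈ ultraLimit U P ∧ Tendsto f U (𝓝 x) := by
  obtain ⟨x, hx, hfx⟩ := hK.ultrafilter_le_nhds' (U.map f)
    (Ultrafilter.mem_map.2 (Filter.univ_mem' fun n => hP n (hf n)))
  exact ⟨x, hx, ⟨f, hf, hfx⟩, hfx⟩

/-- If the traces of short words in uniformly bounded sets `P n` tend to zero, then some `P n` can
be conjugated into the ball of radius `1 / 2`. -/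
theorem exists_norm_conjSL_le_half [NeZero d] {P : ℕ → Set (Matrix (Fin d) (Fin d) ℂ)}
    {r : ℝ} (hr : 0 < r) (hP : ∀ n, ∀ a ∈ P n, ‖a‖ ≤ r) {C : ℝ}
    (htr : ∀ n i : ℕ, 1 ≤ i → i ≤ d ^ 2 → ∀ a ∈ P n ^ i, ‖a.trace‖ ≤ C / ((n : ℝ) + 1)) :
    ∃ (n : ℕ) (g : Matrix.SpecialLinearGroup (Fin d) ℂ), ∀ a ∈ P n, ‖conjSL g a‖ ≤ 1 / 2 := by
  have : ProperSpace (Matrix (Fin d) (Fin d) ℂ) := FiniteDimensional.proper ℂ _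
  let U : Ultrafilter ℕ := hyperfilter ℕ
  have hU : (U : Filter ℕ) ≤ atTop := Nat.hyperfilter_le_atTop
  have hPK : ∀ n, P n ⊆ Metric.closedBall 0 r := fun n a ha => by simpa using hP n a ha
  obtain ⟨N, hN⟩ := Matrix.exists_span_pow_eq_bot_of_trace_eq_zero (S := ultraLimit U P) (by
    intro i hi hid x hx
    obtain ⟨f, hf, hfx⟩ := ultraLimit_pow_subset U P i hx
    have h0 : Tendsto (fun n => (f n).trace) U (𝓝 0) :=
      squeeze_zero_norm (fun n => htr n i hi hid _ (hf n))
        ((tendsto_const_div_atTop_nhds_zero_nat C |>.comp (tendsto_add_atTop_nat 1)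
          |>.congr fun n => by simp).mono_left hU)
    exact tendsto_nhds_unique ((continuous_id.matrix_trace.tendsto x).comp hfx) h0)
  obtain ⟨g, hg⟩ := exists_norm_conjSL_le hN (ε := 1 / (4 * r)) (by positivity)
  by_contra! hbad
  choose f hfP hf using fun n => hbad n g
  obtain ⟨x, hxK, hxU, hfx⟩ :=
    exists_mem_ultraLimit (isCompact_closedBall _ _) U hPK hfP
  have hx : ‖x‖ ≤ r := by simpa using hxK
  have hle : ‖conjSL g x‖ ≤ 1 / 4 := by
    calc ‖conjSL g x‖ ≤ 1 / (4 * r) * ‖x‖ := hg x (Submodule.subset_span hxU)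
      _ ≤ 1 / (4 * r) * r := by gcongr
      _ = 1 / 4 := by field_simp
  have hge : 1 / 2 ≤ ‖conjSL g x‖ :=
    ge_of_tendsto (((continuous_conjSL g).norm.tendsto x).comp hfx)
      (Eventually.of_forall fun n => (hf n).le)
  linarith

/-- The lower bound in the comparison of the minimal norm with spectral radii. -/
theorem exists_mul_DeltaC_pow_le_LamC [NeZero d] :
    ∃ c : ℝ, 0 < c ∧ ∀ Q : Set (Matrix (Fin d) (Fin d) ℂ), Q.Nonempty → Bornology.IsBounded Q →
      ∃ i : ℕ, 1 ≤ i ∧ i ≤ d ^ 2 ∧ c * DeltaC Q ^ i ≤ LamC (Q ^ i) := by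
  by_contra! h
  choose Q hne hbdd hlt using fun n : ℕ => h (1 / ((n : ℝ) + 1)) (by positivity)
  have hΔ : ∀ n, 0 < DeltaC (Q n) := fun n => by
    have h1 := (LamC_nonneg _).trans_lt (hlt n 1 le_rfl (Nat.one_le_pow _ _ (NeZero.pos d)))
    rw [pow_one] at h1
    exact pos_of_mul_pos_right h1 (by positivity)
  have hgex : ∀ n, ∃ g : Matrix.SpecialLinearGroup (Fin d) ℂ,
      sSup ((fun a => ‖conjSL g a‖) '' Q n) < 2 * DeltaC (Q n) := fun n =>
    exists_lt_of_ciInf_lt ((DeltaC_eq (Q n)).symm.trans_lt (by linarith [hΔ n]))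
  choose g hg using hgex
  let φ : ℕ → Matrix (Fin d) (Fin d) ℂ → Matrix (Fin d) (Fin d) ℂ := fun n a =>
    ((DeltaC (Q n))⁻¹ : ℂ) • conjSL (g n) a
  have hnorm : ∀ n : ℕ, ‖((DeltaC (Q n))⁻¹ : ℂ)‖ = (DeltaC (Q n))⁻¹ := fun n => by
    rw [norm_inv, Complex.norm_real, Real.norm_of_nonneg (hΔ n).le]
  have hpow : ∀ n i, ∀ x ∈ (φ n '' Q n) ^ i,
      ∃ y ∈ Q n ^ i, x = ((DeltaC (Q n))⁻¹ : ℂ) ^ i • conjSL (g n) y := by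
    intro n i
    induction i with
    | zero => intro x hx; exact ⟨1, by simp, by simpa using hx⟩
    | succ i ih =>
      intro x hx
      rw [pow_succ] at hx
      obtain ⟨u, hu, _, ⟨b, hb, rfl⟩, rfl⟩ := Set.mem_mul.1 hx
      obtain ⟨y, hy, rfl⟩ := ih u hu
      refine ⟨y * b, by rw [pow_succ]; exact Set.mul_mem_mul hy hb, ?_⟩
      rw [map_mul, smul_mul_smul_comm, pow_succ]
  obtain ⟨n, k, hk⟩ := exists_norm_conjSL_le_half (P := fun n => φ n '' Q n) (r := 2) (C := d)
    two_pos
    (by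
      rintro n _ ⟨a, ha, rfl⟩
      simp only [φ]
      rw [norm_smul, hnorm, inv_mul_le_iff₀ (hΔ n), mul_comm]
      exact (norm_conjSL_le_sSup (hbdd n) (g n) ha).trans (hg n).le)
    (by
      intro n i hi hid x hx
      obtain ⟨y, hy, rfl⟩ := hpow n i x hx
      have hpos : 0 < DeltaC (Q n) ^ i := pow_pos (hΔ n) i
      rw [Matrix.trace_smul, trace_conjSL, norm_smul, norm_pow, hnorm, inv_pow,
        inv_mul_le_iff₀ hpos]
      calc ‖y.trace‖ ≤ d * specRad y := norm_trace_le_mul_specRad y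
        _ ≤ d * (1 / ((n : ℝ) + 1) * DeltaC (Q n) ^ i) := by
          gcongr
          exact (specRad_le_LamC_pow (hbdd n) i hy).trans (hlt n i hi hid).le
        _ = DeltaC (Q n) ^ i * (d / ((n : ℝ) + 1)) := by ring)
  have hle : DeltaC (Q n) ≤ DeltaC (Q n) * (1 / 2) := DeltaC_le (k * g n) (hne n) fun a ha => by
    have := hk _ (Set.mem_image_of_mem _ ha)
    simp only [φ] at this
    rwa [map_smul, norm_smul, hnorm, inv_mul_le_iff₀ (hΔ n), ← conjSL_mul] at this
  linarith [hΔ n]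

end Limit

end L2Norm

theorem stmt8 {d : ℕ} (hd : 1 ≤ d) :
    ∃ c : ℝ, 0 < c ∧ ∀ Q : Set (Matrix (Fin d) (Fin d) ℂ), Q.Nonempty → IsCompact Q →
      ∃ i : ℕ, 1 ≤ i ∧ i ≤ d ^ 2 ∧
        LamC (Q ^ i) ≤ DeltaC Q ^ i ∧ c * DeltaC Q ^ i ≤ LamC (Q ^ i) := by
  have : NeZero d := ⟨by omega⟩
  obtain ⟨c, hc, h⟩ := exists_mul_DeltaC_pow_le_LamC (d := d)
  refine ⟨c, hc, fun Q hne hQ => ?_⟩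
  have hQb := open scoped Matrix.Norms.L2Operator in hQ.isBounded
  obtain ⟨i, hi, hid, hle⟩ := h Q hne hQb
  exact ⟨i, hi, hid, LamC_pow_le_DeltaC_pow hne hQb i, hle⟩
end

section
/- Let R be a field and let 𝒜 ⊆ M_d(R) be a subset closed under matrix addition, matrix multiplication, and scalar multiplication by elements of R (i.e. a not necessarily unital R-subalgebra of M_d(R)). If 𝒜 is spanned as an R-vector space by nilpotent matrices, then 𝒜 is a nilpotent algebra: there exists n ≥ 1 such that every product of n elements of 𝒜 equals the zero matrix. -/
/-- In a finite-dimensional algebra over an algebraically closed field, a left ideal contained in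
the linear span of the nilpotent elements lies in the Jacobson radical. -/
theorem mem_jacobson_of_le_span_isNilpotent {K B : Type*} [Field K] [IsAlgClosed K] [Ring B]
    [Algebra K B] [FiniteDimensional K B] (I : Submodule K B)
    (hI : ∀ b : B, ∀ a ∈ I, b * a ∈ I) (hnil : I ≤ Submodule.span K {x : B | IsNilpotent x})
    {a : B} (ha : a ∈ I) : a ∈ Ring.jacobson B := by
  have : IsArtinianRing B := IsArtinianRing.of_finite K B
  obtain ⟨n, d, -, ⟨e⟩⟩ :=
    IsSemisimpleRing.exists_algEquiv_pi_matrix_of_isAlgClosed K (B ⧸ Ring.jacobson B)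
  let q : B →ₐ[K] B ⧸ Ring.jacobson B := Ideal.Quotient.mkₐ K _
  let φ (i : Fin n) : B →ₐ[K] Matrix (Fin (d i)) (Fin (d i)) K :=
    ((Pi.evalAlgHom K _ i).comp e.toAlgHom).comp q
  have htrace (i : Fin n) : ∀ x ∈ I, (φ i x).trace = 0 := by
    have : Submodule.span K {x : B | IsNilpotent x} ≤
        LinearMap.ker ((Matrix.traceLinearMap (Fin (d i)) K K) ∘ₗ (φ i).toLinearMap) :=
      Submodule.span_le.2 fun x hx =>
        (Matrix.isNilpotent_trace_of_isNilpotent (IsNilpotent.map hx (φ i))).eq_zero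
    exact fun x hx => this (hnil hx)
  have hφ (i : Fin n) : φ i a = 0 := by
    ext j k
    obtain ⟨b, hb⟩ : ∃ b : B, φ i b = Matrix.single k j 1 := by
      obtain ⟨b, hb⟩ := Ideal.Quotient.mk_surjective
        (e.symm (Pi.single i (Matrix.single k j 1)))
      refine ⟨b, ?_⟩
      change e (Ideal.Quotient.mk _ b) i = _
      simp [hb]
    simpa [hb, Matrix.trace_single_mul] using htrace i _ (hI b a ha)
  have hq : e (q a) = 0 := funext hφ
  exact Ideal.Quotient.eq_zero_iff_mem.1 ((map_eq_zero_iff e e.injective).1 hq)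

theorem Ideal.list_prod_mem_pow_length {B : Type*} [Ring B] (J : Ideal B) [J.IsTwoSided]
    (L : List B) (hL : ∀ x ∈ L, x ∈ J) : L.prod ∈ J ^ L.length := by
  induction L with
  | nil => simp [Submodule.pow_zero, Ideal.one_eq_top]
  | cons x L ih =>
    rw [List.prod_cons, List.length_cons, Ideal.IsTwoSided.pow_succ]
    exact Ideal.mul_mem_mul (hL x (by simp)) (ih fun y hy => hL y (by simp [hy]))

/-- Over an algebraically closed field, a multiplicatively closed subspace of a finite-dimensional
algebra which is spanned by nilpotent elements is nilpotent. -/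
theorem exists_list_prod_eq_zero_of_le_span_isNilpotent {K E : Type*} [Field K] [IsAlgClosed K]
    [Ring E] [Algebra K E] [FiniteDimensional K E] (S : Submodule K E)
    (hmul : ∀ a ∈ S, ∀ b ∈ S, a * b ∈ S)
    (hnil : S ≤ Submodule.span K {x : E | x ∈ S ∧ IsNilpotent x}) :
    ∃ n : ℕ, 1 ≤ n ∧ ∀ L : List E, (∀ x ∈ L, x ∈ S) → L.length = n → L.prod = 0 := by
  let B := Algebra.adjoin K (S : Set E)
  have hSB : ∀ x ∈ S, x ∈ B := fun x hx => Algebra.subset_adjoin hx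
  let I : Submodule K B := S.comap B.val.toLinearMap
  have hI (b : B) : ∀ a ∈ I, b * a ∈ I := by
    suffices ∀ a ∈ S, (b : E) * a ∈ S from fun a ha => this a ha
    refine Algebra.adjoin_induction (p := fun x _ => ∀ a ∈ S, x * a ∈ S) hmul ?_ ?_ ?_ b.2
    · intro r a ha
      simpa [← Algebra.smul_def] using S.smul_mem r ha
    · intro x y _ _ hx hy a ha
      simpa [add_mul] using S.add_mem (hx a ha) (hy a ha)
    · intro x y _ _ hx hy a ha
      simpa [mul_assoc] using hx _ (hy a ha)
  have hspan : I ≤ Submodule.span K {x : B | IsNilpotent x} := by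
    have hle : S ≤ (Submodule.span K {x : B | IsNilpotent x}).map B.val.toLinearMap := by
      refine hnil.trans (Submodule.span_le.2 fun x hx => ?_)
      refine ⟨⟨x, hSB x hx.1⟩, Submodule.subset_span ?_, rfl⟩
      exact (IsNilpotent.map_iff (f := B.val) Subtype.val_injective).1 hx.2
    intro x hx
    obtain ⟨y, hy, hyx⟩ := hle hx
    rwa [← Subtype.val_injective hyx]
  have : IsArtinianRing B := IsArtinianRing.of_finite K B
  obtain ⟨n, hn⟩ := IsSemiprimaryRing.isNilpotent (R := B)
  refine ⟨n + 1, by omega, fun L hL hlen => ?_⟩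
  lift L to List B using fun x hx => hSB x (hL x hx)
  have hmem := (Ring.jacobson B).list_prod_mem_pow_length L fun x hx =>
    mem_jacobson_of_le_span_isNilpotent I hI hspan (hL x (List.mem_map_of_mem hx))
  rw [List.length_map] at hlen
  have hprod : L.prod = 0 := by
    have := Ideal.pow_le_pow_right n.le_succ (hlen ▸ hmem)
    rwa [hn] at this
  simpa [hprod] using (map_list_prod B.val L).symm

theorem stmt9 {R : Type*} [Field R] {d : ℕ}
    (A : Set (Matrix (Fin d) (Fin d) R))
    (hadd : ∀ a ∈ A, ∀ b ∈ A, a + b ∈ A)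
    (hmul : ∀ a ∈ A, ∀ b ∈ A, a * b ∈ A)
    (hsmul : ∀ (r : R), ∀ a ∈ A, r • a ∈ A)
    (hspan : A ⊆ (Submodule.span R {N : Matrix (Fin d) (Fin d) R | N ∈ A ∧ IsNilpotent N} :
      Submodule R (Matrix (Fin d) (Fin d) R))) :
    ∃ n : ℕ, 1 ≤ n ∧ ∀ L : List (Matrix (Fin d) (Fin d) R),
      (∀ x ∈ L, x ∈ A) → L.length = n → L.prod = 0 := by
  let K := AlgebraicClosure R
  let f : Matrix (Fin d) (Fin d) R →ₐ[R] Matrix (Fin d) (Fin d) K :=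
    (Algebra.ofId R K).mapMatrix
  have hf : Function.Injective f := Matrix.map_injective (algebraMap R K).injective
  let S := Submodule.span K (f '' A)
  have hfS : ∀ x ∈ A, f x ∈ S := fun x hx => Submodule.subset_span ⟨x, hx, rfl⟩
  have hSmul : ∀ a ∈ S, ∀ b ∈ S, a * b ∈ S := by
    have hSS : S * S ≤ S := by
      rw [Submodule.span_mul_span]
      refine Submodule.span_mono ?_
      rintro _ ⟨_, ⟨a, ha, rfl⟩, _, ⟨b, hb, rfl⟩, rfl⟩
      exact ⟨a * b, hmul a ha b hb, map_mul f a b⟩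
    exact fun a ha b hb => hSS (Submodule.mul_mem_mul ha hb)
  have hSnil : S ≤ Submodule.span K {x | x ∈ S ∧ IsNilpotent x} := by
    have hle : Submodule.span R {N : Matrix (Fin d) (Fin d) R | N ∈ A ∧ IsNilpotent N} ≤
        ((Submodule.span K {x | x ∈ S ∧ IsNilpotent x}).restrictScalars R).comap
          f.toLinearMap :=
      Submodule.span_le.2 fun x hx => Submodule.subset_span ⟨hfS x hx.1, hx.2.map f⟩
    refine Submodule.span_le.2 ?_
    rintro _ ⟨a, ha, rfl⟩
    exact hle (hspan ha)
  obtain ⟨n, hn, h⟩ := exists_list_prod_eq_zero_of_le_span_isNilpotent S hSmul hSnil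
  refine ⟨n, hn, fun L hL hlen => hf ?_⟩
  rw [map_list_prod, map_zero]
  refine h _ (fun x hx => ?_) (by simpa using hlen)
  obtain ⟨a, ha, rfl⟩ := List.mem_map.1 hx
  exact hfS a (hL a ha)
end
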